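/- Suppose the entries K_{ij} of the symmetric weight matrices K = K^{(n)} satisfy Conditions (C1)–(C6) (with R replaced by K) together with the additional condition (C7): max_{i,j} K_{ij} = o(n² r_d²) as n → ∞. Then for every integer m ≥ 1 and every 0 < u_1 < … < u_m < 1, the joint random vector (Z_w^π(⌊n·u_1⌋), …, Z_w^π(⌊n·u_m⌋), Z_diff^π(⌊n·u_1⌋), …, Z_diff^π(⌊n·u_m⌋)) under the permutation null distribution converges in distribution, as n → ∞, to a centered 2m-dimensional Gaussian random vector whose covariance matrix is block diagonal, equal to ρ_w*(u_i,u_j) on the first m×m block, equal to ρ_diff*(u_i,u_j) on the last m×m block, and with all cross-covariances between the Z_w-coordinates and the Z_diff-coordinates equal to zero. -/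

import Mathlib

open Finset Filter Asymptotics MeasureTheory ProbabilityTheory Topology

namespace RING

/-- `U1^π(t1,t2)`: sum of `R (π i) (π j)` over indices (1-based `i,j ∈ {1,…,n}`,
represented by `Fin n` with `i` standing for index `i+1`) with `t1 < i ≤ t2` and
`t1 < j ≤ t2`. -/
noncomputable def U1 (n : ℕ) (R : Fin n → Fin n → ℝ) (π : Equiv.Perm (Fin n))
    (t1 t2 : ℕ) : ℝ :=
  ∑ i : Fin n, ∑ j : Fin n,
    if t1 ≤ (i : ℕ) ∧ (i : ℕ) < t2 ∧ t1 ≤ (j : ℕ) ∧ (j : ℕ) < t2 then R (π i) (π j) else 0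

/-- `U2^π(t1,t2)`: sum of `R (π i) (π j)` over indices with `i ≤ t1` or `i > t2`,
and `j ≤ t1` or `j > t2`. -/
noncomputable def U2 (n : ℕ) (R : Fin n → Fin n → ℝ) (π : Equiv.Perm (Fin n))
    (t1 t2 : ℕ) : ℝ :=
  ∑ i : Fin n, ∑ j : Fin n,
    if ((i : ℕ) < t1 ∨ t2 ≤ (i : ℕ)) ∧ ((j : ℕ) < t1 ∨ t2 ≤ (j : ℕ)) then R (π i) (π j) else 0

/-- Expectation under the permutation null distribution (uniform over all `n!`
permutations). -/
noncomputable def pexp (n : ℕ) (f : Equiv.Perm (Fin n) → ℝ) : ℝ :=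
  (∑ π : Equiv.Perm (Fin n), f π) / (Nat.factorial n)

/-- Variance under the permutation null distribution. -/
noncomputable def pvar (n : ℕ) (f : Equiv.Perm (Fin n) → ℝ) : ℝ :=
  pexp n (fun π => (f π - pexp n f) ^ 2)

/-- Covariance under the permutation null distribution. -/
noncomputable def pcov (n : ℕ) (f g : Equiv.Perm (Fin n) → ℝ) : ℝ :=
  pexp n (fun π => (f π - pexp n f) * (g π - pexp n g))

/-- `R̄_{i·} = (Σ_j R_{ij})/(n-1)`. -/
noncomputable def Rbar (n : ℕ) (R : Fin n → Fin n → ℝ) (i : Fin n) : ℝ :=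
  (∑ j : Fin n, R i j) / ((n : ℝ) - 1)

/-- `r0 = (1/n) Σ_i R̄_{i·}`. -/
noncomputable def r0 (n : ℕ) (R : Fin n → Fin n → ℝ) : ℝ :=
  (∑ i : Fin n, Rbar n R i) / n

/-- `r1² = (1/n) Σ_i R̄_{i·}²`. -/
noncomputable def r1sq (n : ℕ) (R : Fin n → Fin n → ℝ) : ℝ :=
  (∑ i : Fin n, (Rbar n R i) ^ 2) / n

/-- `r_d² = (1/(n(n-1))) Σ_i Σ_j R_{ij}²`. -/
noncomputable def rdsq (n : ℕ) (R : Fin n → Fin n → ℝ) : ℝ :=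
  (∑ i : Fin n, ∑ j : Fin n, (R i j) ^ 2) / ((n : ℝ) * ((n : ℝ) - 1))

/-- `U_diff^π = U1^π − U2^π`. -/
noncomputable def Udiff (n : ℕ) (R : Fin n → Fin n → ℝ) (π : Equiv.Perm (Fin n))
    (t1 t2 : ℕ) : ℝ :=
  U1 n R π t1 t2 - U2 n R π t1 t2

/-- `U_w^π = ((n−t2+t1−1)·U1^π + (t2−t1−1)·U2^π)/(n−2)`. -/
noncomputable def Uw (n : ℕ) (R : Fin n → Fin n → ℝ) (π : Equiv.Perm (Fin n))
    (t1 t2 : ℕ) : ℝ :=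
  (((n : ℝ) - t2 + t1 - 1) * U1 n R π t1 t2 + ((t2 : ℝ) - t1 - 1) * U2 n R π t1 t2) /
    ((n : ℝ) - 2)

/-- Standardized `Z_w^π(t1,t2)`. -/
noncomputable def Zw (n : ℕ) (R : Fin n → Fin n → ℝ) (π : Equiv.Perm (Fin n))
    (t1 t2 : ℕ) : ℝ :=
  (Uw n R π t1 t2 - pexp n (fun σ => Uw n R σ t1 t2)) /
    Real.sqrt (pvar n (fun σ => Uw n R σ t1 t2))

/-- Standardized `Z_diff^π(t1,t2)`. -/
noncomputable def Zdiff (n : ℕ) (R : Fin n → Fin n → ℝ) (π : Equiv.Perm (Fin n))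
    (t1 t2 : ℕ) : ℝ :=
  (Udiff n R π t1 t2 - pexp n (fun σ => Udiff n R σ t1 t2)) /
    Real.sqrt (pvar n (fun σ => Udiff n R σ t1 t2))

/-- Discrete σ-algebra on the finite permutation group. -/
instance (n : ℕ) : MeasurableSpace (Equiv.Perm (Fin n)) := ⊤

/-- The permutation null distribution: the uniform probability measure on the
`n!` permutations of `{1,…,n}`. -/
noncomputable def permP (n : ℕ) : ProbabilityMeasure (Equiv.Perm (Fin n)) :=
  ⟨(PMF.uniformOfFintype (Equiv.Perm (Fin n))).toMeasure,
    PMF.toMeasure.isProbabilityMeasure _⟩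

/-- The distribution of a real-valued statistic under the permutation null
distribution. -/
noncomputable def permDist (n : ℕ) (f : Equiv.Perm (Fin n) → ℝ) : ProbabilityMeasure ℝ :=
  (permP n).map (f := f) (Measurable.aemeasurable (fun _ _ => trivial))

/-- The centered Gaussian distribution on `ℝ` with variance `v` (for `v ≥ 0`). -/
noncomputable def gaussLimit (v : ℝ) : ProbabilityMeasure ℝ :=
  ⟨gaussianReal 0 (Real.toNNReal v), inferInstance⟩

/-- `ρ_w*(u,v) = (u∧v)(1−(u∨v))/((u∨v)(1−(u∧v)))`. -/
noncomputable def rhoW (u v : ℝ) : ℝ :=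
  (min u v * (1 - max u v)) / (max u v * (1 - min u v))

/-- `ρ_diff*(u,v) = (u∧v)(1−(u∨v))/√((u∧v)(1−(u∧v))·(u∨v)(1−(u∨v)))`. -/
noncomputable def rhoDiff (u v : ℝ) : ℝ :=
  (min u v * (1 - max u v)) /
    Real.sqrt (min u v * (1 - min u v) * (max u v * (1 - max u v)))

/-- Condition (C1): `Σ_i (Σ_j R_{ij}²)² = O(n³ r_d⁴)`. -/
def Cond1 (R : (n : ℕ) → Fin n → Fin n → ℝ) : Prop :=
  (fun n => ∑ i : Fin n, (∑ j : Fin n, (R n i j) ^ 2) ^ 2)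
    =O[atTop] fun n => (n : ℝ) ^ 3 * (rdsq n (R n)) ^ 2

/-- Condition (C2): `Σ_i |R̄_{i·} − r0|³ = o((n(r1² − r0²))^{3/2})`. -/
def Cond2 (R : (n : ℕ) → Fin n → Fin n → ℝ) : Prop :=
  (fun n => ∑ i : Fin n, |Rbar n (R n) i - r0 n (R n)| ^ 3)
    =o[atTop] fun n => ((n : ℝ) * (r1sq n (R n) - (r0 n (R n)) ^ 2)) ^ ((3 : ℝ) / 2)

/-- Condition (C3): `Σ_i (R̄_{i·} − r0)³ = o(n·r_d·(r1² − r0²))`. -/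
def Cond3 (R : (n : ℕ) → Fin n → Fin n → ℝ) : Prop :=
  (fun n => ∑ i : Fin n, (Rbar n (R n) i - r0 n (R n)) ^ 3)
    =o[atTop] fun n =>
      (n : ℝ) * Real.sqrt (rdsq n (R n)) * (r1sq n (R n) - (r0 n (R n)) ^ 2)

/-- Condition (C4): `|Σ_{i≠j≠k} R_{ji} R_{ik} (R̄_{j·} − r0)(R̄_{k·} − r0)| =
o(n³ r_d² (r1² − r0²))`. -/
def Cond4 (R : (n : ℕ) → Fin n → Fin n → ℝ) : Prop :=
  (fun n =>
      |∑ i : Fin n, ∑ j : Fin n, ∑ k : Fin n,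
        if i ≠ j ∧ i ≠ k ∧ j ≠ k then
          R n j i * R n i k * (Rbar n (R n) j - r0 n (R n)) * (Rbar n (R n) k - r0 n (R n))
        else 0|)
    =o[atTop] fun n => (n : ℝ) ^ 3 * rdsq n (R n) * (r1sq n (R n) - (r0 n (R n)) ^ 2)

/-- Condition (C5): `Σ_i Σ_j Σ_{k∉{i,j}} Σ_{l∉{i,j}} R_{ij} R_{kl}
(R_{ik} R_{jl} + R_{il} R_{jk}) = o(n⁴ r_d⁴)`. -/
def Cond5 (R : (n : ℕ) → Fin n → Fin n → ℝ) : Prop :=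
  (fun n =>
      ∑ i : Fin n, ∑ j : Fin n, ∑ k : Fin n, ∑ l : Fin n,
        if k ≠ i ∧ k ≠ j ∧ l ≠ i ∧ l ≠ j then
          R n i j * R n k l * (R n i k * R n j l + R n i l * R n j k)
        else 0)
    =o[atTop] fun n => (n : ℝ) ^ 4 * (rdsq n (R n)) ^ 2

/-- Condition (C6): `r1 = o(r_d)`. -/
def Cond6 (R : (n : ℕ) → Fin n → Fin n → ℝ) : Prop :=
  (fun n => Real.sqrt (r1sq n (R n))) =o[atTop] fun n => Real.sqrt (rdsq n (R n))

end RING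

open RING

/-- Condition (C7): `max_{i,j} K_{ij} = o(n² r_d²)`. -/
def Cond7 (K : (n : ℕ) → Fin n → Fin n → ℝ) : Prop :=
  (fun n => ⨆ i : Fin n, ⨆ j : Fin n, K n i j)
    =o[Filter.atTop] fun n => (n : ℝ) ^ 2 * RING.rdsq n (K n)

namespace RING

/-! ### Second moments of exchangeable linear and quadratic statistics -/

lemma exists_perm_map_tuple {ι : Type*} {k : ℕ} {f g : Fin k → ι} (hf : Function.Injective f)
    (hg : Function.Injective g) : ∃ σ : Equiv.Perm ι, ∀ i, σ (f i) = g i := by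
  obtain ⟨σ, hσ⟩ := (Equiv.Perm.isMultiplyPretransitive ι k).exists_smul_eq ⟨f, hf⟩ ⟨g, hg⟩
  exact ⟨σ, fun i => by simpa using DFunLike.congr_fun hσ i⟩

section Exchangeable

variable {Ω ι : Type*} [Fintype Ω] [Fintype ι] [DecidableEq ι]

lemma sum_sq_linear_of_pattern (Y : Ω → ι → ℝ) (b : ι → ℝ) (e₁ e₂ : ℝ)
    (h₁ : ∀ a, ∑ ω, Y ω a * Y ω a = e₁) (h₂ : ∀ a c, a ≠ c → ∑ ω, Y ω a * Y ω c = e₂) :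
    ∑ ω, (∑ a, b a * Y ω a) ^ 2 = e₂ * (∑ a, b a) ^ 2 + (e₁ - e₂) * ∑ a, b a ^ 2 := by
  have expand : ∑ ω, (∑ a, b a * Y ω a) ^ 2
      = ∑ a, ∑ c, b a * b c * ∑ ω, Y ω a * Y ω c := by
    simp_rw [sq, Finset.sum_mul_sum, Finset.mul_sum]
    rw [Finset.sum_comm]
    refine Finset.sum_congr rfl fun a _ => ?_
    rw [Finset.sum_comm]
    refine Finset.sum_congr rfl fun c _ => Finset.sum_congr rfl fun ω _ => by ring
  have pat : ∀ a c, b a * b c * ∑ ω, Y ω a * Y ω c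
      = b a * (b c * e₂) + if a = c then b a ^ 2 * (e₁ - e₂) else 0 := by
    intro a c
    by_cases h : a = c
    · subst h; simp [h₁]; ring
    · simp [h, h₂ a c h]; ring
  simp_rw [expand, pat, Finset.sum_add_distrib, ← Finset.mul_sum, ← Finset.sum_mul]
  simp only [Finset.sum_ite_eq, Finset.mem_univ, if_true, ← Finset.sum_mul]
  ring

lemma sum_sq_quadratic_of_pattern (X : Ω → ι → ι → ℝ) (H : ι → ι → ℝ)
    (hX : ∀ ω a b, X ω a b = X ω b a)
    (hH : ∀ a b, H a b = H b a) (hd : ∀ a, H a a = 0) (hrow : ∀ a, ∑ b, H a b = 0)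
    (e₂ e₃ e₄ : ℝ)
    (h₂ : ∀ a b, a ≠ b → ∑ ω, X ω a b * X ω a b = e₂)
    (h₃ : ∀ a b c, a ≠ b → a ≠ c → b ≠ c → ∑ ω, X ω a b * X ω a c = e₃)
    (h₄ : ∀ a b c d, a ≠ b → a ≠ c → a ≠ d → b ≠ c → b ≠ d → c ≠ d →
      ∑ ω, X ω a b * X ω c d = e₄) :
    ∑ ω, (∑ a, ∑ b, H a b * X ω a b) ^ 2
      = 2 * (e₂ - 2 * e₃ + e₄) * ∑ a, ∑ b, H a b ^ 2 := by
  have expand : ∑ ω, (∑ a, ∑ b, H a b * X ω a b) ^ 2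
      = ∑ a, ∑ b, ∑ c, ∑ d, H a b * H c d * ∑ ω, X ω a b * X ω c d := by
    simp_rw [sq, Finset.sum_mul_sum, Finset.mul_sum]
    rw [Finset.sum_comm]
    refine Finset.sum_congr rfl fun a _ => ?_
    rw [Finset.sum_comm]
    conv_rhs => rw [Finset.sum_comm]
    refine Finset.sum_congr rfl fun c _ => ?_
    rw [Finset.sum_comm]
    refine Finset.sum_congr rfl fun b _ => ?_
    rw [Finset.sum_comm]
    refine Finset.sum_congr rfl fun d _ => Finset.sum_congr rfl fun ω _ => by ring
  have hcol : ∀ a, ∑ b, H b a = 0 := fun a => by simpa only [hH _ a] using hrow a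
  have pat : ∀ a b c d, H a b * H c d * ∑ ω, X ω a b * X ω c d
      = H a b * (H c d * e₄)
        + ((if a = c then H a b * (H a d * (e₃ - e₄)) else 0)
          + (if a = d then H a b * (H c a * (e₃ - e₄)) else 0)
          + (if b = c then H a b * (H b d * (e₃ - e₄)) else 0)
          + (if b = d then H a b * (H c b * (e₃ - e₄)) else 0))
        + ((if a = c then (if b = d then H a b ^ 2 * (e₂ - 2 * e₃ + e₄) else 0) else 0)
          + (if a = d then (if b = c then H a b ^ 2 * (e₂ - 2 * e₃ + e₄) else 0) else 0)) := by
    intro a b c d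
    by_cases hab : a = b
    · subst hab; simp [hd]
    by_cases hcd : c = d
    · subst hcd
      by_cases hac : a = c <;> by_cases hbc : b = c <;> simp_all
    by_cases hac : a = c
    · subst hac
      by_cases hbd : b = d
      · subst hbd
        simp [hab, Ne.symm hab, h₂ a b hab]
        ring
      · simp [hcd, Ne.symm hab, hbd, h₃ a b d hab hcd hbd]
        ring
    · by_cases had : a = d
      · subst had
        by_cases hbc : b = c
        · subst hbc
          simp only [hX _ b a, h₂ a b hab, hH b a]
          simp [hab, Ne.symm hab]
          ring
        · simp only [hX _ c a, h₃ a b c hab hac hbc, hH c a]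
          simp [hac, Ne.symm hab, hbc]
          ring
      · by_cases hbc : b = c
        · subst hbc
          simp only [hX _ a b, h₃ b a d (Ne.symm hab) hcd had]
          simp [hab, had, hcd]
          ring
        · by_cases hbd : b = d
          · subst hbd
            simp only [hX _ a b, hX _ c b, h₃ b a c (Ne.symm hab) hbc hac, hH c b]
            simp [hac, hab, hbc]
            ring
          · simp [hac, had, hbc, hbd, h₄ a b c d hab hac had hbc hbd hcd]
            ring
  simp_rw [expand, pat, Finset.sum_add_distrib]
  simp [← Finset.mul_sum, ← Finset.sum_mul, hrow, hcol]
  ring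

lemma abs_sum_mul_le_of_sum_sq_le {f g : Ω → ℝ} {e : ℝ} (hf : ∑ ω, f ω * f ω ≤ e)
    (hg : ∑ ω, g ω * g ω ≤ e) : |∑ ω, f ω * g ω| ≤ e := by
  have h1 : ∑ ω, (f ω * g ω) ≤ ∑ ω, (f ω * f ω + g ω * g ω) / 2 :=
    Finset.sum_le_sum fun ω _ => by nlinarith [sq_nonneg (f ω - g ω)]
  have h2 : ∑ ω, -(f ω * g ω) ≤ ∑ ω, (f ω * f ω + g ω * g ω) / 2 :=
    Finset.sum_le_sum fun ω _ => by nlinarith [sq_nonneg (f ω + g ω)]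
  rw [Finset.sum_neg_distrib] at h2
  rw [← Finset.sum_div, Finset.sum_add_distrib] at h1 h2
  exact abs_le.2 ⟨by linarith, by linarith⟩

lemma sum_sq_linear_le_of_exchangeable (hcard : 2 ≤ Fintype.card ι) (Y : Ω → ι → ℝ) (b : ι → ℝ)
    (hb : ∑ a, b a = 0)
    (hex : ∀ (σ : Equiv.Perm ι) (a c : ι),
      ∑ ω, Y ω (σ a) * Y ω (σ c) = ∑ ω, Y ω a * Y ω c)
    (e : ℝ) (he : ∀ a, ∑ ω, Y ω a * Y ω a ≤ e) :
    ∑ ω, (∑ a, b a * Y ω a) ^ 2 ≤ 2 * e * ∑ a, b a ^ 2 := by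
  obtain ⟨f⟩ := Function.Embedding.nonempty_of_card_le (α := Fin 2) (β := ι) (by simpa using hcard)
  rw [sum_sq_linear_of_pattern Y b (∑ ω, Y ω (f 0) * Y ω (f 0)) (∑ ω, Y ω (f 0) * Y ω (f 1)), hb]
  · have h1 := he (f 0)
    have h2 := (abs_le.1 (abs_sum_mul_le_of_sum_sq_le h1 (he (f 1)))).1
    have : 0 ≤ ∑ a, b a ^ 2 := by positivity
    nlinarith
  · intro a
    obtain ⟨σ, hσ⟩ := MulAction.exists_smul_eq (Equiv.Perm ι) (f 0) a
    rw [Equiv.Perm.smul_def] at hσ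
    rw [← hex σ (f 0), hσ]
  · intro a c hac
    obtain ⟨σ, hσ⟩ := exists_perm_map_tuple f.injective (g := ![a, c])
      (by intro i j; fin_cases i <;> fin_cases j <;> simp_all [eq_comm])
    have h0 : σ (f 0) = a := hσ 0
    have h1 : σ (f 1) = c := hσ 1
    rw [← hex σ (f 0), h0, h1]

lemma sum_sq_quadratic_le_of_exchangeable (hcard : 4 ≤ Fintype.card ι) (X : Ω → ι → ι → ℝ)
    (H : ι → ι → ℝ) (hX : ∀ ω a b, X ω a b = X ω b a)
    (hH : ∀ a b, H a b = H b a) (hd : ∀ a, H a a = 0) (hrow : ∀ a, ∑ b, H a b = 0)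
    (hex : ∀ (σ : Equiv.Perm ι) (a b c d : ι),
      ∑ ω, X ω (σ a) (σ b) * X ω (σ c) (σ d) = ∑ ω, X ω a b * X ω c d)
    (e : ℝ) (he : ∀ a b, a ≠ b → ∑ ω, X ω a b * X ω a b ≤ e) :
    ∑ ω, (∑ a, ∑ b, H a b * X ω a b) ^ 2 ≤ 8 * e * ∑ a, ∑ b, H a b ^ 2 := by
  obtain ⟨f⟩ := Function.Embedding.nonempty_of_card_le (α := Fin 4) (β := ι) (by simpa using hcard)
  have hne : ∀ i j : Fin 4, i ≠ j → f i ≠ f j := fun i j h => f.injective.ne h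
  rw [sum_sq_quadratic_of_pattern X H hX hH hd hrow (∑ ω, X ω (f 0) (f 1) * X ω (f 0) (f 1))
    (∑ ω, X ω (f 0) (f 1) * X ω (f 0) (f 2)) (∑ ω, X ω (f 0) (f 1) * X ω (f 2) (f 3))]
  · have h1 := he _ _ (hne 0 1 (by decide))
    have h2 := (abs_le.1 (abs_sum_mul_le_of_sum_sq_le h1 (he _ _ (hne 0 2 (by decide))))).1
    have h3 := (abs_le.1 (abs_sum_mul_le_of_sum_sq_le h1 (he _ _ (hne 2 3 (by decide))))).2
    have : 0 ≤ ∑ a, ∑ b, H a b ^ 2 := by positivity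
    nlinarith
  · intro a b hab
    have hne := hne 0 1 (by decide)
    obtain ⟨σ, hσ⟩ := exists_perm_map_tuple (f := ![f 0, f 1]) (g := ![a, b])
      (by intro i j; fin_cases i <;> fin_cases j <;> simp_all [eq_comm])
      (by intro i j; fin_cases i <;> fin_cases j <;> simp_all [eq_comm])
    have h0 : σ (f 0) = a := hσ 0
    have h1 : σ (f 1) = b := hσ 1
    rw [← hex σ (f 0), h0, h1]
  · intro a b c hab hac hbc
    have h12 := hne 1 2 (by decide)
    have h01 := hne 0 1 (by decide)
    have h02 := hne 0 2 (by decide)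
    obtain ⟨σ, hσ⟩ := exists_perm_map_tuple (f := ![f 0, f 1, f 2]) (g := ![a, b, c])
      (by intro i j; fin_cases i <;> fin_cases j <;> simp_all [eq_comm])
      (by intro i j; fin_cases i <;> fin_cases j <;> simp_all [eq_comm])
    have h0 : σ (f 0) = a := hσ 0
    have h1 : σ (f 1) = b := hσ 1
    have h2 : σ (f 2) = c := hσ 2
    rw [← hex σ (f 0), h0, h1, h2]
  · intro a b c d hab hac had hbc hbd hcd
    obtain ⟨σ, hσ⟩ := exists_perm_map_tuple f.injective (g := ![a, b, c, d])
      (by intro i j; fin_cases i <;> fin_cases j <;> simp_all [eq_comm])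
    have h0 : σ (f 0) = a := hσ 0
    have h1 : σ (f 1) = b := hσ 1
    have h2 : σ (f 2) = c := hσ 2
    have h3 : σ (f 3) = d := hσ 3
    rw [← hex σ (f 0), h0, h1, h2, h3]

end Exchangeable

/-! ### Permutations coupled with independent uniform positions -/

section Coupling

variable {n : ℕ}

/-- The quadratic statistic `∑ H k l φ (f k) φ (f l)` of the positions `f`. -/
noncomputable def qstat (H : Fin n → Fin n → ℝ) (φ : Fin n → ℝ) (f : Fin n → Fin n) : ℝ :=
  ∑ k, ∑ l, H k l * (φ (f k) * φ (f l))

/-- The linear statistic `∑ b k φ (f k)` of the positions `f`. -/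
noncomputable def lstat (b : Fin n → ℝ) (φ : Fin n → ℝ) (f : Fin n → Fin n) : ℝ :=
  ∑ k, b k * φ (f k)

/-- The centred indicator of the first `t` positions. -/
noncomputable def cind (n t : ℕ) (i : Fin n) : ℝ :=
  (if (i : ℕ) < t then 1 else 0) - (t : ℝ) / n

lemma sum_indicator_lt {t : ℕ} (ht : t ≤ n) :
    ∑ i : Fin n, (if (i : ℕ) < t then (1 : ℝ) else 0) = t := by
  rw [Fin.sum_univ_eq_sum_range (fun i => if i < t then (1 : ℝ) else 0) n, Finset.sum_boole]
  congr 1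
  have : {x ∈ Finset.range n | x < t} = Finset.range t := by
    ext x; simp; omega
  rw [this, Finset.card_range]

lemma sum_cind {t : ℕ} (ht : t ≤ n) : ∑ i, cind n t i = 0 := by
  rcases Nat.eq_zero_or_pos n with rfl | hn
  · simp
  have : (n : ℝ) ≠ 0 := by positivity
  simp only [cind, Finset.sum_sub_distrib, sum_indicator_lt ht]
  simp
  field_simp
  simp

lemma sum_cind_mul_cind {s t : ℕ} (hst : s ≤ t) (ht : t ≤ n) :
    ∑ i, cind n s i * cind n t i = (s : ℝ) * (n - t) / n := by
  rcases Nat.eq_zero_or_pos n with rfl | hn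
  · simp
  have hn' : (n : ℝ) ≠ 0 := by positivity
  have : ∀ i, cind n s i * cind n t i = (if (i : ℕ) < s then (1 : ℝ) else 0)
      - (t : ℝ) / n * (if (i : ℕ) < s then (1 : ℝ) else 0)
      - (s : ℝ) / n * (if (i : ℕ) < t then (1 : ℝ) else 0) + (s : ℝ) / n * ((t : ℝ) / n) := by
    intro i
    simp only [cind]
    by_cases h1 : (i : ℕ) < s
    · have h2 : (i : ℕ) < t := by omega
      simp only [h1, h2, if_true]
      ring
    · simp only [h1, if_false]
      ring
  simp_rw [this, Finset.sum_add_distrib, Finset.sum_sub_distrib, ← Finset.mul_sum,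
    sum_indicator_lt ht, sum_indicator_lt (hst.trans ht)]
  simp
  field_simp
  ring

lemma abs_cind_le {t : ℕ} (ht : t ≤ n) (i : Fin n) : |cind n t i| ≤ 1 := by
  have hn : 0 < n := i.pos
  have h0 : (0 : ℝ) ≤ (t : ℝ) / n := by positivity
  have h1 : (t : ℝ) / n ≤ 1 := by
    rw [div_le_one (by positivity)]; exact_mod_cast ht
  rw [abs_le, cind]
  split_ifs <;> constructor <;> linarith

lemma sum_fun_four (F₁ F₂ F₃ F₄ : Fin n → ℝ) (a b c d : Fin n) :
    ∑ f : Fin n → Fin n, F₁ (f a) * F₂ (f b) * (F₃ (f c) * F₄ (f d))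
      = ∏ k, ∑ i, (if k = a then F₁ i else 1) * (if k = b then F₂ i else 1)
        * ((if k = c then F₃ i else 1) * (if k = d then F₄ i else 1)) := by
  rw [Finset.prod_univ_sum, Fintype.piFinset_univ]
  refine Finset.sum_congr rfl fun f _ => ?_
  simp only [Finset.prod_mul_distrib, Finset.prod_ite_eq', Finset.mem_univ, if_true]

lemma sum_fun_lstat_sq (hn : 0 < n) (b φ : Fin n → ℝ) (hφ : ∑ i, φ i = 0) :
    ∑ f : Fin n → Fin n, lstat b φ f ^ 2
      = (n : ℝ) ^ n * ((∑ i, φ i ^ 2) / n * ∑ k, b k ^ 2) := by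
  have hn' : (n : ℝ) ≠ 0 := by positivity
  have pair := fun (F₁ F₂ : Fin n → ℝ) a b => sum_fun_four F₁ F₂ (fun _ => 1) (fun _ => 1) a b a b
  simp only [mul_one, ite_self] at pair
  unfold lstat
  rw [sum_sq_linear_of_pattern (fun (f : Fin n → Fin n) k => φ (f k)) b ((n : ℝ) ^ n * ((∑ i, φ i ^ 2) / n)) 0]
  · ring
  · intro a
    rw [pair]
    have : ∀ k : Fin n, (∑ i, (if k = a then φ i else 1) * (if k = a then φ i else 1))
        = n * (if k = a then (∑ i, φ i ^ 2) / n else 1) := by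
      intro k
      by_cases h : k = a
      · simp [h]; field_simp
      · simp [h]
    simp_rw [this, Finset.prod_mul_distrib]
    simp
  · intro a c hac
    rw [pair]
    exact Finset.prod_eq_zero (Finset.mem_univ a) (by simp [hac, hφ])

lemma sum_fun_qstat_sq (hn : 0 < n) (H : Fin n → Fin n → ℝ) (φ : Fin n → ℝ)
    (hφ : ∑ i, φ i = 0)
    (hH : ∀ a b, H a b = H b a) (hd : ∀ a, H a a = 0) (hrow : ∀ a, ∑ b, H a b = 0) :
    ∑ f : Fin n → Fin n, qstat H φ f ^ 2
      = (n : ℝ) ^ n * (2 * ((∑ i, φ i ^ 2) / n) ^ 2 * ∑ k, ∑ l, H k l ^ 2) := by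
  have hn' : (n : ℝ) ≠ 0 := by positivity
  unfold qstat
  rw [sum_sq_quadratic_of_pattern (fun (f : Fin n → Fin n) k l => φ (f k) * φ (f l)) H
    (fun _ _ _ => mul_comm _ _) hH hd hrow ((n : ℝ) ^ n * ((∑ i, φ i ^ 2) / n) ^ 2) 0 0]
  · ring
  · intro a b hab
    rw [sum_fun_four]
    have : ∀ k : Fin n, (∑ i, (if k = a then φ i else 1) * (if k = b then φ i else 1)
        * ((if k = a then φ i else 1) * (if k = b then φ i else 1)))
        = n * ((if k = a then (∑ i, φ i ^ 2) / n else 1)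
          * (if k = b then (∑ i, φ i ^ 2) / n else 1)) := by
      intro k
      by_cases h : k = a
      · subst h
        simp [hab]; field_simp
      · by_cases h' : k = b
        · simp [h', Ne.symm hab]; field_simp
        · simp [h, h']
    simp_rw [this, Finset.prod_mul_distrib]
    simp
    ring
  · intro a b c hab hac hbc
    rw [sum_fun_four]
    exact Finset.prod_eq_zero (Finset.mem_univ b) (by simp [Ne.symm hab, hbc, hφ])
  · intro a b c d hab hac had hbc hbd hcd
    rw [sum_fun_four]
    exact Finset.prod_eq_zero (Finset.mem_univ a) (by simp [hab, hac, had, hφ])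

/-- The increasing rearrangement of `f`. -/
def srt (f : Fin n → Fin n) : Fin n → Fin n := f ∘ Tuple.sort f

lemma monotone_srt (f : Fin n → Fin n) : Monotone (srt f) := Tuple.monotone_sort f

lemma srt_lt_iff (f : Fin n → Fin n) (t : ℕ) (i : Fin n) :
    (srt f i : ℕ) < t ↔ (i : ℕ) < #{k | (f k : ℕ) < t} := by
  have hcard : #{k | (f k : ℕ) < t} = #{k | (srt f k : ℕ) < t} := by
    refine Finset.card_bij (fun k _ => (Tuple.sort f).symm k) ?_ ?_ ?_
    · intro k hk
      simp only [Finset.mem_filter, Finset.mem_univ, true_and] at hk ⊢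
      simpa [srt] using hk
    · intro k _ l _ h; simpa using h
    · intro k hk
      simp only [Finset.mem_filter, Finset.mem_univ, true_and] at hk
      exact ⟨Tuple.sort f k, by simpa [srt] using hk, by simp⟩
  rw [hcard]
  constructor
  · intro h
    have hsub : Finset.Iic i ⊆ ({k | (srt f k : ℕ) < t} : Finset (Fin n)) := by
      intro k hk
      have : srt f k ≤ srt f i := monotone_srt f (Finset.mem_Iic.1 hk)
      simp only [Finset.mem_filter, Finset.mem_univ, true_and]
      exact lt_of_le_of_lt (Fin.le_def.1 this) h
    have := Finset.card_le_card hsub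
    rw [Fin.card_Iic] at this
    omega
  · intro h
    by_contra hi
    have hsub : ({k | (srt f k : ℕ) < t} : Finset (Fin n)) ⊆ Finset.Iio i := by
      intro k hk
      simp only [Finset.mem_filter, Finset.mem_univ, true_and] at hk
      rw [Finset.mem_Iio]
      by_contra hki
      have : srt f i ≤ srt f k := monotone_srt f (not_lt.1 hki)
      exact hi (lt_of_le_of_lt (Fin.le_def.1 this) hk)
    have := Finset.card_le_card hsub
    rw [Fin.card_Iio] at this
    omega

lemma sum_sq_cind_sub_srt {t : ℕ} (ht : t ≤ n) (f : Fin n → Fin n) :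
    ∑ i, (cind n t i - cind n t (srt f i)) ^ 2 = |lstat (fun _ => 1) (cind n t) f| := by
  rcases Nat.eq_zero_or_pos n with rfl | hn
  · simp [lstat]
  set N := #{k | (f k : ℕ) < t} with hN
  have hNn : N ≤ n := by simpa using Finset.card_le_univ ({k | (f k : ℕ) < t} : Finset (Fin n))
  have hl : lstat (fun _ => 1) (cind n t) f = (N : ℝ) - t := by
    have : (n : ℝ) ≠ 0 := by positivity
    simp only [lstat, one_mul, cind, Finset.sum_sub_distrib, Finset.sum_boole, ← hN]
    simp
    field_simp
  have hpt : ∀ i, (cind n t i - cind n t (srt f i)) ^ 2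
      = |(if (i : ℕ) < N then (1 : ℝ) else 0) - (if (i : ℕ) < t then (1 : ℝ) else 0)| := by
    intro i
    simp only [cind, srt_lt_iff, ← hN, sub_sub_sub_cancel_right]
    split_ifs <;> norm_num
  simp_rw [hpt]
  rw [hl, ← sum_indicator_lt hNn, ← sum_indicator_lt ht, ← Finset.sum_sub_distrib]
  rcases le_total t N with h | h
  · have h0 : ∀ i : Fin n, 0 ≤
        (if (i : ℕ) < N then (1 : ℝ) else 0) - (if (i : ℕ) < t then (1 : ℝ) else 0) := by
      intro i
      split_ifs <;> norm_num
      omega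
    rw [abs_of_nonneg (Finset.sum_nonneg fun i _ => h0 i)]
    exact Finset.sum_congr rfl fun i _ => abs_of_nonneg (h0 i)
  · have h0 : ∀ i : Fin n,
        (if (i : ℕ) < N then (1 : ℝ) else 0) - (if (i : ℕ) < t then (1 : ℝ) else 0) ≤ 0 := by
      intro i
      split_ifs <;> norm_num
      omega
    rw [abs_of_nonpos (Finset.sum_nonpos fun i _ => h0 i), ← Finset.sum_neg_distrib]
    exact Finset.sum_congr rfl fun i _ => abs_of_nonpos (h0 i)

lemma sum_fun_sum_sq_cind_sub_srt_le (hn : 0 < n) {t : ℕ} (ht : t ≤ n) :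
    ∑ f : Fin n → Fin n, ∑ i, (cind n t i - cind n t (srt f i)) ^ 2
      ≤ (n : ℝ) ^ n * Real.sqrt n := by
  have hn' : (0 : ℝ) < n := by positivity
  have hs : 0 < Real.sqrt n := Real.sqrt_pos.2 hn'
  have hss : Real.sqrt n * Real.sqrt n = n := Real.mul_self_sqrt hn'.le
  simp_rw [sum_sq_cind_sub_srt ht]
  have hb : ∀ x : ℝ, |x| ≤ (x ^ 2 / Real.sqrt n + Real.sqrt n) / 2 := by
    intro x
    rw [le_div_iff₀ two_pos, ← sub_nonneg]
    have : x ^ 2 / Real.sqrt n + Real.sqrt n - |x| * 2 = (|x| - Real.sqrt n) ^ 2 / Real.sqrt n := by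
      rw [← sq_abs x]
      field_simp
      ring
    rw [this]
    positivity
  calc ∑ f : Fin n → Fin n, |lstat (fun _ => 1) (cind n t) f|
      ≤ ∑ f : Fin n → Fin n,
          ((lstat (fun _ => 1) (cind n t) f) ^ 2 / Real.sqrt n + Real.sqrt n) / 2 :=
        Finset.sum_le_sum fun f _ => hb _
    _ = ((n : ℝ) ^ n * ((∑ i, cind n t i ^ 2) / n * n) / Real.sqrt n
          + (n : ℝ) ^ n * Real.sqrt n) / 2 := by
        rw [← Finset.sum_div, Finset.sum_add_distrib, ← Finset.sum_div,
          sum_fun_lstat_sq hn _ _ (sum_cind ht)]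
        simp
    _ ≤ (n : ℝ) ^ n * Real.sqrt n := by
        have h1 : ∑ i, cind n t i ^ 2 ≤ n := by
          calc ∑ i, cind n t i ^ 2 ≤ ∑ _i : Fin n, (1 : ℝ) := by
                refine Finset.sum_le_sum fun i _ => ?_
                rw [← sq_abs]
                exact pow_le_one₀ (abs_nonneg _) (abs_cind_le ht i)
            _ = n := by simp
        have h2 : (n : ℝ) ^ n * ((∑ i, cind n t i ^ 2) / n * n) / Real.sqrt n
            ≤ (n : ℝ) ^ n * Real.sqrt n := by
          rw [div_mul_cancel₀ _ hn'.ne', div_le_iff₀ hs, mul_assoc, hss]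
          gcongr
        linarith

lemma sum_perm_apply (hn : 0 < n) (F : Fin n → ℝ) (a : Fin n) :
    ∑ π : Equiv.Perm (Fin n), F (π a) = (Nat.factorial n : ℝ) / n * ∑ i, F i := by
  have hn' : (n : ℝ) ≠ 0 := by positivity
  have hinv : ∀ c : Fin n, ∑ π : Equiv.Perm (Fin n), F (π c)
      = ∑ π : Equiv.Perm (Fin n), F (π a) := fun c =>
    Fintype.sum_equiv (Equiv.mulRight (Equiv.swap a c)) _ _ fun π => by simp
  have htot : ∑ c : Fin n, ∑ π : Equiv.Perm (Fin n), F (π c) = Nat.factorial n * ∑ i, F i := by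
    rw [Finset.sum_comm]
    simp_rw [fun π : Equiv.Perm (Fin n) => Equiv.sum_comp π F]
    simp [Fintype.card_perm]
  simp_rw [hinv] at htot
  simp only [Finset.sum_const, Finset.card_univ, Fintype.card_fin, nsmul_eq_mul] at htot
  field_simp
  linarith

lemma sum_srt_comp {R : Type*} [CommSemiring R] (g : (Fin n → Fin n) → R) :
    ∑ ω : (Fin n → Fin n) × Equiv.Perm (Fin n), g (srt ω.1 ∘ ω.2)
      = Nat.factorial n * ∑ f, g f := by
  rw [Fintype.sum_prod_type]
  have h1 : ∀ f : Fin n → Fin n, ∑ π : Equiv.Perm (Fin n), g (srt f ∘ π)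
      = ∑ π : Equiv.Perm (Fin n), g (f ∘ π) := fun f =>
    Fintype.sum_equiv (Equiv.mulLeft (Tuple.sort f)) _ _ fun π => by
      simp [srt, Function.comp_assoc]
  have h2 : ∀ π : Equiv.Perm (Fin n), ∑ f : Fin n → Fin n, g (f ∘ π) = ∑ f, g f := fun π =>
    Fintype.sum_equiv (Equiv.arrowCongr π.symm (Equiv.refl _)) _ _ fun f => by
      congr 1
  simp_rw [h1]
  rw [Finset.sum_comm]
  simp_rw [h2]
  simp [Fintype.card_perm]

lemma sum_coupling_sq_cind_le (hn : 0 < n) {t : ℕ} (ht : t ≤ n) (a : Fin n) :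
    ∑ ω : (Fin n → Fin n) × Equiv.Perm (Fin n),
      (cind n t (ω.2 a) - cind n t (srt ω.1 (ω.2 a))) ^ 2
      ≤ (n : ℝ) ^ n * Nat.factorial n / Real.sqrt n := by
  have hn' : (0 : ℝ) < n := by positivity
  have hs : 0 < Real.sqrt n := Real.sqrt_pos.2 hn'
  have hss : Real.sqrt n * Real.sqrt n = n := Real.mul_self_sqrt hn'.le
  rw [Fintype.sum_prod_type]
  simp_rw [fun f : Fin n → Fin n =>
    sum_perm_apply hn (fun i => (cind n t i - cind n t (srt f i)) ^ 2) a, ← Finset.mul_sum]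
  calc (Nat.factorial n : ℝ) / n
        * ∑ f : Fin n → Fin n, ∑ i, (cind n t i - cind n t (srt f i)) ^ 2
      ≤ (Nat.factorial n : ℝ) / n * ((n : ℝ) ^ n * Real.sqrt n) := by
        gcongr
        exact sum_fun_sum_sq_cind_sub_srt_le hn ht
    _ = (n : ℝ) ^ n * Nat.factorial n / Real.sqrt n := by
        rw [div_mul_eq_mul_div, div_eq_div_iff hn'.ne' hs.ne']
        linear_combination (Nat.factorial n : ℝ) * (n : ℝ) ^ n * hss

lemma sum_coupling_lstat_le (hn : 2 ≤ n) {t : ℕ} (ht : t ≤ n) (b : Fin n → ℝ)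
    (hb : ∑ k, b k = 0) :
    ∑ ω : (Fin n → Fin n) × Equiv.Perm (Fin n),
      (lstat b (cind n t) ω.2 - lstat b (cind n t) (srt ω.1 ∘ ω.2)) ^ 2
      ≤ (n : ℝ) ^ n * Nat.factorial n * (2 / Real.sqrt n * ∑ k, b k ^ 2) := by
  have := sum_sq_linear_le_of_exchangeable (by simpa using hn)
    (fun (ω : (Fin n → Fin n) × Equiv.Perm (Fin n)) k =>
      cind n t (ω.2 k) - cind n t (srt ω.1 (ω.2 k))) b hb ?_ _
    (fun a => by simpa only [sq] using sum_coupling_sq_cind_le (by omega) ht a)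
  · calc _ = ∑ ω : (Fin n → Fin n) × Equiv.Perm (Fin n), (∑ k, b k *
          (cind n t (ω.2 k) - cind n t (srt ω.1 (ω.2 k)))) ^ 2 := by
          simp [lstat, mul_sub, Finset.sum_sub_distrib]
      _ ≤ _ := this
      _ = _ := by ring
  · intro σ a c
    exact Fintype.sum_equiv ((Equiv.refl _).prodCongr (Equiv.mulRight σ)) _ _ fun ω => by simp

lemma sum_coupling_qstat_le (hn : 4 ≤ n) {t : ℕ} (ht : t ≤ n) (H : Fin n → Fin n → ℝ)
    (hH : ∀ a b, H a b = H b a) (hd : ∀ a, H a a = 0) (hrow : ∀ a, ∑ b, H a b = 0) :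
    ∑ ω : (Fin n → Fin n) × Equiv.Perm (Fin n),
      (qstat H (cind n t) ω.2 - qstat H (cind n t) (srt ω.1 ∘ ω.2)) ^ 2
      ≤ (n : ℝ) ^ n * Nat.factorial n * (32 / Real.sqrt n * ∑ k, ∑ l, H k l ^ 2) := by
  have hpt : ∀ i j i' j' : Fin n,
      (cind n t i * cind n t j - cind n t i' * cind n t j')
        * (cind n t i * cind n t j - cind n t i' * cind n t j')
      ≤ 2 * (cind n t i - cind n t i') ^ 2 + 2 * (cind n t j - cind n t j') ^ 2 := by
    intro i j i' j'
    have h1 : cind n t j ^ 2 ≤ 1 := by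
      rw [← sq_abs]; exact pow_le_one₀ (abs_nonneg _) (abs_cind_le ht j)
    have h2 : cind n t i' ^ 2 ≤ 1 := by
      rw [← sq_abs]; exact pow_le_one₀ (abs_nonneg _) (abs_cind_le ht i')
    nlinarith [sq_nonneg ((cind n t i - cind n t i') * cind n t j
        - cind n t i' * (cind n t j - cind n t j')),
      mul_nonneg (sq_nonneg (cind n t i - cind n t i')) (sub_nonneg.2 h1),
      mul_nonneg (sq_nonneg (cind n t j - cind n t j')) (sub_nonneg.2 h2)]
  have := sum_sq_quadratic_le_of_exchangeable (by simpa using hn)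
    (fun (ω : (Fin n → Fin n) × Equiv.Perm (Fin n)) k l =>
      cind n t (ω.2 k) * cind n t (ω.2 l)
        - cind n t (srt ω.1 (ω.2 k)) * cind n t (srt ω.1 (ω.2 l))) H
    (fun ω a b => by ring) hH hd hrow ?_ (4 * ((n : ℝ) ^ n * Nat.factorial n / Real.sqrt n)) ?_
  · calc _ = ∑ ω : (Fin n → Fin n) × Equiv.Perm (Fin n), (∑ k, ∑ l, H k l *
          (cind n t (ω.2 k) * cind n t (ω.2 l)
            - cind n t (srt ω.1 (ω.2 k)) * cind n t (srt ω.1 (ω.2 l)))) ^ 2 := by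
          simp [qstat, mul_sub, Finset.sum_sub_distrib]
      _ ≤ _ := this
      _ = _ := by ring
  · intro σ a b c d
    exact Fintype.sum_equiv ((Equiv.refl _).prodCongr (Equiv.mulRight σ)) _ _ fun ω => by simp
  · intro a b _
    have ha := sum_coupling_sq_cind_le (n := n) (by omega) ht a
    have hb := sum_coupling_sq_cind_le (n := n) (by omega) ht b
    calc _ ≤ ∑ ω : (Fin n → Fin n) × Equiv.Perm (Fin n),
          (2 * (cind n t (ω.2 a) - cind n t (srt ω.1 (ω.2 a))) ^ 2
            + 2 * (cind n t (ω.2 b) - cind n t (srt ω.1 (ω.2 b))) ^ 2) :=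
          Finset.sum_le_sum fun ω _ => hpt _ _ _ _
      _ ≤ _ := by
          rw [Finset.sum_add_distrib, ← Finset.mul_sum, ← Finset.mul_sum]
          linarith

end Coupling

/-! ### Moments of sums of independent variables -/

section IndependentSums

variable {Ω : Type*} {mΩ : MeasurableSpace Ω} {P : Measure Ω}

lemma integrable_pow_of_memLp_four [IsFiniteMeasure P] {X : Ω → ℝ} (hX : MemLp X 4 P) {p : ℕ}
    (hp : p ≤ 4) : Integrable (fun ω => X ω ^ p) P := by
  have h : MemLp X p P := hX.mono_exponent (by exact_mod_cast hp)
  have := h.integrable_norm_pow'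
  refine this.mono' (hX.1.pow p) (ae_of_all _ fun ω => by simp)

lemma moments_add_of_indepFun [IsProbabilityMeasure P] {X Y : Ω → ℝ}
    (hX : MemLp X 4 P) (hY : MemLp Y 4 P) (h : IndepFun X Y P)
    (hX1 : ∫ ω, X ω ∂P = 0) (hY1 : ∫ ω, Y ω ∂P = 0) {a b a' b' : ℝ}
    (hX2 : ∫ ω, X ω ^ 2 ∂P = a) (hY2 : ∫ ω, Y ω ^ 2 ∂P = b) (ha : a ≤ a') (hb : b ≤ b')
    (hX4 : ∫ ω, X ω ^ 4 ∂P ≤ 3 * a' ^ 2) (hY4 : ∫ ω, Y ω ^ 4 ∂P ≤ 3 * b' ^ 2) :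
    ∫ ω, X ω + Y ω ∂P = 0 ∧ ∫ ω, (X ω + Y ω) ^ 2 ∂P = a + b
      ∧ ∫ ω, (X ω + Y ω) ^ 4 ∂P ≤ 3 * (a' + b') ^ 2 := by
  have iX := fun {p : ℕ} (hp : p ≤ 4) => integrable_pow_of_memLp_four hX hp
  have iY := fun {p : ℕ} (hp : p ≤ 4) => integrable_pow_of_memLp_four hY hp
  have hind : ∀ p q : ℕ, IndepFun (fun ω => X ω ^ p) (fun ω => Y ω ^ q) P := fun p q =>
    h.comp (φ := fun x : ℝ => x ^ p) (ψ := fun x : ℝ => x ^ q) (by fun_prop) (by fun_prop)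
  have iXY : ∀ p q : ℕ, p ≤ 4 → q ≤ 4 → Integrable (fun ω => X ω ^ p * Y ω ^ q) P :=
    fun p q hp hq => (hind p q).integrable_mul (iX hp) (iY hq)
  have eXY : ∀ p q : ℕ, p ≤ 4 → q ≤ 4 → ∫ ω, X ω ^ p * Y ω ^ q ∂P
      = (∫ ω, X ω ^ p ∂P) * ∫ ω, Y ω ^ q ∂P := fun p q hp hq =>
    (hind p q).integral_fun_mul_eq_mul_integral (iX hp).1 (iY hq).1
  have hX1' : ∫ ω, X ω ^ 1 ∂P = 0 := by simpa using hX1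
  have hY1' : ∫ ω, Y ω ^ 1 ∂P = 0 := by simpa using hY1
  refine ⟨?_, ?_, ?_⟩
  · rw [integral_add (by simpa using iX (p := 1) (by norm_num))
      (by simpa using iY (p := 1) (by norm_num)), hX1, hY1, add_zero]
  · have : ∀ ω, (X ω + Y ω) ^ 2 = X ω ^ 2 + (2 * (X ω ^ 1 * Y ω ^ 1) + Y ω ^ 2) := fun ω => by ring
    simp_rw [this]
    have i1 := (iXY 1 1 (by norm_num) (by norm_num)).const_mul 2
    have i2 : Integrable (fun ω => 2 * (X ω ^ 1 * Y ω ^ 1) + Y ω ^ 2) P :=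
      i1.add (iY (by norm_num))
    rw [integral_add (iX (p := 2) (by norm_num)) i2,
      integral_add i1 (iY (p := 2) (by norm_num)), integral_const_mul, eXY 1 1 (by norm_num) (by norm_num),
      hX1', hX2, hY2]
    ring
  · have : ∀ ω, (X ω + Y ω) ^ 4 = X ω ^ 4 + (4 * (X ω ^ 3 * Y ω ^ 1)
        + (6 * (X ω ^ 2 * Y ω ^ 2) + (4 * (X ω ^ 1 * Y ω ^ 3) + Y ω ^ 4))) := fun ω => by ring
    simp_rw [this]
    have i31 := (iXY 3 1 (by norm_num) (by norm_num)).const_mul 4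
    have i22 := (iXY 2 2 (by norm_num) (by norm_num)).const_mul 6
    have i13 := (iXY 1 3 (by norm_num) (by norm_num)).const_mul 4
    have j1 : Integrable (fun ω => 4 * (X ω ^ 1 * Y ω ^ 3) + Y ω ^ 4) P :=
      i13.add (iY (by norm_num))
    have j2 : Integrable (fun ω => 6 * (X ω ^ 2 * Y ω ^ 2)
        + (4 * (X ω ^ 1 * Y ω ^ 3) + Y ω ^ 4)) P := i22.add j1
    have j3 : Integrable (fun ω => 4 * (X ω ^ 3 * Y ω ^ 1) + (6 * (X ω ^ 2 * Y ω ^ 2)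
        + (4 * (X ω ^ 1 * Y ω ^ 3) + Y ω ^ 4))) P := i31.add j2
    rw [integral_add (iX (p := 4) (by norm_num)) j3, integral_add i31 j2, integral_add i22 j1,
      integral_add i13 (iY (p := 4) (by norm_num)),
      integral_const_mul, integral_const_mul, integral_const_mul,
      eXY 3 1 (by norm_num) (by norm_num), eXY 2 2 (by norm_num) (by norm_num),
      eXY 1 3 (by norm_num) (by norm_num), hX1', hY1', hX2, hY2]
    have ha0 : 0 ≤ a := hX2 ▸ integral_nonneg fun ω => sq_nonneg _
    have hb0 : 0 ≤ b := hY2 ▸ integral_nonneg fun ω => sq_nonneg _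
    have : a * b ≤ a' * b' := mul_le_mul ha hb hb0 (ha0.trans ha)
    linarith

lemma moments_sum_of_iIndepFun [IsProbabilityMeasure P] {ι : Type*} [DecidableEq ι]
    {X : ι → Ω → ℝ}
    (hm : ∀ l, Measurable (X l)) (hX : ∀ l, MemLp (X l) 4 P) (h : iIndepFun X P) {v β : ι → ℝ}
    (hv : ∀ l, v l ≤ β l) (h1 : ∀ l, ∫ ω, X l ω ∂P = 0) (h2 : ∀ l, ∫ ω, X l ω ^ 2 ∂P = v l)
    (h4 : ∀ l, ∫ ω, X l ω ^ 4 ∂P ≤ 3 * β l ^ 2) (s : Finset ι) :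
    MemLp (fun ω => ∑ l ∈ s, X l ω) 4 P ∧ ∫ ω, ∑ l ∈ s, X l ω ∂P = 0
      ∧ ∫ ω, (∑ l ∈ s, X l ω) ^ 2 ∂P = ∑ l ∈ s, v l
      ∧ ∫ ω, (∑ l ∈ s, X l ω) ^ 4 ∂P ≤ 3 * (∑ l ∈ s, β l) ^ 2 := by
  induction s using Finset.induction_on with
  | empty => simp
  | insert k s hk ih =>
    obtain ⟨i0, i1, i2, i4⟩ := ih
    simp only [Finset.sum_insert hk]
    have hind : IndepFun (X k) (fun ω => ∑ l ∈ s, X l ω) P := by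
      have := (h.indepFun_finsetSum_of_notMem hm hk).symm
      convert this using 1
      ext ω; simp
    exact ⟨(hX k).add i0, moments_add_of_indepFun (hX k) i0 hind (h1 k) i1 (h2 k) i2 (hv k)
      (Finset.sum_le_sum fun l _ => hv l) (h4 k) i4⟩

end IndependentSums

/-! ### Replacing the coordinates of a quadratic form one at a time -/

lemma norm_exp_I_mul_sub_taylor_le (z : ℝ) :
    ‖Complex.exp (Complex.I * z) - (1 + Complex.I * z - (z : ℂ) ^ 2 / 2)‖ ≤ |z| ^ 3 := by
  rcases le_or_gt |z| 2 with hz | hz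
  · have h := Complex.exp_bound' (x := Complex.I * z) (n := 3) (by simp; linarith)
    have e : ∑ m ∈ Finset.range 3, (Complex.I * (z : ℂ)) ^ m / (m.factorial : ℂ)
        = 1 + Complex.I * z - (z : ℂ) ^ 2 / 2 := by
      simp [Finset.sum_range_succ, Nat.factorial, mul_pow]
      ring
    rw [e] at h
    refine h.trans ?_
    have : 0 ≤ |z| ^ 3 := by positivity
    simp [Nat.factorial]
    linarith
  · have h1 : ‖Complex.exp (Complex.I * z)‖ = 1 := Complex.norm_exp_I_mul_ofReal z
    have h2 : ‖(1 + Complex.I * z - (z : ℂ) ^ 2 / 2)‖ ≤ 1 + |z| + |z| ^ 2 / 2 := by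
      refine (norm_sub_le _ _).trans (add_le_add ((norm_add_le _ _).trans ?_) ?_) <;> simp
    refine (norm_sub_le _ _).trans ?_
    rw [h1]
    nlinarith [sq_nonneg |z|]

lemma abs_pow_three_le (z : ℝ) {ε : ℝ} (hε : 0 < ε) :
    |z| ^ 3 ≤ (ε * z ^ 2 + z ^ 4 / ε) / 2 := by
  have h : (ε * z ^ 2 + z ^ 4 / ε) - 2 * |z| ^ 3 = |z| ^ 2 * (|z| - ε) ^ 2 / ε := by
    rw [← sq_abs z, show z ^ 4 = |z| ^ 4 by rw [← abs_pow, abs_of_nonneg (by positivity)]]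
    field_simp
    ring
  have : 0 ≤ |z| ^ 2 * (|z| - ε) ^ 2 / ε := by positivity
  linarith

/-- The measures on `Fin n → ℝ` under which linear functionals orthogonal to constants are centred,
isometric to the coefficients, and have controlled fourth moments. -/
structure Isonormal (n : ℕ) (ρ : Measure (Fin n → ℝ)) : Prop where
  prob : IsProbabilityMeasure ρ
  memLp : ∀ w : Fin n → ℝ, ∑ i, w i = 0 → MemLp (fun y => ∑ i, w i * y i) 4 ρ
  mean : ∀ w : Fin n → ℝ, ∑ i, w i = 0 → ∫ y, ∑ i, w i * y i ∂ρ = 0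
  second : ∀ w : Fin n → ℝ, ∑ i, w i = 0 → ∫ y, (∑ i, w i * y i) ^ 2 ∂ρ = ∑ i, w i ^ 2
  fourth : ∀ w : Fin n → ℝ, ∑ i, w i = 0 →
    ∫ y, (∑ i, w i * y i) ^ 4 ∂ρ ≤ 3 * (n * ∑ i, w i ^ 4)

lemma norm_integral_exp_linear_sub_le {n : ℕ} {ρ : Measure (Fin n → ℝ)} (hρ : Isonormal n ρ)
    {w : Fin n → ℝ} (hw : ∑ i, w i = 0) {ε : ℝ} (hε : 0 < ε) :
    ‖∫ y, Complex.exp (Complex.I * ((∑ i, w i * y i : ℝ) : ℂ)) ∂ρ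
        - (1 - ((∑ i, w i ^ 2 : ℝ) : ℂ) / 2)‖
      ≤ (ε * ∑ i, w i ^ 2 + 3 * (n * ∑ i, w i ^ 4) / ε) / 2 := by
  have := hρ.prob
  have i1 : Integrable (fun y : Fin n → ℝ => ∑ i, w i * y i) ρ := by
    simpa using integrable_pow_of_memLp_four (hρ.memLp w hw) (p := 1) (by norm_num)
  have i2 := integrable_pow_of_memLp_four (hρ.memLp w hw) (p := 2) (by norm_num)
  have i4 := integrable_pow_of_memLp_four (hρ.memLp w hw) (p := 4) (by norm_num)
  have c1 : Integrable (fun y : Fin n → ℝ => Complex.I * ((∑ i, w i * y i : ℝ) : ℂ)) ρ :=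
    i1.ofReal.const_mul _
  have c2 : Integrable (fun y : Fin n → ℝ => (((∑ i, w i * y i : ℝ) : ℂ)) ^ 2 / 2) ρ := by
    have := (i2.ofReal (𝕜 := ℂ)).div_const 2
    simpa using this
  have c01 : Integrable (fun y : Fin n → ℝ => 1 + Complex.I * ((∑ i, w i * y i : ℝ) : ℂ)) ρ :=
    (integrable_const _).add c1
  have ce : Integrable (fun y : Fin n → ℝ =>
      Complex.exp (Complex.I * ((∑ i, w i * y i : ℝ) : ℂ))) ρ := by
    refine Integrable.of_bound (C := 1) (Measurable.aestronglyMeasurable (by fun_prop))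
      (ae_of_all _ fun y => ?_)
    rw [Complex.norm_exp_I_mul_ofReal]
  have e : (1 - ((∑ i, w i ^ 2 : ℝ) : ℂ) / 2) = ∫ y, (1 + Complex.I * ((∑ i, w i * y i : ℝ) : ℂ)
      - (((∑ i, w i * y i : ℝ) : ℂ)) ^ 2 / 2) ∂ρ := by
    have e1 : ∫ y, ((∑ i, w i * y i : ℝ) : ℂ) ∂ρ = 0 := by
      rw [integral_complex_ofReal, hρ.mean w hw]; simp
    have e2 : ∫ y, ((∑ i, w i * y i : ℝ) : ℂ) ^ 2 ∂ρ = ((∑ i, w i ^ 2 : ℝ) : ℂ) := by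
      rw [← hρ.second w hw, ← integral_complex_ofReal]
      simp
    rw [integral_sub c01 c2, integral_add (integrable_const _) c1, integral_const_mul, e1,
      integral_div, e2]
    simp
  have c012 : Integrable (fun y : Fin n → ℝ => 1 + Complex.I * ((∑ i, w i * y i : ℝ) : ℂ)
      - (((∑ i, w i * y i : ℝ) : ℂ)) ^ 2 / 2) ρ := c01.sub c2
  rw [e, ← integral_sub ce c012]
  calc _ ≤ ∫ y, (ε * (∑ i, w i * y i) ^ 2 + (∑ i, w i * y i) ^ 4 / ε) / 2 ∂ρ := by
        refine norm_integral_le_of_norm_le (((i2.const_mul ε).add (i4.div_const ε)).div_const 2)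
          (ae_of_all _ fun y => ?_)
        exact (norm_exp_I_mul_sub_taylor_le _).trans (abs_pow_three_le _ hε)
    _ ≤ _ := by
        rw [integral_div, integral_add (i2.const_mul ε) (i4.div_const ε), integral_const_mul,
          integral_div, hρ.second w hw]
        have := hρ.fourth w hw
        gcongr

section Swap

variable {n : ℕ}

/-- The quadratic form with coefficients `H k l * A i j` plus the linear form with coefficients
`b k * c i`. -/
noncomputable def qform (H A : Fin n → Fin n → ℝ) (b c : Fin n → ℝ) (x : Fin n → Fin n → ℝ) : ℝ :=
  ∑ k, ∑ l, H k l * ∑ i, ∑ j, A i j * (x k i * x l j) + ∑ k, b k * ∑ i, c i * x k i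

/-- The coefficient of `x k i` in `qform` when the other rows of `x` are frozen. -/
noncomputable def qcoef (H A : Fin n → Fin n → ℝ) (b c : Fin n → ℝ) (k i : Fin n)
    (x : Fin n → Fin n → ℝ) : ℝ :=
  ∑ l, 2 * H k l * (∑ j, A i j * x l j) + b k * c i

lemma measurable_qform (H A : Fin n → Fin n → ℝ) (b c : Fin n → ℝ) :
    Measurable (qform H A b c) := by
  unfold qform; fun_prop

lemma sum_qcoef {H A : Fin n → Fin n → ℝ} {b c : Fin n → ℝ} (hA : ∀ i j, A i j = A j i)
    (hA0 : ∀ i, ∑ j, A i j = 0) (hc : ∑ i, c i = 0) (k : Fin n) (x : Fin n → Fin n → ℝ) :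
    ∑ i, qcoef H A b c k i x = 0 := by
  simp only [qcoef, Finset.sum_add_distrib]
  rw [Finset.sum_comm]
  simp_rw [← Finset.mul_sum, hc]
  have : ∀ l, ∑ i, ∑ j, A i j * x l j = 0 := by
    intro l
    rw [Finset.sum_comm]
    simp_rw [← Finset.sum_mul, fun i j => hA i j, hA0]
    simp
  simp [this]

lemma qform_update {H A : Fin n → Fin n → ℝ} {b c : Fin n → ℝ} (hH : ∀ k l, H k l = H l k)
    (hd : ∀ k, H k k = 0) (hA : ∀ i j, A i j = A j i) (k : Fin n) (x : Fin n → Fin n → ℝ)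
    (y : Fin n → ℝ) :
    qform H A b c (Function.update x k y)
      = qform H A b c (Function.update x k 0) + ∑ i, qcoef H A b c k i x * y i := by
  set z := Function.update x k 0 with hz
  have hu : ∀ a i, Function.update x k y a i = z a i + (if a = k then y i else 0) := by
    intro a i
    by_cases h : a = k
    · subst h; simp [hz]
    · simp [hz, h]
  set Q : (Fin n → ℝ) → (Fin n → ℝ) → ℝ := fun p q => ∑ i, ∑ j, A i j * (p i * q j) with hQ
  have hQs : ∀ p q, Q p q = Q q p := by
    intro p q
    simp only [hQ]
    rw [Finset.sum_comm]
    refine Finset.sum_congr rfl fun i _ => Finset.sum_congr rfl fun j _ => ?_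
    rw [hA]; ring
  have hterm : ∀ a l, H a l * ∑ i, ∑ j, A i j * ((z a i + (if a = k then y i else 0))
        * (z l j + (if l = k then y j else 0)))
      = H a l * Q (z a) (z l) + (if a = k then H k l * Q y (z l) else 0)
        + (if l = k then H a k * Q (z a) y else 0) := by
    intro a l
    by_cases h1 : a = k <;> by_cases h2 : l = k
    · subst h1; subst h2; simp [hd]
    · subst h1
      simp only [h2, if_true, if_false, add_zero, hQ, ← mul_add, ← Finset.sum_add_distrib, add_mul]
    · subst h2
      simp only [h1, if_true, if_false, add_zero, hQ, ← mul_add, ← Finset.sum_add_distrib]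
    · simp [h1, h2, hQ]
  have hlin : ∀ a, b a * ∑ i, c i * (z a i + (if a = k then y i else 0))
      = b a * ∑ i, c i * z a i + (if a = k then b k * ∑ i, c i * y i else 0) := by
    intro a
    by_cases h : a = k
    · subst h
      simp only [if_true, mul_add, Finset.sum_add_distrib]
    · simp [h]
  have hzl : ∀ l, H k l * Q y (z l) = H k l * Q y (x l) := by
    intro l
    by_cases h : l = k
    · subst h; simp [hd]
    · simp [hz, h]
  have hco : ∑ i, qcoef H A b c k i x * y i
      = 2 * ∑ l, H k l * Q y (x l) + b k * ∑ i, c i * y i := by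
    simp only [qcoef, add_mul, Finset.sum_add_distrib, hQ, Finset.mul_sum, Finset.sum_mul]
    congr 1
    · rw [Finset.sum_comm]
      refine Finset.sum_congr rfl fun l _ => Finset.sum_congr rfl fun i _ =>
        Finset.sum_congr rfl fun j _ => ?_
      ring
    · refine Finset.sum_congr rfl fun i _ => ?_
      ring
  rw [hco]
  simp only [qform, hu, hterm, hlin, Finset.sum_add_distrib, Finset.sum_ite_eq', Finset.mem_univ,
    if_true]
  have h1 : ∑ a, ∑ l, (if a = k then H k l * Q y (z l) else 0) = ∑ l, H k l * Q y (x l) := by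
    rw [Finset.sum_comm]
    simp [hzl]
  have h2 : ∑ a, H a k * Q (z a) y = ∑ l, H k l * Q y (x l) := by
    refine Finset.sum_congr rfl fun l _ => ?_
    rw [← hzl l, hH, hQs]
  rw [h1, h2]
  simp only [hQ]
  ring

variable {ρ : Fin n → Measure (Fin n → ℝ)}

lemma moments_linear_combination {A : Fin n → Fin n → ℝ} {C : ℝ}
    (hρ : ∀ k, Isonormal n (ρ k)) (hA0 : ∀ i, ∑ j, A i j = 0) (hAC : ∀ i j, |A i j| ≤ C / n)
    (h : Fin n → ℝ) (i : Fin n) :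
    MemLp (fun x : Fin n → Fin n → ℝ => ∑ l, h l * ∑ j, A i j * x l j) 4 (Measure.pi ρ)
      ∧ ∫ x, (∑ l, h l * ∑ j, A i j * x l j) ^ 2 ∂(Measure.pi ρ) ≤ C ^ 2 / n * ∑ l, h l ^ 2
      ∧ ∫ x, (∑ l, h l * ∑ j, A i j * x l j) ^ 4 ∂(Measure.pi ρ)
        ≤ 3 * (C ^ 2 / n * ∑ l, h l ^ 2) ^ 2 := by
  have hn : (0 : ℝ) < n := by exact_mod_cast i.pos
  have := fun k => (hρ k).prob
  have hA2 : ∑ j, A i j ^ 2 ≤ C ^ 2 / n := by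
    calc ∑ j, A i j ^ 2 ≤ ∑ _j : Fin n, (C / n) ^ 2 := Finset.sum_le_sum fun j _ => by
          rw [← sq_abs]; gcongr; exact hAC i j
      _ = _ := by simp; field_simp
  have hA4 : n * ∑ j, A i j ^ 4 ≤ (C ^ 2 / n) ^ 2 := by
    calc n * ∑ j, A i j ^ 4 ≤ n * ∑ _j : Fin n, (C / n) ^ 4 := by
          refine mul_le_mul_of_nonneg_left (Finset.sum_le_sum fun j _ => ?_) hn.le
          rw [show A i j ^ 4 = |A i j| ^ 4 by rw [← abs_pow, abs_of_nonneg (by positivity)]]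
          gcongr; exact hAC i j
      _ = _ := by simp; field_simp
  have hmp := fun l => measurePreserving_eval ρ l
  have hint : ∀ l (g : (Fin n → ℝ) → ℝ), Measurable g →
      ∫ x, g (x l) ∂(Measure.pi ρ) = ∫ y, g y ∂(ρ l) := by
    intro l g hg
    rw [← (hmp l).map_eq, integral_map (measurable_pi_apply l).aemeasurable
      hg.aestronglyMeasurable]
  have key := moments_sum_of_iIndepFun (P := Measure.pi ρ)
    (X := fun l (x : Fin n → Fin n → ℝ) => h l * ∑ j, A i j * x l j)
    (v := fun l => h l ^ 2 * ∑ j, A i j ^ 2) (β := fun l => h l ^ 2 * (C ^ 2 / n))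
    (fun l => by fun_prop) ?_ ?_ (fun l => by gcongr) ?_ ?_ ?_ Finset.univ
  · obtain ⟨h0, -, h2, h4⟩ := key
    refine ⟨h0, ?_, ?_⟩
    · rw [h2, ← Finset.sum_mul, mul_comm]
      gcongr
    · rw [← Finset.sum_mul, mul_comm] at h4
      exact h4.trans_eq (by ring)
  · intro l
    exact (((hρ l).memLp (A i) (hA0 i)).comp_measurePreserving (hmp l)).const_mul (h l)
  · exact iIndepFun_pi (X := fun l (y : Fin n → ℝ) => h l * ∑ j, A i j * y j)
      fun l => Measurable.aemeasurable (by fun_prop)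
  · intro l
    rw [integral_const_mul, hint l (fun y => ∑ j, A i j * y j) (by fun_prop),
      (hρ l).mean _ (hA0 i), mul_zero]
  · intro l
    simp_rw [mul_pow]
    rw [integral_const_mul, hint l (fun y => (∑ j, A i j * y j) ^ 2) (by fun_prop),
      (hρ l).second _ (hA0 i)]
  · intro l
    simp_rw [mul_pow]
    rw [integral_const_mul, hint l (fun y => (∑ j, A i j * y j) ^ 4) (by fun_prop)]
    calc h l ^ 4 * ∫ y, (∑ j, A i j * y j) ^ 4 ∂(ρ l)
        ≤ h l ^ 4 * (3 * (C ^ 2 / n) ^ 2) := by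
          gcongr
          exact ((hρ l).fourth _ (hA0 i)).trans (by gcongr)
      _ = _ := by ring

lemma integral_qcoef_le {H A : Fin n → Fin n → ℝ} {b c : Fin n → ℝ} {C : ℝ}
    (hρ : ∀ k, Isonormal n (ρ k)) (hA0 : ∀ i, ∑ j, A i j = 0) (hAC : ∀ i j, |A i j| ≤ C / n)
    (hc : ∀ i, c i ^ 2 ≤ C ^ 2 / n) (k i : Fin n) :
    MemLp (qcoef H A b c k i) 4 (Measure.pi ρ)
      ∧ ∫ x, qcoef H A b c k i x ^ 2 ∂(Measure.pi ρ)
        ≤ C ^ 2 / n * (8 * ∑ l, H k l ^ 2 + 2 * b k ^ 2)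
      ∧ ∫ x, qcoef H A b c k i x ^ 4 ∂(Measure.pi ρ)
        ≤ (C ^ 2 / n) ^ 2 * (384 * (∑ l, H k l ^ 2) ^ 2 + 8 * b k ^ 4) := by
  have := fun k => (hρ k).prob
  obtain ⟨h0, h2, h4⟩ := moments_linear_combination hρ hA0 hAC (fun l => 2 * H k l) i
  set S : (Fin n → Fin n → ℝ) → ℝ := fun x => ∑ l, 2 * H k l * ∑ j, A i j * x l j with hS
  have hsum : ∑ l, (2 * H k l) ^ 2 = 4 * ∑ l, H k l ^ 2 := by
    rw [Finset.mul_sum]; exact Finset.sum_congr rfl fun l _ => by ring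
  rw [hsum] at h2 h4
  have i2 : Integrable (fun x => S x ^ 2) (Measure.pi ρ) :=
    integrable_pow_of_memLp_four h0 (by norm_num)
  have i4 : Integrable (fun x => S x ^ 4) (Measure.pi ρ) :=
    integrable_pow_of_memLp_four h0 (by norm_num)
  have hm : MemLp (qcoef H A b c k i) 4 (Measure.pi ρ) := h0.add (memLp_const (b k * c i))
  have hc2 : (b k * c i) ^ 2 ≤ b k ^ 2 * (C ^ 2 / n) := by
    rw [mul_pow]; gcongr; exact hc i
  have hc4 : (b k * c i) ^ 4 ≤ b k ^ 4 * (C ^ 2 / n) ^ 2 := by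
    calc (b k * c i) ^ 4 = b k ^ 4 * (c i ^ 2) ^ 2 := by ring
      _ ≤ _ := by gcongr; exact hc i
  refine ⟨hm, ?_, ?_⟩
  · calc ∫ x, qcoef H A b c k i x ^ 2 ∂(Measure.pi ρ)
        ≤ ∫ x, (2 * S x ^ 2 + 2 * (b k * c i) ^ 2) ∂(Measure.pi ρ) := by
          refine integral_mono (integrable_pow_of_memLp_four hm (by norm_num))
            ((i2.const_mul 2).add (integrable_const _)) fun x => ?_
          change (S x + b k * c i) ^ 2 ≤ 2 * S x ^ 2 + 2 * (b k * c i) ^ 2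
          nlinarith [sq_nonneg (S x - b k * c i)]
      _ ≤ _ := by
          rw [integral_add (i2.const_mul 2) (integrable_const _), integral_const_mul]
          simp only [integral_const, probReal_univ, one_smul]
          linarith
  · calc ∫ x, qcoef H A b c k i x ^ 4 ∂(Measure.pi ρ)
        ≤ ∫ x, (8 * S x ^ 4 + 8 * (b k * c i) ^ 4) ∂(Measure.pi ρ) := by
          refine integral_mono (integrable_pow_of_memLp_four hm (by norm_num))
            ((i4.const_mul 8).add (integrable_const _)) fun x => ?_
          change (S x + b k * c i) ^ 4 ≤ 8 * S x ^ 4 + 8 * (b k * c i) ^ 4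
          have h1 : (S x + b k * c i) ^ 2 ≤ 2 * (S x ^ 2 + (b k * c i) ^ 2) := by
            nlinarith [sq_nonneg (S x - b k * c i)]
          have h2 : ((S x + b k * c i) ^ 2) ^ 2 ≤ (2 * (S x ^ 2 + (b k * c i) ^ 2)) ^ 2 := by
            gcongr
          nlinarith [sq_nonneg (S x ^ 2 - (b k * c i) ^ 2)]
      _ ≤ _ := by
          rw [integral_add (i4.const_mul 8) (integrable_const _), integral_const_mul]
          simp only [integral_const, probReal_univ, one_smul]
          linarith

lemma map_update_pi_prod [∀ k, IsProbabilityMeasure (ρ k)] (σ : Measure (Fin n → ℝ))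
    [IsProbabilityMeasure σ] (k : Fin n) :
    ((Measure.pi ρ).prod σ).map (fun p => Function.update p.1 k p.2)
      = Measure.pi (Function.update ρ k σ) := by
  have hprob : ∀ j, IsProbabilityMeasure (Function.update ρ k σ j) := by
    intro j
    by_cases h : j = k
    · subst h; simpa
    · simp only [Function.update_of_ne h]; infer_instance
  have hmeas : Measurable (fun p : (Fin n → Fin n → ℝ) × (Fin n → ℝ) =>
      Function.update p.1 k p.2) := by
    refine measurable_pi_lambda _ fun j => ?_
    by_cases h : j = k
    · subst h; simpa using measurable_snd
    · simp only [Function.update_of_ne h]; fun_prop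
  symm
  refine Measure.pi_eq fun s hs => ?_
  rw [Measure.map_apply hmeas (MeasurableSet.univ_pi hs)]
  have hpre : (fun p : (Fin n → Fin n → ℝ) × (Fin n → ℝ) => Function.update p.1 k p.2) ⁻¹'
      (Set.univ.pi s) = (Set.univ.pi (Function.update s k Set.univ)) ×ˢ (s k) := by
    ext p
    simp only [Set.mem_preimage, Set.mem_pi, Set.mem_univ, true_imp_iff, Set.mem_prod]
    constructor
    · intro h
      refine ⟨fun j => ?_, by simpa using h k⟩
      by_cases hj : j = k
      · subst hj; simp
      · simpa [hj] using h j
    · rintro ⟨h, h'⟩ j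
      by_cases hj : j = k
      · subst hj; simpa using h'
      · simpa [hj] using h j
  rw [hpre, Measure.prod_prod, Measure.pi_pi, ← Finset.mul_prod_erase _ _ (Finset.mem_univ k),
    ← Finset.mul_prod_erase (s := Finset.univ) (a := k) _ (Finset.mem_univ k)]
  simp only [Function.update_self, measure_univ, one_mul]
  rw [mul_comm]
  congr 1
  refine Finset.prod_congr rfl fun j hj => ?_
  have := Finset.ne_of_mem_erase hj
  simp [this]

lemma exists_norm_integral_exp_qform_update_sub_le {H A : Fin n → Fin n → ℝ} {b c : Fin n → ℝ}
    {C : ℝ} (hH : ∀ k l, H k l = H l k) (hd : ∀ k, H k k = 0) (hA : ∀ i j, A i j = A j i)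
    (hρ : ∀ k, Isonormal n (ρ k)) (hA0 : ∀ i, ∑ j, A i j = 0) (hc0 : ∑ i, c i = 0)
    (hAC : ∀ i j, |A i j| ≤ C / n) (hc : ∀ i, c i ^ 2 ≤ C ^ 2 / n) {ε : ℝ} (hε : 0 < ε)
    (k : Fin n) :
    ∃ G : ℂ, ∀ σ, Isonormal n σ →
      ‖∫ x, Complex.exp (Complex.I * (qform H A b c x : ℂ)) ∂(Measure.pi (Function.update ρ k σ))
        - G‖ ≤ (ε * (C ^ 2 * (8 * ∑ l, H k l ^ 2 + 2 * b k ^ 2))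
          + 3 * (C ^ 4 * (384 * (∑ l, H k l ^ 2) ^ 2 + 8 * b k ^ 4)) / ε) / 2 := by
  have hn : (0 : ℝ) < n := by exact_mod_cast k.pos
  have := fun k => (hρ k).prob
  have key := fun i => integral_qcoef_le (H := H) (b := b) hρ hA0 hAC hc k i
  have i2 := fun i => integrable_pow_of_memLp_four (key i).1 (p := 2) (by norm_num)
  have i4 := fun i => integrable_pow_of_memLp_four (key i).1 (p := 4) (by norm_num)
  have j2 := integrable_finsetSum Finset.univ fun i _ => i2 i
  have j4 := (integrable_finsetSum Finset.univ fun i _ => i4 i).const_mul (n : ℝ)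
  have b2 : ∫ x, ∑ i, qcoef H A b c k i x ^ 2 ∂(Measure.pi ρ)
      ≤ C ^ 2 * (8 * ∑ l, H k l ^ 2 + 2 * b k ^ 2) := by
    rw [integral_finsetSum _ fun i _ => i2 i]
    refine (Finset.sum_le_sum fun i _ => (key i).2.1).trans_eq ?_
    simp; field_simp
  have b4 : ∫ x, n * ∑ i, qcoef H A b c k i x ^ 4 ∂(Measure.pi ρ)
      ≤ C ^ 4 * (384 * (∑ l, H k l ^ 2) ^ 2 + 8 * b k ^ 4) := by
    rw [integral_const_mul, integral_finsetSum _ fun i _ => i4 i]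
    refine (mul_le_mul_of_nonneg_left (Finset.sum_le_sum fun i _ => (key i).2.2) hn.le).trans_eq ?_
    simp; field_simp
  have hmeas : Measurable (fun p : (Fin n → Fin n → ℝ) × (Fin n → ℝ) =>
      Function.update p.1 k p.2) := by
    refine measurable_pi_lambda _ fun j => ?_
    by_cases h : j = k
    · subst h; simpa using measurable_snd
    · simp only [Function.update_of_ne h]; fun_prop
  have hqm := measurable_qform H A b c
  set W : (Fin n → Fin n → ℝ) → ℝ := fun x => qform H A b c (Function.update x k 0) with hW
  have hWm : Measurable W := hqm.comp (hmeas.comp (measurable_id.prodMk measurable_const))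
  set g : (Fin n → Fin n → ℝ) → ℂ := fun x => Complex.exp (Complex.I * (W x : ℂ))
    * (1 - ((∑ i, qcoef H A b c k i x ^ 2 : ℝ) : ℂ) / 2) with hg
  have hgi : Integrable g (Measure.pi ρ) := by
    refine Integrable.bdd_mul (c := 1) ((integrable_const _).sub ((j2.ofReal (𝕜 := ℂ)).div_const 2))
      (Measurable.aestronglyMeasurable (by fun_prop)) (ae_of_all _ fun x => ?_)
    rw [Complex.norm_exp_I_mul_ofReal]
  refine ⟨∫ x, g x ∂(Measure.pi ρ), fun σ hσ => ?_⟩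
  have := hσ.prob
  have hF : Measurable (fun x : Fin n → Fin n → ℝ =>
      Complex.exp (Complex.I * (qform H A b c x : ℂ))) := by fun_prop
  have hFi : Integrable (fun p : (Fin n → Fin n → ℝ) × (Fin n → ℝ) =>
      Complex.exp (Complex.I * (qform H A b c (Function.update p.1 k p.2) : ℂ)))
      ((Measure.pi ρ).prod σ) := by
    refine Integrable.of_bound (C := 1) (hF.comp hmeas).aestronglyMeasurable
      (ae_of_all _ fun y => ?_)
    rw [Complex.norm_exp_I_mul_ofReal]
  rw [← map_update_pi_prod σ k, integral_map hmeas.aemeasurable hF.aestronglyMeasurable,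
    integral_prod _ hFi, ← integral_sub hFi.integral_prod_left hgi]
  have hbound : Integrable (fun x => (ε * ∑ i, qcoef H A b c k i x ^ 2
      + 3 * (n * ∑ i, qcoef H A b c k i x ^ 4) / ε) / 2) (Measure.pi ρ) :=
    ((j2.const_mul ε).add ((j4.const_mul 3).div_const ε)).div_const 2
  refine (norm_integral_le_of_norm_le hbound (ae_of_all _ fun x => ?_)).trans ?_
  · have e : ∀ y, Complex.exp (Complex.I * (qform H A b c (Function.update x k y) : ℂ))
        = Complex.exp (Complex.I * (W x : ℂ))
          * Complex.exp (Complex.I * ((∑ i, qcoef H A b c k i x * y i : ℝ) : ℂ)) := by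
      intro y
      rw [qform_update hH hd hA, ← Complex.exp_add, ← mul_add, ← Complex.ofReal_add]
    simp_rw [e]
    rw [integral_const_mul, hg, ← mul_sub, norm_mul, Complex.norm_exp_I_mul_ofReal, one_mul]
    exact norm_integral_exp_linear_sub_le hσ (sum_qcoef hA hA0 hc0 k x) hε
  · rw [integral_div, integral_add (j2.const_mul ε) ((j4.const_mul 3).div_const ε),
      integral_const_mul, integral_div, integral_const_mul]
    gcongr

lemma norm_integral_exp_qform_sub_le {H A : Fin n → Fin n → ℝ} {b c : Fin n → ℝ}
    {C : ℝ} (hH : ∀ k l, H k l = H l k) (hd : ∀ k, H k k = 0) (hA : ∀ i j, A i j = A j i)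
    (hA0 : ∀ i, ∑ j, A i j = 0) (hc0 : ∑ i, c i = 0)
    (hAC : ∀ i j, |A i j| ≤ C / n) (hc : ∀ i, c i ^ 2 ≤ C ^ 2 / n) {ε : ℝ} (hε : 0 < ε)
    {μ ν : Measure (Fin n → ℝ)} (hμ : Isonormal n μ) (hν : Isonormal n ν) :
    ‖∫ x, Complex.exp (Complex.I * (qform H A b c x : ℂ)) ∂(Measure.pi fun _ => μ)
        - ∫ x, Complex.exp (Complex.I * (qform H A b c x : ℂ)) ∂(Measure.pi fun _ => ν)‖
      ≤ ε * (C ^ 2 * (8 * ∑ k, ∑ l, H k l ^ 2 + 2 * ∑ k, b k ^ 2))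
          + 3 * (C ^ 4 * (384 * ∑ k, (∑ l, H k l ^ 2) ^ 2 + 8 * ∑ k, b k ^ 4)) / ε := by
  set F : (Fin n → Measure (Fin n → ℝ)) → ℂ := fun ρ =>
    ∫ x, Complex.exp (Complex.I * (qform H A b c x : ℂ)) ∂(Measure.pi ρ) with hF
  set e : Fin n → ℝ := fun k => ε * (C ^ 2 * (8 * ∑ l, H k l ^ 2 + 2 * b k ^ 2))
          + 3 * (C ^ 4 * (384 * (∑ l, H k l ^ 2) ^ 2 + 8 * b k ^ 4)) / ε with he
  have hstep : ∀ s : Finset (Fin n),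
      ‖F (fun _ => μ) - F (fun k => if k ∈ s then ν else μ)‖ ≤ ∑ k ∈ s, e k := by
    intro s
    induction s using Finset.induction_on with
    | empty => simp
    | insert k s hk ih =>
      rw [Finset.sum_insert hk]
      have hρ : ∀ j, Isonormal n (if j ∈ s then ν else μ) := by
        intro j; split_ifs <;> assumption
      obtain ⟨G, hG⟩ := exists_norm_integral_exp_qform_update_sub_le (b := b) hH hd hA hρ hA0 hc0
        hAC hc hε k
      have e1 : Function.update (fun j => if j ∈ s then ν else μ) k μ
          = fun j => if j ∈ s then ν else μ := by
        ext1 j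
        by_cases h : j = k
        · subst h; simp [hk]
        · simp [h]
      have e2 : Function.update (fun j => if j ∈ s then ν else μ) k ν
          = fun j => if j ∈ insert k s then ν else μ := by
        ext1 j
        by_cases h : j = k
        · subst h; simp
        · simp [h]
      have g1 := hG μ hμ
      have g2 := hG ν hν
      rw [e1] at g1
      rw [e2] at g2
      have tri : F (fun _ => μ) - F (fun j => if j ∈ insert k s then ν else μ)
          = (F (fun _ => μ) - F (fun j => if j ∈ s then ν else μ))
            + (F (fun j => if j ∈ s then ν else μ) - G)
            - (F (fun j => if j ∈ insert k s then ν else μ) - G) := by ring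
      rw [tri]
      refine (norm_sub_le _ _).trans ((add_le_add (norm_add_le _ _) le_rfl).trans ?_)
      refine (add_le_add (add_le_add ih g1) g2).trans_eq ?_
      simp only [he]
      ring
  have := hstep Finset.univ
  simp only [Finset.mem_univ, if_true] at this
  refine this.trans_eq ?_
  simp only [he, Finset.sum_add_distrib, ← Finset.mul_sum, ← Finset.sum_div]

end Swap

/-! ### Standard Gaussian coordinates -/

lemma integral_pow_gaussianReal :
    ∫ z, z ∂(gaussianReal 0 1) = 0 ∧ ∫ z, z ^ 2 ∂(gaussianReal 0 1) = 1
      ∧ ∫ z, z ^ 3 ∂(gaussianReal 0 1) = 0 ∧ ∫ z, z ^ 4 ∂(gaussianReal 0 1) = 3 := by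
  have hm : mgf id (gaussianReal 0 1) = fun t => Real.exp (t ^ 2 / 2) := by
    rw [mgf_id_gaussianReal]; ext t; simp
  have hk : ∀ k : ℕ, ∫ z, z ^ k ∂(gaussianReal 0 1)
      = iteratedDeriv k (fun t => Real.exp (t ^ 2 / 2)) 0 := by
    intro k
    rw [← hm, iteratedDeriv_mgf_zero (by simp)]
    rfl
  have hbase : ∀ t : ℝ, HasDerivAt (fun t => Real.exp (t ^ 2 / 2)) (t * Real.exp (t ^ 2 / 2)) t := by
    intro t
    refine ((hasDerivAt_pow 2 t).div_const 2).exp.congr_deriv ?_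
    push_cast; ring
  have hstep : ∀ (p p' : ℝ → ℝ), (∀ t, HasDerivAt p (p' t) t) →
      deriv (fun t => p t * Real.exp (t ^ 2 / 2))
        = fun t => (p' t + t * p t) * Real.exp (t ^ 2 / 2) := by
    intro p p' hp
    ext t
    exact ((hp t).fun_mul (hbase t)).deriv.trans (by ring)
  have d1 : deriv (fun t => Real.exp (t ^ 2 / 2)) = fun t => t * Real.exp (t ^ 2 / 2) := by
    ext t; exact (hbase t).deriv
  have d2 := hstep (fun t => t) (fun _ => 1) hasDerivAt_id'
  have e3 : ∀ t : ℝ, HasDerivAt (fun t : ℝ => 1 + t * t) (2 * t) t := fun t =>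
    (((hasDerivAt_id' t).fun_mul (hasDerivAt_id' t)).const_add 1).congr_deriv (by ring)
  have d3 := hstep (fun t => 1 + t * t) (fun t => 2 * t) e3
  have d4 := hstep (fun t => 2 * t + t * (1 + t * t)) (fun t => 3 + 3 * t ^ 2) fun t =>
    (((hasDerivAt_id' t).const_mul 2).fun_add
      ((hasDerivAt_id' t).fun_mul (e3 t))).congr_deriv (by ring)
  have hk1 := hk 1
  have hk2 := hk 2
  have hk3 := hk 3
  have hk4 := hk 4
  simp only [iteratedDeriv_succ, iteratedDeriv_zero, d1, d2, d3, d4] at hk1 hk2 hk3 hk4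
  refine ⟨?_, ?_, ?_, ?_⟩
  · simp at hk1 ⊢
  · simpa using hk2
  · simpa using hk3
  · simpa using hk4

lemma integrable_gaussianReal_of_le_pow {E : Type*} [NormedAddCommGroup E] {f : ℝ → E}
    (hf : AEStronglyMeasurable f (gaussianReal 0 1)) (k : ℕ) {C : ℝ}
    (h : ∀ z, ‖f z‖ ≤ C * (1 + |z| ^ k)) : Integrable f (gaussianReal 0 1) := by
  have h1 : Integrable (fun z : ℝ => |z| ^ k) (gaussianReal 0 1) := by
    have := (memLp_id_gaussianReal' (μ := 0) (v := 1) k (by simp)).integrable_norm_pow'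
    simpa using this
  exact (((integrable_const (1 : ℝ)).add h1).const_mul C).mono' hf (ae_of_all _ h)

lemma isonormal_gaussian (n : ℕ) : Isonormal n (Measure.pi fun _ : Fin n => gaussianReal 0 1) := by
  obtain ⟨m1, m2, -, m4⟩ := integral_pow_gaussianReal
  have hmp := fun i : Fin n => measurePreserving_eval (fun _ : Fin n => gaussianReal 0 1) i
  have hint : ∀ i (g : ℝ → ℝ), Measurable g →
      ∫ y, g (y i) ∂(Measure.pi fun _ : Fin n => gaussianReal 0 1)
        = ∫ z, g z ∂(gaussianReal 0 1) := by
    intro i g hg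
    have := integral_map (μ := Measure.pi fun _ : Fin n => gaussianReal 0 1)
      (measurable_pi_apply i).aemeasurable (f := g) hg.aestronglyMeasurable
    rw [(hmp i).map_eq] at this
    exact this.symm
  have key := fun w : Fin n → ℝ => moments_sum_of_iIndepFun
    (P := Measure.pi fun _ : Fin n => gaussianReal 0 1)
    (X := fun i (y : Fin n → ℝ) => w i * y i) (v := fun i => w i ^ 2) (β := fun i => w i ^ 2)
    (fun i => by fun_prop)
    (fun i => ((memLp_id_gaussianReal' 4 (by simp)).comp_measurePreserving (hmp i)).const_mul (w i))
    (iIndepFun_pi (X := fun i (z : ℝ) => w i * z) fun i => Measurable.aemeasurable (by fun_prop))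
    (fun i => le_rfl)
    (fun i => by rw [integral_const_mul, hint i (fun z => z) measurable_id, m1, mul_zero])
    (fun i => by
      simp_rw [mul_pow]
      rw [integral_const_mul, hint i (fun z => z ^ 2) (by fun_prop), m2, mul_one])
    (fun i => by
      simp_rw [mul_pow]
      rw [integral_const_mul, hint i (fun z => z ^ 4) (by fun_prop), m4]
      exact le_of_eq (by ring)) Finset.univ
  refine ⟨inferInstance, fun w _ => (key w).1, fun w _ => (key w).2.1, fun w _ => (key w).2.2.1,
    fun w _ => (key w).2.2.2.trans ?_⟩
  gcongr
  have := sq_sum_le_card_mul_sum_sq (s := (Finset.univ : Finset (Fin n))) (f := fun i => w i ^ 2)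
  simp only [Finset.card_univ, Fintype.card_fin, ← pow_mul] at this
  exact this

lemma norm_exp_I_mul_sub_one_sub_le (x : ℝ) :
    ‖Complex.exp (Complex.I * x) - 1 - Complex.I * x‖ ≤ 2 * x ^ 2 := by
  rcases le_or_gt |x| 1 with h | h
  · have h1 := norm_exp_I_mul_sub_taylor_le x
    have h2 : Complex.exp (Complex.I * x) - 1 - Complex.I * x
        = (Complex.exp (Complex.I * x) - (1 + Complex.I * x - (x : ℂ) ^ 2 / 2))
          - (x : ℂ) ^ 2 / 2 := by ring
    rw [h2]
    refine (norm_sub_le _ _).trans ?_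
    have h3 : ‖(x : ℂ) ^ 2 / 2‖ = x ^ 2 / 2 := by simp
    rw [h3]
    have : |x| ^ 3 ≤ x ^ 2 := by
      rw [← sq_abs, pow_succ]
      exact mul_le_of_le_one_right (by positivity) h
    nlinarith [sq_nonneg x]
  · have h1 := Real.norm_exp_I_mul_ofReal_sub_one_le (x := x)
    refine (norm_sub_le _ _).trans ?_
    have h2 : ‖Complex.I * (x : ℂ)‖ = |x| := by simp
    rw [h2]
    rw [Real.norm_eq_abs] at h1
    rw [← sq_abs]
    nlinarith

/-- The characteristic function of `l * (z ^ 2 - 1) + β * z` for small `l`. -/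
lemma exists_norm_integral_exp_quadratic_sub_le :
    ∃ C : ℝ, 0 ≤ C ∧ ∀ l β : ℝ, |l| ≤ 1 →
      ‖∫ z, Complex.exp (Complex.I * ((l * (z ^ 2 - 1) + β * z : ℝ) : ℂ)) ∂(gaussianReal 0 1)
        - Complex.exp (-((2 * l ^ 2 + β ^ 2 : ℝ) : ℂ) / 2)‖ ≤ C * (|l| * (l ^ 2 + β ^ 2)) := by
  obtain ⟨m1, m2, m3, m4⟩ := integral_pow_gaussianReal
  set γ := gaussianReal 0 1
  have hip : ∀ k : ℕ, Integrable (fun z : ℝ => z ^ k) γ := fun k =>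
    integrable_gaussianReal_of_le_pow (Measurable.aestronglyMeasurable (by fun_prop)) k (C := 1)
      fun z => by simp
  have hexp : ∀ x : ℝ, ‖Complex.exp (Complex.I * (x : ℂ))‖ = 1 := Complex.norm_exp_I_mul_ofReal
  have hq : ∀ z : ℝ, |z ^ 2 - 1| ≤ 1 + |z| ^ 2 := fun z => by
    rw [sq_abs]; exact abs_le.2 ⟨by nlinarith [sq_nonneg z], by nlinarith [sq_nonneg z]⟩
  have i1 : Integrable (fun z : ℝ => |z ^ 2 - 1| ^ 3) γ := by
    refine integrable_gaussianReal_of_le_pow (Measurable.aestronglyMeasurable (by fun_prop)) 6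
      (C := 4) fun z => ?_
    rw [norm_pow, Real.norm_eq_abs, abs_abs]
    have h1 := pow_le_pow_left₀ (abs_nonneg _) (hq z) 3
    have h2 := add_pow_le (a := 1) (b := |z| ^ 2) zero_le_one (by positivity) 3
    rw [← pow_mul, one_pow] at h2
    norm_num only at h2
    exact h1.trans h2
  have i2 : Integrable (fun z : ℝ => 2 * (z ^ 2 * |z ^ 2 - 1|)) γ := by
    refine integrable_gaussianReal_of_le_pow (Measurable.aestronglyMeasurable (by fun_prop)) 4
      (C := 4) fun z => ?_
    rw [Real.norm_eq_abs, abs_of_nonneg (by positivity)]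
    have h1 := mul_le_mul_of_nonneg_left (hq z) (sq_nonneg z)
    rw [sq_abs] at h1
    rw [show |z| ^ 4 = (z ^ 2) ^ 2 by rw [← sq_abs z]; ring]
    nlinarith [sq_nonneg (z ^ 2 - 1)]
  have i3 : Integrable (fun z : ℝ => |z| * |2 - (z ^ 2 - 1) ^ 2|) γ := by
    refine integrable_gaussianReal_of_le_pow (Measurable.aestronglyMeasurable (by fun_prop)) 6
      (C := 8) fun z => ?_
    rw [Real.norm_eq_abs, abs_of_nonneg (by positivity)]
    have h1 : |2 - (z ^ 2 - 1) ^ 2| ≤ 1 + z ^ 4 + 2 * z ^ 2 := by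
      rw [abs_le]; constructor <;> nlinarith [sq_nonneg (z ^ 2), sq_nonneg z]
    have h2 := mul_le_mul_of_nonneg_left h1 (abs_nonneg z)
    refine h2.trans ?_
    rw [← sq_abs z, show z ^ 4 = |z| ^ 4 by rw [pow_abs]; exact (abs_of_nonneg (by positivity)).symm]
    have h0 := abs_nonneg z
    set y := |z|
    rcases le_total y 1 with h | h
    · have a1 : y ^ 5 ≤ 1 := pow_le_one₀ h0 h
      have a2 : y ^ 3 ≤ 1 := pow_le_one₀ h0 h
      have a3 : 0 ≤ y ^ 6 := by positivity
      nlinarith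
    · have a1 : y ^ 5 ≤ y ^ 6 := pow_le_pow_right₀ h (by norm_num)
      have a2 : y ^ 3 ≤ y ^ 6 := pow_le_pow_right₀ h (by norm_num)
      have a3 : y ≤ y ^ 6 := le_self_pow₀ h (by norm_num)
      nlinarith
  set K₁ := ∫ z, |z ^ 2 - 1| ^ 3 ∂γ with hK₁
  set K₂ := ∫ z, 2 * (z ^ 2 * |z ^ 2 - 1|) ∂γ with hK₂
  set K₃ := ∫ z, |z| * |2 - (z ^ 2 - 1) ^ 2| ∂γ with hK₃
  have p1 : 0 ≤ K₁ := integral_nonneg fun z => by positivity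
  have p2 : 0 ≤ K₂ := integral_nonneg fun z => by positivity
  have p3 : 0 ≤ K₃ := integral_nonneg fun z => by positivity
  refine ⟨K₁ + K₂ + K₃ + 1, by positivity, fun l β hl => ?_⟩
  set E : ℝ → ℂ := fun z => Complex.exp (Complex.I * ((β * z : ℝ) : ℂ)) with hE
  set q : ℝ → ℝ := fun z => z ^ 2 - 1 with hqdef
  set T₁ : ℝ → ℂ := fun z => E z * (Complex.exp (Complex.I * ((l * q z : ℝ) : ℂ))
    - (1 + Complex.I * ((l * q z : ℝ) : ℂ) - ((l * q z : ℝ) : ℂ) ^ 2 / 2)) with hT₁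
  set T₂ : ℝ → ℂ := fun z => Complex.I * l * (q z : ℂ)
    * (E z - 1 - Complex.I * ((β * z : ℝ) : ℂ)) with hT₂
  set T₃ : ℝ → ℂ := fun z => (l : ℂ) ^ 2 / 2 * (((2 - q z ^ 2 : ℝ) : ℂ) * (E z - 1)) with hT₃
  set T₄ : ℝ → ℂ := fun z => ((l * q z : ℝ) : ℂ) * Complex.I - ((l * (β * (z * q z)) : ℝ) : ℂ)
    + ((l ^ 2 / 2 * (2 - q z ^ 2) : ℝ) : ℂ) with hT₄
  have b1 : ∀ z, ‖T₁ z‖ ≤ |l| ^ 3 * |z ^ 2 - 1| ^ 3 := fun z => by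
    rw [hT₁]; dsimp only
    rw [norm_mul, hE, hexp, one_mul]
    refine (norm_exp_I_mul_sub_taylor_le _).trans_eq ?_
    rw [abs_mul, mul_pow]
  have b2 : ∀ z, ‖T₂ z‖ ≤ |l| * β ^ 2 * (2 * (z ^ 2 * |z ^ 2 - 1|)) := fun z => by
    rw [hT₂]; dsimp only
    rw [norm_mul, norm_mul, norm_mul, Complex.norm_I, one_mul, Complex.norm_real,
      Complex.norm_real, Real.norm_eq_abs, Real.norm_eq_abs]
    refine (mul_le_mul_of_nonneg_left (norm_exp_I_mul_sub_one_sub_le (β * z))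
      (by positivity)).trans_eq ?_
    ring
  have b3 : ∀ z, ‖T₃ z‖ ≤ l ^ 2 / 2 * |β| * (|z| * |2 - (z ^ 2 - 1) ^ 2|) := fun z => by
    rw [hT₃]; dsimp only
    have h1 : ‖(l : ℂ) ^ 2 / 2‖ = l ^ 2 / 2 := by simp
    rw [norm_mul, norm_mul, h1, Complex.norm_real, Real.norm_eq_abs]
    have h2 := Real.norm_exp_I_mul_ofReal_sub_one_le (x := β * z)
    rw [Real.norm_eq_abs, abs_mul] at h2
    refine (mul_le_mul_of_nonneg_left (mul_le_mul_of_nonneg_left h2 (abs_nonneg _))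
      (by positivity)).trans_eq ?_
    ring
  have hEm : Measurable E := by fun_prop
  have hqm : Measurable q := by fun_prop
  have t1 : Integrable T₁ γ := (i1.const_mul (|l| ^ 3)).mono'
    (Measurable.aestronglyMeasurable (by fun_prop)) (ae_of_all _ b1)
  have t2 : Integrable T₂ γ := (i2.const_mul (|l| * β ^ 2)).mono'
    (Measurable.aestronglyMeasurable (by fun_prop)) (ae_of_all _ b2)
  have t3 : Integrable T₃ γ := (i3.const_mul (l ^ 2 / 2 * |β|)).mono'
    (Measurable.aestronglyMeasurable (by fun_prop)) (ae_of_all _ b3)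
  have g0 : Integrable (fun z => l * q z) γ := ((hip 2).sub (integrable_const 1)).const_mul l
  have g1 : Integrable (fun z => l * (β * (z * q z))) γ := by
    have : (fun z => z * q z) = fun z => z ^ 3 - z ^ 1 := by ext z; simp only [hqdef]; ring
    have h : Integrable (fun z => z * q z) γ := this ▸ (hip 3).sub (hip 1)
    exact (h.const_mul β).const_mul l
  have g2 : Integrable (fun z => l ^ 2 / 2 * (2 - q z ^ 2)) γ := by
    have : (fun z => 2 - q z ^ 2) = fun z => 1 + (2 * z ^ 2 - z ^ 4) := by
      ext z; simp only [hqdef]; ring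
    have h : Integrable (fun z => 2 - q z ^ 2) γ :=
      this ▸ (integrable_const 1).add (((hip 2).const_mul 2).sub (hip 4))
    exact h.const_mul _
  have v0 : ∫ z, l * q z ∂γ = 0 := by
    rw [integral_const_mul, hqdef, integral_sub (hip 2) (integrable_const 1), m2]; simp
  have v1 : ∫ z, l * (β * (z * q z)) ∂γ = 0 := by
    rw [integral_const_mul, integral_const_mul]
    have : (fun z => z * q z) = fun z => z ^ 3 - z := by ext z; simp only [hqdef]; ring
    rw [this, integral_sub (hip 3) (by simpa using hip 1), m3, m1]; simp
  have v2 : ∫ z, l ^ 2 / 2 * (2 - q z ^ 2) ∂γ = 0 := by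
    have : (fun z => 2 - q z ^ 2) = fun z => (1 + 2 * z ^ 2) - z ^ 4 := by
      ext z; simp only [hqdef]; ring
    have h : Integrable (fun z : ℝ => 1 + 2 * z ^ 2) γ :=
      (integrable_const 1).add ((hip 2).const_mul 2)
    rw [integral_const_mul, this, integral_sub h (hip 4),
      integral_add (integrable_const 1) ((hip 2).const_mul 2), integral_const_mul, m2, m4]
    simp; norm_num
  have g0' := (g0.ofReal (𝕜 := ℂ)).mul_const Complex.I
  have g1' := g1.ofReal (𝕜 := ℂ)
  have g2' := g2.ofReal (𝕜 := ℂ)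
  have t4 : Integrable T₄ γ := (g0'.sub g1').add g2'
  have v4 : ∫ z, T₄ z ∂γ = 0 := by
    refine (integral_add (g0'.sub g1') g2').trans ?_
    have w0 : ∫ z, ((l * q z : ℝ) : ℂ) ∂γ = 0 := by rw [integral_complex_ofReal, v0]; simp
    have w1 : ∫ z, ((l * (β * (z * q z)) : ℝ) : ℂ) ∂γ = 0 := by
      rw [integral_complex_ofReal, v1]; simp
    have w2 : ∫ z, ((l ^ 2 / 2 * (2 - q z ^ 2) : ℝ) : ℂ) ∂γ = 0 := by
      rw [integral_complex_ofReal, v2]; simp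
    refine (congrArg₂ _ (integral_sub g0' g1') rfl).trans ?_
    refine (congrArg₂ _ (congrArg₂ _ (integral_mul_const _ _) rfl) rfl).trans ?_
    refine (congrArg₂ _ (congrArg₂ _ (congrArg₂ _ w0 rfl) w1) w2).trans ?_
    simp
  have hEi : Integrable E γ := Integrable.of_bound (C := 1) hEm.aestronglyMeasurable
    (ae_of_all _ fun z => (hexp _).le)
  have hEv : ∫ z, E z ∂γ = Complex.exp (-(β : ℂ) ^ 2 / 2) := by
    have := charFun_gaussianReal (μ := 0) (v := 1) β
    rw [charFun_apply_real] at this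
    simp only [hE]
    convert this using 3
    · congr 1; push_cast; ring
    · simp; ring
  have hdec : ∀ z, Complex.exp (Complex.I * ((l * (z ^ 2 - 1) + β * z : ℝ) : ℂ))
      = ((1 - l ^ 2 : ℝ) : ℂ) * E z + (T₁ z + T₂ z + T₃ z + T₄ z) := fun z => by
    have : Complex.exp (Complex.I * ((l * (z ^ 2 - 1) + β * z : ℝ) : ℂ))
        = E z * Complex.exp (Complex.I * ((l * q z : ℝ) : ℂ)) := by
      rw [hE, ← Complex.exp_add]; congr 1; push_cast; simp only [hqdef]; push_cast; ring
    rw [this]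
    simp only [hT₁, hT₂, hT₃, hT₄]
    push_cast
    linear_combination ((l : ℂ) * q z * β * z) * Complex.I_sq
  simp_rw [hdec]
  have hsum : ∫ z, ((1 - l ^ 2 : ℝ) : ℂ) * E z + (T₁ z + T₂ z + T₃ z + T₄ z) ∂γ
      = ((1 - l ^ 2 : ℝ) : ℂ) * Complex.exp (-(β : ℂ) ^ 2 / 2)
        + (∫ z, T₁ z ∂γ + ∫ z, T₂ z ∂γ + ∫ z, T₃ z ∂γ + 0) := by
    rw [← hEv, ← integral_const_mul, ← v4, ← integral_add t1 t2]
    refine (integral_add (hEi.const_mul _) (((t1.add t2).add t3).add t4)).trans ?_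
    refine congrArg _ ((integral_add ((t1.add t2).add t3) t4).trans ?_)
    exact congrArg₂ _ (integral_add (t1.add t2) t3) rfl
  rw [hsum]
  have n1 : ‖∫ z, T₁ z ∂γ‖ ≤ |l| ^ 3 * K₁ :=
    (norm_integral_le_of_norm_le (i1.const_mul _) (ae_of_all _ b1)).trans_eq
      (integral_const_mul _ _)
  have n2 : ‖∫ z, T₂ z ∂γ‖ ≤ |l| * β ^ 2 * K₂ :=
    (norm_integral_le_of_norm_le (i2.const_mul _) (ae_of_all _ b2)).trans_eq
      (integral_const_mul _ _)
  have n3 : ‖∫ z, T₃ z ∂γ‖ ≤ l ^ 2 / 2 * |β| * K₃ :=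
    (norm_integral_le_of_norm_le (i3.const_mul _) (ae_of_all _ b3)).trans_eq
      (integral_const_mul _ _)
  have n4 : ‖((1 - l ^ 2 : ℝ) : ℂ) * Complex.exp (-(β : ℂ) ^ 2 / 2)
      - Complex.exp (-((2 * l ^ 2 + β ^ 2 : ℝ) : ℂ) / 2)‖ ≤ |l| ^ 3 := by
    have e1 : ((1 - l ^ 2 : ℝ) : ℂ) * Complex.exp (-(β : ℂ) ^ 2 / 2)
        - Complex.exp (-((2 * l ^ 2 + β ^ 2 : ℝ) : ℂ) / 2)
        = (((1 - l ^ 2 - Real.exp (-l ^ 2)) * Real.exp (-β ^ 2 / 2) : ℝ) : ℂ) := by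
      have : Complex.exp (-((2 * l ^ 2 + β ^ 2 : ℝ) : ℂ) / 2)
          = Complex.exp (-(l : ℂ) ^ 2) * Complex.exp (-(β : ℂ) ^ 2 / 2) := by
        rw [← Complex.exp_add]; congr 1; push_cast; ring
      rw [this]; push_cast; ring
    rw [e1, Complex.norm_real, Real.norm_eq_abs, abs_mul, abs_of_pos (Real.exp_pos _)]
    have h1 : Real.exp (-β ^ 2 / 2) ≤ 1 := Real.exp_le_one_iff.2 (by nlinarith [sq_nonneg β])
    have hl2 : l ^ 2 ≤ 1 := by rw [← sq_abs]; exact pow_le_one₀ (abs_nonneg _) hl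
    have h2 : |1 - l ^ 2 - Real.exp (-l ^ 2)| ≤ (l ^ 2) ^ 2 := by
      have := Real.abs_exp_sub_one_sub_id_le (x := -l ^ 2)
        (by rw [abs_neg, abs_of_nonneg (sq_nonneg l)]; exact hl2)
      rw [abs_sub_comm] at this
      convert this using 1
      · congr 1; ring
      · ring
    have h3 : (l ^ 2) ^ 2 ≤ |l| ^ 3 := by
      rw [← sq_abs l, ← pow_mul]
      exact pow_le_pow_of_le_one (abs_nonneg _) hl (by norm_num)
    exact (mul_le_mul (h2.trans h3) h1 (Real.exp_pos _).le (by positivity)).trans_eq (mul_one _)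
  set X := ((1 - l ^ 2 : ℝ) : ℂ) * Complex.exp (-(β : ℂ) ^ 2 / 2) with hX
  set Y := Complex.exp (-((2 * l ^ 2 + β ^ 2 : ℝ) : ℂ) / 2) with hY
  rw [show X + (∫ z, T₁ z ∂γ + ∫ z, T₂ z ∂γ + ∫ z, T₃ z ∂γ + 0) - Y
    = ∫ z, T₁ z ∂γ + ∫ z, T₂ z ∂γ + ∫ z, T₃ z ∂γ + (X - Y) by ring]
  refine (norm_add₄_le).trans ((add_le_add (add_le_add (add_le_add n1 n2) n3) n4).trans ?_)
  have hb := sq_abs l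
  have hb' := sq_abs β
  have k3 : l ^ 2 / 2 * |β| ≤ |l| * (l ^ 2 + β ^ 2) := by
    rw [← hb, ← hb']
    have : |l| ^ 2 / 2 * |β| = |l| * (|l| * |β| / 2) := by ring
    rw [this]
    refine mul_le_mul_of_nonneg_left ?_ (abs_nonneg l)
    nlinarith [sq_nonneg (|l| - |β|), abs_nonneg l, abs_nonneg β]
  have k1 : |l| ^ 3 ≤ |l| * (l ^ 2 + β ^ 2) := by
    rw [pow_succ', hb]; nlinarith [mul_nonneg (abs_nonneg l) (sq_nonneg β)]
  have k2 : |l| * β ^ 2 ≤ |l| * (l ^ 2 + β ^ 2) := by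
    nlinarith [mul_nonneg (abs_nonneg l) (sq_nonneg l)]
  nlinarith [mul_le_mul_of_nonneg_right k1 p1, mul_le_mul_of_nonneg_right k2 p2,
    mul_le_mul_of_nonneg_right k3 p3]

/-! ### Quadratic forms in Gaussian variables -/

section Diagonalize

variable {ι : Type*} [Fintype ι] [DecidableEq ι]

/-- A symmetric matrix is diagonal in an orthonormal basis, and the standard Gaussian measure is
invariant under the corresponding change of coordinates. -/
lemma exists_orthonormal_diagonalization {M : ι → ι → ℝ} (hM : ∀ r s, M r s = M s r) :
    ∃ (e : ι → ι → ℝ) (l : ι → ℝ),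
      (∀ i j, ∑ r, e i r * e j r = if i = j then 1 else 0)
      ∧ (∀ v : ι → ℝ, ∑ i, (∑ r, v r * e i r) ^ 2 = ∑ r, v r ^ 2)
      ∧ (∀ i r, ∑ s, M r s * e i s = l i * e i r)
      ∧ ∑ i, l i = ∑ r, M r r
      ∧ (Measure.pi fun _ : ι => gaussianReal 0 1).map (fun z r => ∑ i, z i * e i r)
          = Measure.pi fun _ : ι => gaussianReal 0 1 := by
  have hH : (Matrix.of M).IsHermitian := by
    ext r s; simp [hM r s]
  set b := hH.eigenvectorBasis with hb
  have hin : ∀ x y : EuclideanSpace ℝ ι, inner ℝ x y = ∑ r, y r * x r := fun x y => by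
    simp [PiLp.inner_apply]
  refine ⟨fun i r => b i r, hH.eigenvalues, fun i j => ?_, fun v => ?_, fun i r => ?_, ?_, ?_⟩
  · have := orthonormal_iff_ite.1 b.orthonormal i j
    rw [hin] at this
    rw [← this]
    exact Finset.sum_congr rfl fun r _ => mul_comm _ _
  · have := b.sum_sq_inner_right (WithLp.toLp 2 v)
    simp_rw [hin] at this
    rw [this, EuclideanSpace.norm_sq_eq]
    simp
  · have := congrFun (hH.mulVec_eigenvectorBasis i) r
    simpa [Matrix.mulVec, dotProduct] using this
  · have := hH.trace_eq_sum_eigenvalues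
    simp only [Matrix.trace, Matrix.diag_apply, Matrix.of_apply] at this
    simpa using this.symm
  · have h1 := stdGaussian_eq_map_pi_orthonormalBasis b
    rw [← map_pi_eq_stdGaussian] at h1
    have h2 := congrArg (Measure.map (WithLp.ofLp : EuclideanSpace ℝ ι → ι → ℝ)) h1
    rw [Measure.map_map (by fun_prop) (by fun_prop), Measure.map_map (by fun_prop) (by fun_prop)]
      at h2
    have h3 : (WithLp.ofLp : EuclideanSpace ℝ ι → ι → ℝ) ∘ WithLp.toLp 2 = id := rfl
    rw [h3, Measure.map_id] at h2
    conv_rhs => rw [h2]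
    congr 1
    ext z r
    simp

lemma norm_prod_sub_prod_le {κ : Type*} (s : Finset κ) {f g : κ → ℂ} (hf : ∀ i, ‖f i‖ ≤ 1)
    (hg : ∀ i, ‖g i‖ ≤ 1) : ‖∏ i ∈ s, f i - ∏ i ∈ s, g i‖ ≤ ∑ i ∈ s, ‖f i - g i‖ := by
  classical
  induction s using Finset.induction_on with
  | empty => simp
  | insert a s ha ih =>
    rw [Finset.prod_insert ha, Finset.prod_insert ha, Finset.sum_insert ha]
    have h1 : f a * ∏ i ∈ s, f i - g a * ∏ i ∈ s, g i
        = (f a - g a) * ∏ i ∈ s, f i + g a * (∏ i ∈ s, f i - ∏ i ∈ s, g i) := by ring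
    rw [h1]
    refine (norm_add_le _ _).trans (add_le_add ?_ ?_)
    · rw [norm_mul, norm_prod]
      exact mul_le_of_le_one_right (norm_nonneg _)
        (Finset.prod_le_one (fun i _ => norm_nonneg _) fun i _ => hf i)
    · rw [norm_mul]
      exact (mul_le_of_le_one_left (norm_nonneg _) (hg a)).trans ih

/-- A trace-free Gaussian quadratic polynomial whose matrix has small operator norm is almost
Gaussian. -/
lemma exists_norm_integral_exp_quadratic_pi_sub_le :
    ∃ C : ℝ, 0 ≤ C ∧ ∀ (ι : Type) [Fintype ι] [DecidableEq ι] (M : ι → ι → ℝ) (w : ι → ℝ) (η : ℝ),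
      (∀ r s, M r s = M s r) → ∑ r, M r r = 0 → 0 ≤ η → η ≤ 1 →
      (∀ v : ι → ℝ, ∑ r, (∑ s, M r s * v s) ^ 2 ≤ η ^ 2 * ∑ r, v r ^ 2) →
      ‖∫ y, Complex.exp (Complex.I * ((∑ r, ∑ s, M r s * (y r * y s) + ∑ r, w r * y r : ℝ) : ℂ))
          ∂(Measure.pi fun _ : ι => gaussianReal 0 1)
        - Complex.exp (-((2 * ∑ r, ∑ s, M r s ^ 2 + ∑ r, w r ^ 2 : ℝ) : ℂ) / 2)‖
        ≤ C * (η * (∑ r, ∑ s, M r s ^ 2 + ∑ r, w r ^ 2)) := by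
  obtain ⟨C, hC, hone⟩ := exists_norm_integral_exp_quadratic_sub_le
  refine ⟨C, hC, fun ι _ _ M w η hM htr hη0 hη1 hop => ?_⟩
  obtain ⟨e, l, horth, hpars, heig, htrl, hmap⟩ := exists_orthonormal_diagonalization hM
  set β : ι → ℝ := fun i => ∑ r, w r * e i r with hβ
  have hnorm : ∀ i, ∑ r, e i r ^ 2 = 1 := fun i => by
    have := horth i i
    simpa [← sq] using this
  have hlsq : ∀ i, l i ^ 2 = ∑ r, (∑ s, M r s * e i s) ^ 2 := fun i => by
    simp_rw [heig, mul_pow]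
    rw [← Finset.mul_sum, hnorm, mul_one]
  have hl : ∀ i, |l i| ≤ η := fun i => by
    refine abs_le_of_sq_le_sq ?_ hη0
    rw [hlsq]
    refine (hop (e i)).trans_eq ?_
    rw [hnorm, mul_one]
  have hl2 : ∑ i, l i ^ 2 = ∑ r, ∑ s, M r s ^ 2 := by
    simp_rw [hlsq]
    rw [Finset.sum_comm]
    exact Finset.sum_congr rfl fun r _ => hpars (M r)
  have hβ2 : ∑ i, β i ^ 2 = ∑ r, w r ^ 2 := hpars w
  have hform : ∀ z : ι → ℝ,
      ∑ r, ∑ s, M r s * ((∑ i, z i * e i r) * ∑ i, z i * e i s)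
        + ∑ r, w r * ∑ i, z i * e i r = ∑ i, (l i * (z i ^ 2 - 1) + β i * z i) := fun z => by
    have q1 : ∀ r, ∑ s, M r s * ((∑ i, z i * e i r) * ∑ i, z i * e i s)
        = ∑ i, ∑ j, z i * z j * l j * (e i r * e j r) := fun r => by
      have : ∀ s, M r s * ((∑ i, z i * e i r) * ∑ i, z i * e i s)
          = ∑ i, ∑ j, z i * z j * e i r * (M r s * e j s) := fun s => by
        rw [Finset.sum_mul_sum, Finset.mul_sum]
        refine Finset.sum_congr rfl fun i _ => ?_
        rw [Finset.mul_sum]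
        exact Finset.sum_congr rfl fun j _ => by ring
      simp_rw [this]
      rw [Finset.sum_comm]
      refine Finset.sum_congr rfl fun i _ => ?_
      rw [Finset.sum_comm]
      refine Finset.sum_congr rfl fun j _ => ?_
      rw [← Finset.mul_sum, heig]; ring
    have q2 : ∑ r, w r * ∑ i, z i * e i r = ∑ i, β i * z i := by
      simp_rw [hβ, Finset.mul_sum, Finset.sum_mul]
      rw [Finset.sum_comm]
      exact Finset.sum_congr rfl fun i _ => Finset.sum_congr rfl fun r _ => by ring
    have q3 : ∑ r, ∑ i, ∑ j, z i * z j * l j * (e i r * e j r) = ∑ i, l i * z i ^ 2 := by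
      rw [Finset.sum_comm]
      refine Finset.sum_congr rfl fun i _ => ?_
      rw [Finset.sum_comm]
      simp_rw [← Finset.mul_sum, horth]
      simp; ring
    simp_rw [q1]
    rw [q2, q3, Finset.sum_add_distrib]
    simp_rw [mul_sub, mul_one]
    rw [Finset.sum_sub_distrib, htrl, htr, sub_zero]
  have hexp : Complex.exp (-((2 * ∑ r, ∑ s, M r s ^ 2 + ∑ r, w r ^ 2 : ℝ) : ℂ) / 2)
      = ∏ i, Complex.exp (-((2 * l i ^ 2 + β i ^ 2 : ℝ) : ℂ) / 2) := by
    rw [← Complex.exp_sum, ← hl2, ← hβ2, Finset.mul_sum, ← Finset.sum_add_distrib,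
      Complex.ofReal_sum, ← Finset.sum_neg_distrib, Finset.sum_div]
  rw [hexp, ← hmap, integral_map (Measurable.aemeasurable (by fun_prop))
    (Measurable.aestronglyMeasurable (by fun_prop))]
  simp_rw [hform, Complex.ofReal_sum, Finset.mul_sum, Complex.exp_sum]
  rw [integral_fintype_prod_eq_prod (f := fun i (z : ℝ) =>
    Complex.exp (Complex.I * ((l i * (z ^ 2 - 1) + β i * z : ℝ) : ℂ)))]
  push_cast
  refine (norm_prod_sub_prod_le _ (fun i => ?_) fun i => ?_).trans ?_
  · refine (norm_integral_le_integral_norm _).trans ?_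
    have : ∀ z : ℝ, ‖Complex.exp (Complex.I * ((l i : ℂ) * ((z : ℂ) ^ 2 - 1) + β i * z))‖ = 1 :=
      fun z => by
        have := Complex.norm_exp_I_mul_ofReal (l i * (z ^ 2 - 1) + β i * z)
        push_cast at this; exact this
    simp_rw [this]; simp
  · have : -(2 * (l i : ℂ) ^ 2 + (β i : ℂ) ^ 2) / 2 = ((-(2 * l i ^ 2 + β i ^ 2) / 2 : ℝ) : ℂ) := by
      push_cast; ring
    rw [this, Complex.norm_exp_ofReal]
    exact Real.exp_le_one_iff.2 (by nlinarith [sq_nonneg (l i), sq_nonneg (β i)])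
  · rw [← hl2, ← hβ2, ← Finset.sum_add_distrib, Finset.mul_sum, Finset.mul_sum]
    refine Finset.sum_le_sum fun i _ => ?_
    have := hone (l i) (β i) ((hl i).trans hη1)
    push_cast at this
    refine this.trans ?_
    gcongr
    exact hl i

end Diagonalize

/-! ### Bilinear statistics of Gaussian and of one-hot rows -/

lemma integral_pi_pi_gaussianReal {n : ℕ} {F : (Fin n → Fin n → ℝ) → ℂ} (hF : Measurable F) :
    ∫ x, F x ∂(Measure.pi fun _ : Fin n => Measure.pi fun _ : Fin n => gaussianReal 0 1)
      = ∫ y, F (fun k i => y (k, i)) ∂(Measure.pi fun _ : Fin n × Fin n => gaussianReal 0 1) := by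
  have h := Measure.infinitePi_map_curry (ι := Fin n) (κ := Fin n) (X := ℝ)
    (fun _ _ => gaussianReal 0 1)
  simp only [Measure.infinitePi_eq_pi] at h
  rw [← h, integral_map (MeasurableEquiv.measurable _).aemeasurable hF.aestronglyMeasurable]
  rfl

lemma exists_norm_integral_exp_qform_gaussian_sub_le :
    ∃ C : ℝ, 0 ≤ C ∧ ∀ (n : ℕ) (H A : Fin n → Fin n → ℝ) (b c : Fin n → ℝ) (η B : ℝ),
      (∀ k l, H k l = H l k) → (∀ k, H k k = 0) → (∀ i j, A i j = A j i) → 0 ≤ η → 0 ≤ B →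
      η * B ≤ 1 → ∑ i, ∑ j, A i j ^ 2 ≤ B ^ 2 →
      (∀ v : Fin n → ℝ, ∑ k, (∑ l, H k l * v l) ^ 2 ≤ η ^ 2 * ∑ k, v k ^ 2) →
      ‖∫ x, Complex.exp (Complex.I * (qform H A b c x : ℂ))
          ∂(Measure.pi fun _ : Fin n => Measure.pi fun _ : Fin n => gaussianReal 0 1)
        - Complex.exp (-((2 * ((∑ k, ∑ l, H k l ^ 2) * ∑ i, ∑ j, A i j ^ 2)
            + (∑ k, b k ^ 2) * ∑ i, c i ^ 2 : ℝ) : ℂ) / 2)‖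
        ≤ C * (η * B * ((∑ k, ∑ l, H k l ^ 2) * ∑ i, ∑ j, A i j ^ 2
            + (∑ k, b k ^ 2) * ∑ i, c i ^ 2)) := by
  obtain ⟨C, hC, hpi⟩ := exists_norm_integral_exp_quadratic_pi_sub_le
  refine ⟨C, hC, fun n H A b c η B hH hd hA hη hB hηB hAB hop => ?_⟩
  have hmeas : Measurable fun x : Fin n → Fin n → ℝ =>
      Complex.exp (Complex.I * (qform H A b c x : ℂ)) := by
    have := measurable_qform H A b c
    fun_prop
  have key := hpi (Fin n × Fin n) (fun r s => H r.1 s.1 * A r.2 s.2) (fun r => b r.1 * c r.2)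
    (η * B) (fun r s => by rw [hH, hA]) (by simp [hd]) (by positivity) hηB (fun v => by
      simp only [Fintype.sum_prod_type]
      have e1 : ∀ k i, ∑ l, ∑ j, H k l * A i j * v (l, j) = ∑ l, H k l * ∑ j, A i j * v (l, j) :=
        fun k i => Finset.sum_congr rfl fun l _ => by
          rw [Finset.mul_sum]; exact Finset.sum_congr rfl fun j _ => by ring
      simp_rw [e1]
      rw [Finset.sum_comm]
      refine (Finset.sum_le_sum fun i _ => hop fun l => ∑ j, A i j * v (l, j)).trans ?_
      rw [← Finset.mul_sum, mul_pow, mul_assoc]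
      refine mul_le_mul_of_nonneg_left ?_ (sq_nonneg η)
      refine (Finset.sum_le_sum fun i _ => Finset.sum_le_sum fun l _ =>
        Finset.sum_mul_sq_le_sq_mul_sq Finset.univ (A i) fun j => v (l, j)).trans ?_
      simp_rw [← Finset.mul_sum]
      rw [← Finset.sum_mul]
      exact mul_le_mul_of_nonneg_right hAB
        (Finset.sum_nonneg fun _ _ => Finset.sum_nonneg fun _ _ => sq_nonneg _))
  have s1 : ∑ r : Fin n × Fin n, ∑ s : Fin n × Fin n, (H r.1 s.1 * A r.2 s.2) ^ 2
      = (∑ k, ∑ l, H k l ^ 2) * ∑ i, ∑ j, A i j ^ 2 := by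
    simp only [Fintype.sum_prod_type, mul_pow, ← Finset.mul_sum, ← Finset.sum_mul]
  have s2 : ∑ r : Fin n × Fin n, (b r.1 * c r.2) ^ 2 = (∑ k, b k ^ 2) * ∑ i, c i ^ 2 := by
    simp only [Fintype.sum_prod_type, mul_pow, ← Finset.mul_sum, ← Finset.sum_mul]
  rw [s1, s2] at key
  rw [integral_pi_pi_gaussianReal hmeas]
  have hq : ∀ y : Fin n × Fin n → ℝ, qform H A b c (fun k i => y (k, i))
      = ∑ r, ∑ s : Fin n × Fin n, H r.1 s.1 * A r.2 s.2 * (y r * y s)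
        + ∑ r : Fin n × Fin n, b r.1 * c r.2 * y r := fun y => by
    simp only [qform, Fintype.sum_prod_type]
    congr 1
    · refine Finset.sum_congr rfl fun k _ => ?_
      rw [Finset.sum_comm]
      refine Finset.sum_congr rfl fun l _ => ?_
      simp_rw [Finset.mul_sum]
      exact Finset.sum_congr rfl fun i _ => Finset.sum_congr rfl fun j _ => by ring
    · refine Finset.sum_congr rfl fun k _ => ?_
      rw [Finset.mul_sum]
      exact Finset.sum_congr rfl fun i _ => by ring
  simp_rw [hq]
  exact key

section Spike

variable (n : ℕ) [NeZero n]

/-- The law of `√n` times a uniformly random standard basis vector. -/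
noncomputable def spike : Measure (Fin n → ℝ) :=
  (PMF.uniformOfFintype (Fin n)).toMeasure.map fun i => Pi.single i (Real.sqrt n)

lemma integral_spike {F : (Fin n → ℝ) → ℝ} (hF : StronglyMeasurable F) :
    ∫ y, F y ∂(spike n) = (n : ℝ)⁻¹ * ∑ i : Fin n, F (Pi.single i (Real.sqrt n)) := by
  rw [spike, integral_map (Measurable.of_discrete.aemeasurable) hF.aestronglyMeasurable,
    integral_fintype (Integrable.of_finite), Finset.mul_sum]
  refine Finset.sum_congr rfl fun i _ => ?_
  congr 1
  rw [measureReal_def, PMF.toMeasure_apply_singleton _ _ (measurableSet_singleton _)]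
  simp

lemma isonormal_spike : Isonormal n (spike n) := by
  have hn : (0 : ℝ) < n := by exact_mod_cast Nat.pos_of_ne_zero (NeZero.ne n)
  have hs : ∀ (w : Fin n → ℝ) i, ∑ j, w j * (Pi.single i (Real.sqrt n) : Fin n → ℝ) j
      = w i * Real.sqrt n := fun w i => by simp [Pi.single_apply]
  have hsq : Real.sqrt n ^ 2 = n := Real.sq_sqrt hn.le
  refine ⟨Measure.isProbabilityMeasure_map Measurable.of_discrete.aemeasurable, fun w _ => ?_,
    fun w hw => ?_, fun w _ => ?_, fun w _ => ?_⟩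
  · rw [spike, memLp_map_measure_iff (Measurable.aestronglyMeasurable (by fun_prop))
      Measurable.of_discrete.aemeasurable]
    exact MemLp.of_discrete
  · rw [integral_spike n (Measurable.stronglyMeasurable (by fun_prop))]
    simp_rw [hs]
    rw [← Finset.sum_mul, hw]; simp
  · rw [integral_spike n (Measurable.stronglyMeasurable (by fun_prop))]
    simp_rw [hs, mul_pow, hsq]
    rw [← Finset.sum_mul]; field_simp
  · rw [integral_spike n (Measurable.stronglyMeasurable (by fun_prop))]
    have h4 : Real.sqrt n ^ 4 = (n : ℝ) ^ 2 := by
      rw [show (4 : ℕ) = 2 * 2 from rfl, pow_mul, hsq]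
    simp_rw [hs, mul_pow, h4]
    rw [← Finset.sum_mul]
    have : (n : ℝ)⁻¹ * ((∑ i, w i ^ 4) * (n : ℝ) ^ 2) = n * ∑ i, w i ^ 4 := by field_simp
    rw [this]
    have : 0 ≤ (n : ℝ) * ∑ i, w i ^ 4 := by positivity
    linarith

lemma integral_pi_spike {F : (Fin n → Fin n → ℝ) → ℂ} (hF : Measurable F) :
    ∫ x, F x ∂(Measure.pi fun _ : Fin n => spike n)
      = (((n : ℝ) ^ n)⁻¹ : ℝ) • ∑ f : Fin n → Fin n, F fun k => Pi.single (f k) (Real.sqrt n) := by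
  have := (isonormal_spike n).prob
  have h := Measure.pi_map_pi (ι := Fin n) (X := fun _ => Fin n) (Y := fun _ => Fin n → ℝ)
    (μ := fun _ => (PMF.uniformOfFintype (Fin n)).toMeasure)
    (f := fun _ i => Pi.single i (Real.sqrt n))
    (hμ := fun _ => inferInstanceAs (SigmaFinite (spike n)))
    (fun _ => Measurable.of_discrete.aemeasurable)
  simp only [spike]
  rw [← h, integral_map (Measurable.of_discrete.aemeasurable) hF.aestronglyMeasurable,
    integral_fintype (Integrable.of_finite), Finset.smul_sum]
  refine Finset.sum_congr rfl fun f _ => ?_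
  congr 1
  rw [measureReal_def, Measure.pi_singleton]
  simp [PMF.toMeasure_apply_singleton _ _ (measurableSet_singleton _)]

end Spike

/-! ### From independent positions to a random permutation -/

section L2

variable {Ω : Type*} [Fintype Ω] {X Y : Ω → ℝ} {d y : ℝ}

lemma sum_abs_mul_le_of_sum_sq_le (hd : 0 ≤ d) (hy : 0 ≤ y)
    (hX : ∑ ω, X ω ^ 2 ≤ Fintype.card Ω * d) (hY : ∑ ω, Y ω ^ 2 ≤ Fintype.card Ω * y) :
    ∑ ω, |X ω| * |Y ω| ≤ Fintype.card Ω * Real.sqrt (d * y) := by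
  have h1 := Finset.sum_mul_sq_le_sq_mul_sq Finset.univ (fun ω => |X ω|) fun ω => |Y ω|
  simp only [sq_abs] at h1
  refine abs_le_of_sq_le_sq' ?_ (by positivity) |>.2
  rw [mul_pow, Real.sq_sqrt (mul_nonneg hd hy)]
  refine h1.trans ((mul_le_mul hX hY (by positivity) (by positivity)).trans_eq ?_)
  ring

lemma norm_sum_exp_sub_le (hd : 0 ≤ d) (h : ∑ ω, (X ω - Y ω) ^ 2 ≤ Fintype.card Ω * d) :
    ‖∑ ω, Complex.exp (Complex.I * (X ω : ℂ)) - ∑ ω, Complex.exp (Complex.I * (Y ω : ℂ))‖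
      ≤ Fintype.card Ω * Real.sqrt d := by
  rw [← Finset.sum_sub_distrib]
  have h1 := sum_abs_mul_le_of_sum_sq_le (X := fun ω => X ω - Y ω) (Y := fun _ => 1) hd
    zero_le_one h (by simp)
  simp only [abs_one, mul_one] at h1
  refine (norm_sum_le _ _).trans ((Finset.sum_le_sum fun ω _ => ?_).trans h1)
  have e : Complex.exp (Complex.I * (X ω : ℂ)) - Complex.exp (Complex.I * (Y ω : ℂ))
      = Complex.exp (Complex.I * (Y ω : ℂ))
        * (Complex.exp (Complex.I * ((X ω - Y ω : ℝ) : ℂ)) - 1) := by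
    rw [mul_sub, ← Complex.exp_add, mul_one]
    congr 2; push_cast; ring
  rw [e, norm_mul, Complex.norm_exp_I_mul_ofReal, one_mul]
  exact Real.norm_exp_I_mul_ofReal_sub_one_le

lemma abs_sum_sq_sub_le (hd : 0 ≤ d) (hy : 0 ≤ y)
    (h : ∑ ω, (X ω - Y ω) ^ 2 ≤ Fintype.card Ω * d) (hY : ∑ ω, Y ω ^ 2 ≤ Fintype.card Ω * y) :
    |∑ ω, X ω ^ 2 - ∑ ω, Y ω ^ 2| ≤ Fintype.card Ω * (d + 2 * Real.sqrt (d * y)) := by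
  have h1 := sum_abs_mul_le_of_sum_sq_le (X := fun ω => X ω - Y ω) hd hy h hY
  rw [← Finset.sum_sub_distrib]
  refine (Finset.abs_sum_le_sum_abs _ _).trans ?_
  have h2 : ∀ ω, |X ω ^ 2 - Y ω ^ 2| ≤ (X ω - Y ω) ^ 2 + 2 * (|X ω - Y ω| * |Y ω|) := fun ω => by
    have : X ω ^ 2 - Y ω ^ 2 = (X ω - Y ω) ^ 2 + 2 * ((X ω - Y ω) * Y ω) := by ring
    rw [this]
    refine (abs_add_le _ _).trans_eq ?_
    rw [abs_of_nonneg (sq_nonneg _), abs_mul, abs_mul, abs_two]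
  refine (Finset.sum_le_sum fun ω _ => h2 ω).trans ?_
  rw [Finset.sum_add_distrib, ← Finset.mul_sum]
  linarith

end L2

section Perm

variable {n : ℕ}

lemma card_coupling :
    (Fintype.card ((Fin n → Fin n) × Equiv.Perm (Fin n)) : ℝ) = (n : ℝ) ^ n * n.factorial := by
  simp [Fintype.card_perm]

lemma sum_snd_comp {R : Type*} [CommSemiring R] (g : Equiv.Perm (Fin n) → R) :
    ∑ ω : (Fin n → Fin n) × Equiv.Perm (Fin n), g ω.2 = (n : R) ^ n * ∑ π, g π := by
  rw [Fintype.sum_prod_type]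
  simp

/-- A bound on the second moment of a statistic of a random permutation through a coupled statistic
of independent positions. -/
lemma abs_pexp_sq_sub_le (hn : 0 < n) {T : (Fin n → Fin n) → ℝ} {d y : ℝ} (hd : 0 ≤ d)
    (h : ∑ ω : (Fin n → Fin n) × Equiv.Perm (Fin n), (T ω.2 - T (srt ω.1 ∘ ω.2)) ^ 2
      ≤ (n : ℝ) ^ n * n.factorial * d)
    (hy : 0 ≤ y) (hT : ∑ f, T f ^ 2 = (n : ℝ) ^ n * y) :
    |pexp n (fun π => T π ^ 2) - y| ≤ d + 2 * Real.sqrt (d * y) := by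
  have hN : (0 : ℝ) < (n : ℝ) ^ n * n.factorial := by
    have := n.factorial_pos
    positivity
  have hsrt := sum_srt_comp fun f => T f ^ 2
  have key := abs_sum_sq_sub_le hd hy (by rw [card_coupling]; exact h)
    (by rw [card_coupling, hsrt, hT]; exact le_of_eq (by ring))
  rw [card_coupling, hsrt, hT, sum_snd_comp fun π : Equiv.Perm (Fin n) => T π ^ 2] at key
  rw [pexp]
  have e : (n : ℝ) ^ n * ∑ π : Equiv.Perm (Fin n), T π ^ 2
        - n.factorial * ((n : ℝ) ^ n * y)
      = ((n : ℝ) ^ n * n.factorial)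
        * ((∑ π : Equiv.Perm (Fin n), T π ^ 2) / n.factorial - y) := by
    have := n.factorial_pos
    field_simp
  rw [e, abs_mul, abs_of_pos hN] at key
  exact le_of_mul_le_mul_left key hN

lemma norm_avg_perm_sub_avg_fun_le (hn : 0 < n) {T : (Fin n → Fin n) → ℝ} {d : ℝ} (hd : 0 ≤ d)
    (h : ∑ ω : (Fin n → Fin n) × Equiv.Perm (Fin n), (T ω.2 - T (srt ω.1 ∘ ω.2)) ^ 2
      ≤ (n : ℝ) ^ n * n.factorial * d) :
    ‖((n.factorial : ℝ)⁻¹ : ℝ) • ∑ π : Equiv.Perm (Fin n), Complex.exp (Complex.I * (T π : ℂ))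
      - (((n : ℝ) ^ n)⁻¹ : ℝ) • ∑ f, Complex.exp (Complex.I * (T f : ℂ))‖ ≤ Real.sqrt d := by
  have hf : (0 : ℝ) < n.factorial := by exact_mod_cast n.factorial_pos
  have hN : (0 : ℝ) < (n : ℝ) ^ n * n.factorial := by positivity
  have key := norm_sum_exp_sub_le hd (by rw [card_coupling]; exact h)
  rw [card_coupling, sum_srt_comp fun f => Complex.exp (Complex.I * (T f : ℂ)),
    sum_snd_comp fun π : Equiv.Perm (Fin n) => Complex.exp (Complex.I * (T π : ℂ))] at key
  set P := ∑ π : Equiv.Perm (Fin n), Complex.exp (Complex.I * (T π : ℂ))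
  set F := ∑ f, Complex.exp (Complex.I * (T f : ℂ))
  have e : (n : ℂ) ^ n * P - n.factorial * F = ((n : ℝ) ^ n * n.factorial : ℝ)
      • (((n.factorial : ℝ)⁻¹ : ℝ) • P - (((n : ℝ) ^ n)⁻¹ : ℝ) • F) := by
    have e2 : (n : ℝ) ^ n * n.factorial * ((n : ℝ) ^ n)⁻¹ = n.factorial := by field_simp
    rw [smul_sub, smul_smul, smul_smul, mul_inv_cancel_right₀ hf.ne', e2]
    simp [Complex.real_smul]
  rw [e, norm_smul, Real.norm_eq_abs, abs_of_pos hN] at key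
  exact le_of_mul_le_mul_left key hN

end Perm

/-! ### A quantitative central limit theorem for permutation statistics -/

section Scan

variable {κ : Type*} [Fintype κ] {n : ℕ}

/-- A linear combination of quadratic and linear statistics at several cut points. -/
noncomputable def scan (H : Fin n → Fin n → ℝ) (b : Fin n → ℝ) (t : κ → ℕ) (α γ : κ → ℝ)
    (f : Fin n → Fin n) : ℝ :=
  ∑ s, (α s * qstat H (cind n (t s)) f + γ s * lstat b (cind n (t s)) f)

/-- The normalised inner products of the centred indicators. -/
noncomputable def cindCov (n : ℕ) (t : κ → ℕ) (r s : κ) : ℝ :=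
  (∑ i : Fin n, cind n (t r) i * cind n (t s) i) / n

/-- The limiting variance of `scan`. -/
noncomputable def scanVar (H : Fin n → Fin n → ℝ) (b : Fin n → ℝ) (t : κ → ℕ) (α γ : κ → ℝ) : ℝ :=
  2 * ((∑ k, ∑ l, H k l ^ 2) * ∑ r, ∑ s, α r * α s * cindCov n t r s ^ 2)
    + (∑ k, b k ^ 2) * ∑ r, ∑ s, γ r * γ s * cindCov n t r s

/-- The kernel on positions of the quadratic part of `scan`. -/
noncomputable def scanKernel (n : ℕ) (t : κ → ℕ) (α : κ → ℝ) (i j : Fin n) : ℝ :=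
  (∑ s, α s * (cind n (t s) i * cind n (t s) j)) / n

/-- The weights on positions of the linear part of `scan`. -/
noncomputable def scanWeight (n : ℕ) (t : κ → ℕ) (γ : κ → ℝ) (i : Fin n) : ℝ :=
  (∑ s, γ s * cind n (t s) i) / Real.sqrt n

lemma qform_single (H A : Fin n → Fin n → ℝ) (b c : Fin n → ℝ) (f : Fin n → Fin n) (z : ℝ) :
    qform H A b c (fun k => Pi.single (f k) z)
      = ∑ k, ∑ l, H k l * (A (f k) (f l) * (z * z)) + ∑ k, b k * (c (f k) * z) := by
  simp [qform, Pi.single_apply]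

lemma qform_scanKernel (H : Fin n → Fin n → ℝ) (b : Fin n → ℝ) (t : κ → ℕ) (α γ : κ → ℝ)
    (f : Fin n → Fin n) :
    qform H (scanKernel n t α) b (scanWeight n t γ) (fun k => Pi.single (f k) (Real.sqrt n))
      = scan H b t α γ f := by
  rcases Nat.eq_zero_or_pos n with rfl | hn
  · simp [qform, scan, qstat, lstat]
  have hn' : (0 : ℝ) < n := by positivity
  have hs : Real.sqrt n ≠ 0 := (Real.sqrt_pos.2 hn').ne'
  rw [qform_single, Real.mul_self_sqrt hn'.le, scan, Finset.sum_add_distrib]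
  congr 1
  · simp only [scanKernel, div_mul_cancel₀ _ hn'.ne', qstat, Finset.mul_sum]
    conv_rhs => rw [Finset.sum_comm]
    refine Finset.sum_congr rfl fun k _ => ?_
    rw [Finset.sum_comm]
    exact Finset.sum_congr rfl fun _ _ => Finset.sum_congr rfl fun _ _ => by ring
  · simp only [scanWeight, div_mul_cancel₀ _ hs, lstat, Finset.mul_sum]
    rw [Finset.sum_comm]
    exact Finset.sum_congr rfl fun _ _ => Finset.sum_congr rfl fun _ _ => by ring

lemma sum_scanKernel_sq (t : κ → ℕ) (α : κ → ℝ) :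
    ∑ i, ∑ j, scanKernel n t α i j ^ 2 = ∑ r, ∑ s, α r * α s * cindCov n t r s ^ 2 := by
  have h : ∀ i j : Fin n, scanKernel n t α i j ^ 2
      = ∑ r, ∑ s, α r * α s * ((cind n (t r) i * cind n (t s) i)
        * (cind n (t r) j * cind n (t s) j)) / n ^ 2 := fun i j => by
    rw [scanKernel, div_pow, sq (∑ s, _), Finset.sum_mul_sum, Finset.sum_div]
    refine Finset.sum_congr rfl fun r _ => ?_
    rw [Finset.sum_div]
    exact Finset.sum_congr rfl fun s _ => by ring
  simp_rw [h]
  have e : ∀ r s, α r * α s * cindCov n t r s ^ 2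
      = ∑ i, ∑ j, α r * α s * ((cind n (t r) i * cind n (t s) i)
        * (cind n (t r) j * cind n (t s) j)) / n ^ 2 := fun r s => by
    rw [cindCov, div_pow, sq (∑ i, _), Finset.sum_mul_sum, mul_div_assoc', Finset.mul_sum,
      Finset.sum_div]
    refine Finset.sum_congr rfl fun r _ => ?_
    rw [Finset.mul_sum, Finset.sum_div]
  simp_rw [e]
  calc _ = ∑ i : Fin n, ∑ r, ∑ j : Fin n, ∑ s, α r * α s * ((cind n (t r) i * cind n (t s) i)
        * (cind n (t r) j * cind n (t s) j)) / n ^ 2 :=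
        Finset.sum_congr rfl fun _ _ => Finset.sum_comm
    _ = ∑ r, ∑ i : Fin n, ∑ s, ∑ j : Fin n, α r * α s * ((cind n (t r) i * cind n (t s) i)
        * (cind n (t r) j * cind n (t s) j)) / n ^ 2 := by
        rw [Finset.sum_comm]
        exact Finset.sum_congr rfl fun _ _ => Finset.sum_congr rfl fun _ _ => Finset.sum_comm
    _ = _ := Finset.sum_congr rfl fun _ _ => Finset.sum_comm

lemma sum_scanWeight_sq (t : κ → ℕ) (γ : κ → ℝ) :
    ∑ i, scanWeight n t γ i ^ 2 = ∑ r, ∑ s, γ r * γ s * cindCov n t r s := by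
  have h : ∀ i : Fin n, scanWeight n t γ i ^ 2
      = ∑ r, ∑ s, γ r * γ s * (cind n (t r) i * cind n (t s) i) / n := fun i => by
    rw [scanWeight, div_pow, Real.sq_sqrt (Nat.cast_nonneg n), sq, Finset.sum_mul_sum,
      Finset.sum_div]
    refine Finset.sum_congr rfl fun r _ => ?_
    rw [Finset.sum_div]
    exact Finset.sum_congr rfl fun s _ => by ring
  simp_rw [h]
  rw [Finset.sum_comm]
  refine Finset.sum_congr rfl fun r _ => ?_
  rw [Finset.sum_comm]
  refine Finset.sum_congr rfl fun s _ => ?_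
  rw [cindCov, mul_div_assoc', Finset.mul_sum, Finset.sum_div]

lemma scanVar_nonneg (H : Fin n → Fin n → ℝ) (b : Fin n → ℝ) (t : κ → ℕ) (α γ : κ → ℝ) :
    0 ≤ scanVar H b t α γ := by
  rw [scanVar, ← sum_scanKernel_sq, ← sum_scanWeight_sq]
  positivity

lemma abs_sum_mul_le_of_abs_le_one {α x : κ → ℝ} {S : ℝ} (hα : ∑ s, |α s| ≤ S)
    (hx : ∀ s, |x s| ≤ 1) : |∑ s, α s * x s| ≤ S := by
  refine (Finset.abs_sum_le_sum_abs _ _).trans ((Finset.sum_le_sum fun s _ => ?_).trans hα)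
  rw [abs_mul]
  exact mul_le_of_le_one_right (abs_nonneg _) (hx s)

variable {t : κ → ℕ} {α γ : κ → ℝ} {S : ℝ}

lemma abs_scanKernel_le (ht : ∀ s, t s ≤ n) (hα : ∑ s, |α s| ≤ S) (i j : Fin n) :
    |scanKernel n t α i j| ≤ S / n := by
  rw [scanKernel, abs_div, Nat.abs_cast]
  gcongr
  refine abs_sum_mul_le_of_abs_le_one hα fun s => ?_
  rw [abs_mul]
  exact mul_le_one₀ (abs_cind_le (ht s) i) (abs_nonneg _) (abs_cind_le (ht s) j)

lemma scanWeight_sq_le (ht : ∀ s, t s ≤ n) (hγ : ∑ s, |γ s| ≤ S) (i : Fin n) :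
    scanWeight n t γ i ^ 2 ≤ S ^ 2 / n := by
  rw [scanWeight, div_pow, Real.sq_sqrt (Nat.cast_nonneg n)]
  exact div_le_div_of_nonneg_right (sq_le_sq.2 ((abs_sum_mul_le_of_abs_le_one hγ
    fun s => abs_cind_le (ht s) i).trans (le_abs_self S))) n.cast_nonneg

lemma sum_scanKernel_sq_le (ht : ∀ s, t s ≤ n) (hα : ∑ s, |α s| ≤ S) :
    ∑ i, ∑ j, scanKernel n t α i j ^ 2 ≤ S ^ 2 := by
  have hS : 0 ≤ S := (Finset.sum_nonneg fun _ _ => abs_nonneg _).trans hα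
  rcases Nat.eq_zero_or_pos n with rfl | hn
  · simpa using sq_nonneg S
  calc _ ≤ ∑ i : Fin n, ∑ j : Fin n, (S / n) ^ 2 := by
        refine Finset.sum_le_sum fun i _ => Finset.sum_le_sum fun j _ => ?_
        exact sq_le_sq.2 ((abs_scanKernel_le ht hα i j).trans (le_abs_self _))
    _ = S ^ 2 := by
        simp
        field_simp

lemma sum_scanWeight_sq_le (ht : ∀ s, t s ≤ n) (hγ : ∑ s, |γ s| ≤ S) :
    ∑ i, scanWeight n t γ i ^ 2 ≤ S ^ 2 := by
  rcases Nat.eq_zero_or_pos n with rfl | hn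
  · simpa using sq_nonneg S
  calc _ ≤ ∑ i : Fin n, S ^ 2 / n := by
        gcongr with i _
        exact scanWeight_sq_le ht hγ i
    _ = S ^ 2 := by
        simp
        field_simp

lemma sum_scanKernel (ht : ∀ s, t s ≤ n) (i : Fin n) : ∑ j, scanKernel n t α i j = 0 := by
  simp only [scanKernel, ← Finset.sum_div]
  rw [Finset.sum_comm]
  simp [← Finset.mul_sum, sum_cind (ht _)]

lemma sum_scanWeight (ht : ∀ s, t s ≤ n) : ∑ i, scanWeight n t γ i = 0 := by
  simp only [scanWeight, ← Finset.sum_div]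
  rw [Finset.sum_comm]
  simp [← Finset.mul_sum, sum_cind (ht _)]

lemma sum_coupling_scan_le (hn : 4 ≤ n) (ht : ∀ s, t s ≤ n) (hα : ∑ s, |α s| ≤ S)
    (hγ : ∑ s, |γ s| ≤ S) {H : Fin n → Fin n → ℝ} {b : Fin n → ℝ}
    (hH : ∀ a b, H a b = H b a) (hd : ∀ a, H a a = 0) (hrow : ∀ a, ∑ b, H a b = 0)
    (hb : ∑ k, b k = 0) (hH1 : ∑ k, ∑ l, H k l ^ 2 ≤ 1) (hb1 : ∑ k, b k ^ 2 ≤ 1) :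
    ∑ ω : (Fin n → Fin n) × Equiv.Perm (Fin n),
      (scan H b t α γ ω.2 - scan H b t α γ (srt ω.1 ∘ ω.2)) ^ 2
      ≤ (n : ℝ) ^ n * n.factorial * (68 * (Fintype.card κ * S) ^ 2 / Real.sqrt n) := by
  have hn' : (0 : ℝ) < n := by exact_mod_cast (by omega : 0 < n)
  have hs : 0 < Real.sqrt n := Real.sqrt_pos.2 hn'
  have hS : 0 ≤ S := (Finset.sum_nonneg fun _ _ => abs_nonneg _).trans hα
  have hsq : ∀ {β : κ → ℝ}, ∑ s, |β s| ≤ S → ∀ s, β s ^ 2 ≤ S ^ 2 := fun {β} h s =>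
    sq_le_sq.2 (((Finset.single_le_sum (f := fun s => |β s|) (fun _ _ => abs_nonneg _)
      (Finset.mem_univ s)).trans h).trans (le_abs_self S))
  set q : κ → (Fin n → Fin n) × Equiv.Perm (Fin n) → ℝ := fun s ω =>
    qstat H (cind n (t s)) ω.2 - qstat H (cind n (t s)) (srt ω.1 ∘ ω.2) with hq
  set l : κ → (Fin n → Fin n) × Equiv.Perm (Fin n) → ℝ := fun s ω =>
    lstat b (cind n (t s)) ω.2 - lstat b (cind n (t s)) (srt ω.1 ∘ ω.2) with hl
  have hpt : ∀ ω : (Fin n → Fin n) × Equiv.Perm (Fin n),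
      (scan H b t α γ ω.2 - scan H b t α γ (srt ω.1 ∘ ω.2)) ^ 2
        ≤ Fintype.card κ * ∑ s, (2 * S ^ 2 * q s ω ^ 2 + 2 * S ^ 2 * l s ω ^ 2) := fun ω => by
    have e : scan H b t α γ ω.2 - scan H b t α γ (srt ω.1 ∘ ω.2)
        = ∑ s, (α s * q s ω + γ s * l s ω) := by
      rw [scan, scan, ← Finset.sum_sub_distrib]
      exact Finset.sum_congr rfl fun s _ => by simp only [hq, hl]; ring
    rw [e]
    refine sq_sum_le_card_mul_sum_sq.trans ?_
    rw [Finset.card_univ]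
    gcongr with s _
    have h1 := mul_le_mul_of_nonneg_right (hsq hα s) (sq_nonneg (q s ω))
    have h2 := mul_le_mul_of_nonneg_right (hsq hγ s) (sq_nonneg (l s ω))
    nlinarith [sq_nonneg (α s * q s ω - γ s * l s ω)]
  refine (Finset.sum_le_sum fun ω _ => hpt ω).trans ?_
  rw [← Finset.mul_sum, Finset.sum_comm]
  have hterm : ∀ s, ∑ ω, (2 * S ^ 2 * q s ω ^ 2 + 2 * S ^ 2 * l s ω ^ 2)
      ≤ (n : ℝ) ^ n * n.factorial * (68 * S ^ 2 / Real.sqrt n) := fun s => by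
    rw [Finset.sum_add_distrib, ← Finset.mul_sum, ← Finset.mul_sum]
    have h1 := sum_coupling_qstat_le hn (ht s) H hH hd hrow
    have h2 := sum_coupling_lstat_le (by omega) (ht s) b hb
    have h1' : ∑ ω, q s ω ^ 2 ≤ (n : ℝ) ^ n * n.factorial * (32 / Real.sqrt n) :=
      h1.trans (by gcongr; exact mul_le_of_le_one_right (by positivity) hH1)
    have h2' : ∑ ω, l s ω ^ 2 ≤ (n : ℝ) ^ n * n.factorial * (2 / Real.sqrt n) :=
      h2.trans (by gcongr; exact mul_le_of_le_one_right (by positivity) hb1)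
    calc _ ≤ 2 * S ^ 2 * ((n : ℝ) ^ n * n.factorial * (32 / Real.sqrt n))
          + 2 * S ^ 2 * ((n : ℝ) ^ n * n.factorial * (2 / Real.sqrt n)) := by gcongr
      _ = _ := by ring
  calc _ ≤ (Fintype.card κ : ℝ)
        * ∑ s : κ, (n : ℝ) ^ n * n.factorial * (68 * S ^ 2 / Real.sqrt n) := by
        gcongr with s _
        exact hterm s
    _ = _ := by
        rw [Finset.sum_const, Finset.card_univ, nsmul_eq_mul]
        ring

lemma exists_norm_avg_exp_scan_sub_le (κ : Type*) [Fintype κ] :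
    ∃ C : ℝ, 0 ≤ C ∧ ∀ (n : ℕ) (H : Fin n → Fin n → ℝ) (b : Fin n → ℝ) (t : κ → ℕ)
      (α γ : κ → ℝ) (S η ε : ℝ), 4 ≤ n → (∀ s, t s ≤ n) → ∑ s, |α s| ≤ S → ∑ s, |γ s| ≤ S →
      (∀ a b, H a b = H b a) → (∀ a, H a a = 0) → (∀ a, ∑ b, H a b = 0) → ∑ k, b k = 0 →
      ∑ k, ∑ l, H k l ^ 2 ≤ 1 → ∑ k, b k ^ 2 ≤ 1 → 0 ≤ η → η * S ≤ 1 → 0 < ε →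
      (∀ v : Fin n → ℝ, ∑ k, (∑ l, H k l * v l) ^ 2 ≤ η ^ 2 * ∑ k, v k ^ 2) →
      ‖((n.factorial : ℝ)⁻¹ : ℝ)
            • ∑ π : Equiv.Perm (Fin n), Complex.exp (Complex.I * (scan H b t α γ π : ℂ))
          - Complex.exp (-(scanVar H b t α γ : ℂ) / 2)‖
        ≤ Real.sqrt (68 * (Fintype.card κ * S) ^ 2 / Real.sqrt n)
          + (10 * ε * S ^ 2
            + 3 * S ^ 4 * (384 * ∑ k, (∑ l, H k l ^ 2) ^ 2 + 8 * ∑ k, b k ^ 4) / ε)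
          + C * (η * S * (2 * S ^ 2)) := by
  obtain ⟨C, hC, key⟩ := exists_norm_integral_exp_qform_gaussian_sub_le
  refine ⟨C, hC, fun n H b t α γ S η ε hn ht hα hγ hH hd hrow hb hH1 hb1 hη hηS hε hop => ?_⟩
  have hS : 0 ≤ S := (Finset.sum_nonneg fun _ _ => abs_nonneg _).trans hα
  have : NeZero n := ⟨by omega⟩
  set A := scanKernel n t α with hA
  set c := scanWeight n t γ with hc
  have hAsym : ∀ i j, A i j = A j i := fun i j => by
    simp only [hA, scanKernel, mul_comm]
  have h1 := norm_avg_perm_sub_avg_fun_le (by omega) (by positivity)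
    (sum_coupling_scan_le hn ht hα hγ hH hd hrow hb hH1 hb1)
  have h2 := norm_integral_exp_qform_sub_le hH hd hAsym (sum_scanKernel ht) (b := b) (c := c)
    (sum_scanWeight ht) (abs_scanKernel_le ht hα) (scanWeight_sq_le ht hγ) hε
    (isonormal_spike n) (isonormal_gaussian n)
  have h3 := key n H A b c η S hH hd hAsym hη hS hηS (sum_scanKernel_sq_le ht hα) hop
  have hm : Measurable fun x => Complex.exp (Complex.I * (qform H A b c x : ℂ)) := by
    have := measurable_qform H A b c
    fun_prop
  rw [integral_pi_spike n hm] at h2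
  simp only [hA, hc, qform_scanKernel] at h2
  have hV : 2 * ((∑ k, ∑ l, H k l ^ 2) * ∑ i, ∑ j, A i j ^ 2) + (∑ k, b k ^ 2) * ∑ i, c i ^ 2
      = scanVar H b t α γ := by
    rw [hA, hc, sum_scanKernel_sq, sum_scanWeight_sq, scanVar]
  rw [hV] at h3
  have hA2 : 0 ≤ ∑ i, ∑ j, A i j ^ 2 := by positivity
  have hc2 : 0 ≤ ∑ i, c i ^ 2 := by positivity
  refine (norm_sub_le_norm_sub_add_norm_sub _ _ _).trans (add_le_add
    ((norm_sub_le_norm_sub_add_norm_sub _ _ _).trans (add_le_add h1 (h2.trans ?_))) (h3.trans ?_))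
  · refine add_le_add ?_ (le_of_eq (by ring))
    have : S ^ 2 * (8 * ∑ k, ∑ l, H k l ^ 2 + 2 * ∑ k, b k ^ 2) ≤ S ^ 2 * 10 := by
      gcongr; linarith
    nlinarith
  · gcongr
    nlinarith [mul_le_of_le_one_left hA2 hH1, mul_le_of_le_one_left hc2 hb1,
      sum_scanKernel_sq_le ht hα, sum_scanWeight_sq_le ht hγ]

/-- The central limit theorem for `scan` along a sequence of kernels and weights. -/
lemma tendsto_avg_exp_scan (κ : Type*) [Fintype κ] {H : (n : ℕ) → Fin n → Fin n → ℝ}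
    {b : (n : ℕ) → Fin n → ℝ} {t : ℕ → κ → ℕ} {α γ : ℕ → κ → ℝ} {S V : ℝ} {η : ℕ → ℝ}
    (ht : ∀ n s, t n s ≤ n)
    (hα : ∀ᶠ n in atTop, ∑ s, |α n s| ≤ S) (hγ : ∀ᶠ n in atTop, ∑ s, |γ n s| ≤ S)
    (hH : ∀ n k l, H n k l = H n l k) (hd : ∀ n k, H n k k = 0)
    (hrow : ∀ᶠ n in atTop, ∀ k, ∑ l, H n k l = 0) (hb : ∀ᶠ n in atTop, ∑ k, b n k = 0)
    (hH1 : ∀ᶠ n in atTop, ∑ k, ∑ l, H n k l ^ 2 ≤ 1) (hb1 : ∀ᶠ n in atTop, ∑ k, b n k ^ 2 ≤ 1)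
    (hH4 : Tendsto (fun n => ∑ k, (∑ l, H n k l ^ 2) ^ 2) atTop (𝓝 0))
    (hb4 : Tendsto (fun n => ∑ k, b n k ^ 4) atTop (𝓝 0))
    (hη0 : ∀ n, 0 ≤ η n) (hη : Tendsto η atTop (𝓝 0))
    (hop : ∀ᶠ n in atTop, ∀ v : Fin n → ℝ,
      ∑ k, (∑ l, H n k l * v l) ^ 2 ≤ η n ^ 2 * ∑ k, v k ^ 2)
    (hV : Tendsto (fun n => scanVar (H n) (b n) (t n) (α n) (γ n)) atTop (𝓝 V)) :
    Tendsto (fun n => ((n.factorial : ℝ)⁻¹ : ℝ) • ∑ π : Equiv.Perm (Fin n),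
      Complex.exp (Complex.I * (scan (H n) (b n) (t n) (α n) (γ n) π : ℂ))) atTop
      (𝓝 (Complex.exp (-(V : ℂ) / 2))) := by
  obtain ⟨C, hC, key⟩ := exists_norm_avg_exp_scan_sub_le κ
  have hV' : Tendsto (fun n => Complex.exp (-(scanVar (H n) (b n) (t n) (α n) (γ n) : ℂ) / 2))
      atTop (𝓝 (Complex.exp (-(V : ℂ) / 2))) := by
    have h : Continuous fun x : ℝ => Complex.exp (-(x : ℂ) / 2) := by fun_prop
    exact (h.tendsto V).comp hV
  set W : ℕ → ℝ := fun n => 384 * ∑ k, (∑ l, H n k l ^ 2) ^ 2 + 8 * ∑ k, b n k ^ 4 with hW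
  have hW0 : Tendsto W atTop (𝓝 0) := by
    simpa using (hH4.const_mul 384).add (hb4.const_mul 8)
  have hWn : ∀ n, 0 ≤ W n := fun n => by positivity
  set ε : ℕ → ℝ := fun n => Real.sqrt (W n) + (n : ℝ)⁻¹ with hε
  have hε0 : Tendsto ε atTop (𝓝 0) := by
    simpa using ((Real.continuous_sqrt.tendsto 0).comp hW0).add tendsto_inv_atTop_nhds_zero_nat
  have hsq : Tendsto (fun n : ℕ =>
      Real.sqrt (68 * (Fintype.card κ * S) ^ 2 / Real.sqrt n)) atTop (𝓝 0) := by
    have h1 : Tendsto (fun n : ℕ => Real.sqrt n) atTop atTop :=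
      Real.tendsto_sqrt_atTop.comp tendsto_natCast_atTop_atTop
    have h2 := (Real.continuous_sqrt.tendsto 0).comp
      (h1.const_div_atTop (68 * (Fintype.card κ * S) ^ 2))
    rwa [Real.sqrt_zero] at h2
  have hbound : Tendsto (fun n : ℕ => Real.sqrt (68 * (Fintype.card κ * S) ^ 2 / Real.sqrt n)
      + (10 * ε n * S ^ 2 + 3 * S ^ 4 * Real.sqrt (W n)) + C * (η n * S * (2 * S ^ 2)))
      atTop (𝓝 0) := by
    have h1 := ((hε0.const_mul 10).mul_const (S ^ 2)).add
      (((Real.continuous_sqrt.tendsto 0).comp hW0).const_mul (3 * S ^ 4))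
    have h2 := ((hη.mul_const S).mul_const (2 * S ^ 2)).const_mul C
    simpa using (hsq.add h1).add h2
  have hηS : ∀ᶠ n in atTop, η n * S ≤ 1 := by
    have : Tendsto (fun n => η n * S) atTop (𝓝 0) := by simpa using hη.mul_const S
    exact this.eventually_le_const one_pos
  have hdiff : Tendsto (fun n => ((n.factorial : ℝ)⁻¹ : ℝ) • ∑ π : Equiv.Perm (Fin n),
      Complex.exp (Complex.I * (scan (H n) (b n) (t n) (α n) (γ n) π : ℂ))
      - Complex.exp (-(scanVar (H n) (b n) (t n) (α n) (γ n) : ℂ) / 2)) atTop (𝓝 0) := by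
    refine squeeze_zero_norm' ?_ hbound
    filter_upwards [hα, hγ, hrow, hb, hH1, hb1, hop, hηS, eventually_ge_atTop 4]
      with n h1 h2 h3 h4 h5 h6 h7 h8 h9
    have hn : (0 : ℝ) < (n : ℝ)⁻¹ := by
      have : (0 : ℝ) < n := by exact_mod_cast (by omega : 0 < n)
      positivity
    have hεn : 0 < ε n := add_pos_of_nonneg_of_pos (Real.sqrt_nonneg _) hn
    refine (key n (H n) (b n) (t n) (α n) (γ n) S (η n) (ε n) h9 (ht n) h1 h2 (hH n) (hd n) h3 h4
      h5 h6 (hη0 n) h8 hεn h7).trans ?_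
    gcongr
    rw [mul_div_assoc]
    gcongr
    rw [div_le_iff₀ hεn]
    change W n ≤ _
    calc W n = Real.sqrt (W n) * Real.sqrt (W n) := (Real.mul_self_sqrt (hWn n)).symm
      _ ≤ Real.sqrt (W n) * ε n := by
        gcongr
        exact le_add_of_nonneg_right hn.le
  simpa using hdiff.add hV'

end Scan

/-! ### Decomposition of the scan statistics -/

section Decomposition

variable {n : ℕ}

/-- The centred row mean. -/
noncomputable def rowDev (n : ℕ) (R : Fin n → Fin n → ℝ) (k : Fin n) : ℝ := Rbar n R k - r0 n R

/-- The part of `R` with zero diagonal and zero row sums. -/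
noncomputable def interaction (n : ℕ) (R : Fin n → Fin n → ℝ) (k l : Fin n) : ℝ :=
  if k = l then 0
  else R k l - r0 n R - ((n : ℝ) - 1) / (n - 2) * (rowDev n R k + rowDev n R l)

variable {R : Fin n → Fin n → ℝ}

lemma sum_rowDev : ∑ k, rowDev n R k = 0 := by
  rcases Nat.eq_zero_or_pos n with rfl | hn
  · simp
  have : (n : ℝ) ≠ 0 := by positivity
  simp only [rowDev, Finset.sum_sub_distrib, Finset.sum_const, Finset.card_univ, Fintype.card_fin,
    nsmul_eq_mul, r0]
  field_simp
  simp

lemma interaction_self (k : Fin n) : interaction n R k k = 0 := by simp [interaction]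

lemma interaction_comm (hR : ∀ i j, R i j = R j i) (k l : Fin n) :
    interaction n R k l = interaction n R l k := by
  simp only [interaction, hR k l, add_comm (rowDev n R k), eq_comm (a := k)]

lemma sum_eq_mul_rowDev (hn : 2 ≤ n) (k : Fin n) :
    ∑ l, R k l = ((n : ℝ) - 1) * (rowDev n R k + r0 n R) := by
  have : (2 : ℝ) ≤ n := by exact_mod_cast hn
  have h1 : (n : ℝ) - 1 ≠ 0 := by linarith
  simp only [rowDev, Rbar]
  field_simp
  ring

lemma sum_ite_eq_zero (k : Fin n) (x : Fin n → ℝ) :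
    ∑ l, (if k = l then 0 else x l) = ∑ l, x l - x k := by
  have : ∀ l, (if k = l then 0 else x l) = x l - (if k = l then x l else 0) := fun l => by
    split_ifs <;> simp
  simp_rw [this]
  simp [Finset.sum_sub_distrib]

lemma sum_interaction (hn : 3 ≤ n) (hd : ∀ i, R i i = 0) (k : Fin n) :
    ∑ l, interaction n R k l = 0 := by
  have h3 : (3 : ℝ) ≤ n := by exact_mod_cast hn
  have h2 : (n : ℝ) - 2 ≠ 0 := by linarith
  simp only [interaction]
  rw [sum_ite_eq_zero, Finset.sum_sub_distrib, Finset.sum_sub_distrib, ← Finset.mul_sum,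
    Finset.sum_add_distrib, sum_rowDev, sum_eq_mul_rowDev (by omega)]
  simp only [Finset.sum_const, Finset.card_univ, Fintype.card_fin, nsmul_eq_mul, hd]
  field_simp
  ring

lemma cind_sq (t : ℕ) (i : Fin n) :
    cind n t i ^ 2 = (1 - 2 * ((t : ℝ) / n)) * cind n t i + (t : ℝ) / n * (1 - (t : ℝ) / n) := by
  simp only [cind]
  split_ifs <;> ring

/-- `U1` as a function of the inverse permutation. -/
lemma U1_zero_eq (R : Fin n → Fin n → ℝ) (π : Equiv.Perm (Fin n)) (t : ℕ) :
    U1 n R π 0 t = ∑ k, ∑ l, R k l * ((cind n t (π⁻¹ k) + (t : ℝ) / n)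
      * (cind n t (π⁻¹ l) + (t : ℝ) / n)) := by
  rw [U1]
  conv_rhs => rw [← Equiv.sum_comp π]
  refine Finset.sum_congr rfl fun i _ => ?_
  conv_rhs => rw [← Equiv.sum_comp π]
  refine Finset.sum_congr rfl fun j _ => ?_
  by_cases h1 : (i : ℕ) < t <;> by_cases h2 : (j : ℕ) < t <;> simp [cind, h1, h2]

lemma U2_zero_eq (R : Fin n → Fin n → ℝ) (π : Equiv.Perm (Fin n)) (t : ℕ) :
    U2 n R π 0 t = ∑ k, ∑ l, R k l * ((1 - (cind n t (π⁻¹ k) + (t : ℝ) / n))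
      * (1 - (cind n t (π⁻¹ l) + (t : ℝ) / n))) := by
  rw [U2]
  conv_rhs => rw [← Equiv.sum_comp π]
  refine Finset.sum_congr rfl fun i _ => ?_
  conv_rhs => rw [← Equiv.sum_comp π]
  refine Finset.sum_congr rfl fun j _ => ?_
  by_cases h1 : (i : ℕ) < t <;> by_cases h2 : (j : ℕ) < t <;> simp [cind, h1, h2]

lemma sum_sum_mul_left (hn : 2 ≤ n) (x : Fin n → ℝ) :
    ∑ k, ∑ l, R k l * x k
      = ((n : ℝ) - 1) * (∑ k, rowDev n R k * x k + r0 n R * ∑ k, x k) := by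
  simp_rw [← Finset.sum_mul, sum_eq_mul_rowDev hn]
  rw [Finset.mul_sum, ← Finset.sum_add_distrib, Finset.mul_sum]
  exact Finset.sum_congr rfl fun k _ => by ring

lemma sum_sum_mul_right (hn : 2 ≤ n) (hR : ∀ i j, R i j = R j i) (x : Fin n → ℝ) :
    ∑ k, ∑ l, R k l * x l
      = ((n : ℝ) - 1) * (∑ k, rowDev n R k * x k + r0 n R * ∑ k, x k) := by
  rw [← sum_sum_mul_left hn, Finset.sum_comm]
  exact Finset.sum_congr rfl fun k _ => Finset.sum_congr rfl fun l _ => by rw [hR]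

lemma sum_cind_perm {t : ℕ} (ht : t ≤ n) (σ : Equiv.Perm (Fin n)) : ∑ k, cind n t (σ k) = 0 := by
  rw [Equiv.sum_comp σ (cind n t), sum_cind ht]

lemma Udiff_zero_eq (hn : 2 ≤ n) (hR : ∀ i j, R i j = R j i) {t : ℕ} (ht : t ≤ n)
    (π : Equiv.Perm (Fin n)) :
    Udiff n R π 0 t = 2 * ((n : ℝ) - 1) * lstat (rowDev n R) (cind n t) (π⁻¹ : Equiv.Perm (Fin n))
      + (2 * ((t : ℝ) / n) - 1) * ∑ k, ∑ l, R k l := by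
  rw [Udiff, U1_zero_eq, U2_zero_eq, ← Finset.sum_sub_distrib]
  have h := sum_sum_mul_left (R := R) hn fun k => cind n t (π⁻¹ k)
  have h' := sum_sum_mul_right hn hR fun k => cind n t (π⁻¹ k)
  rw [sum_cind_perm ht π⁻¹, mul_zero, add_zero] at h h'
  have e : ∀ k l, R k l * ((cind n t (π⁻¹ k) + (t : ℝ) / n) * (cind n t (π⁻¹ l) + (t : ℝ) / n))
      - R k l * ((1 - (cind n t (π⁻¹ k) + (t : ℝ) / n)) * (1 - (cind n t (π⁻¹ l) + (t : ℝ) / n)))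
      = R k l * cind n t (π⁻¹ k) + R k l * cind n t (π⁻¹ l)
        + (2 * ((t : ℝ) / n) - 1) * R k l := fun k l => by ring
  simp_rw [← Finset.sum_sub_distrib, e, Finset.sum_add_distrib, ← Finset.mul_sum]
  rw [h, h', lstat]
  ring

lemma sum_sum_mul_cind_eq (hd : ∀ i, R i i = 0) {t : ℕ}
    (ht : t ≤ n) (σ : Equiv.Perm (Fin n)) :
    ∑ k, ∑ l, R k l * (cind n t (σ k) * cind n t (σ l))
      = qstat (interaction n R) (cind n t) σ
        - 2 * (1 - 2 * ((t : ℝ) / n)) * (((n : ℝ) - 1) / (n - 2))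
          * lstat (rowDev n R) (cind n t) σ
        - r0 n R * ∑ i, cind n t i ^ 2 := by
  set a : ℝ := ((n : ℝ) - 1) / (n - 2) with ha
  set x : Fin n → ℝ := fun k => cind n t (σ k) with hx
  have hx0 : ∑ k, x k = 0 := sum_cind_perm ht σ
  have e : ∀ k l, R k l * (x k * x l) = interaction n R k l * (x k * x l)
      + (r0 n R + a * (rowDev n R k + rowDev n R l)) * (x k * x l)
      - (if k = l then (r0 n R + a * (rowDev n R k + rowDev n R l)) * (x k * x l) else 0) := by
    intro k l
    by_cases h : k = l
    · subst h; simp [interaction, hd]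
    · simp only [interaction, h, if_false]; ring
  have e2 : ∀ k l, (r0 n R + a * (rowDev n R k + rowDev n R l)) * (x k * x l)
      = (r0 n R * x k + a * rowDev n R k * x k) * x l + a * x k * (rowDev n R l * x l) :=
    fun k l => by ring
  have e3 : ∑ k, ∑ l, (r0 n R + a * (rowDev n R k + rowDev n R l)) * (x k * x l) = 0 := by
    simp_rw [e2, Finset.sum_add_distrib, ← Finset.mul_sum, hx0]
    rw [← Finset.sum_mul, ← Finset.sum_mul, ← Finset.mul_sum, hx0]
    ring
  have e4 : ∀ k, (r0 n R + a * (rowDev n R k + rowDev n R k)) * (x k * x k)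
      = r0 n R * x k ^ 2 + 2 * (1 - 2 * ((t : ℝ) / n)) * a * (rowDev n R k * x k)
        + 2 * a * ((t : ℝ) / n * (1 - (t : ℝ) / n)) * rowDev n R k := fun k => by
    have := cind_sq t (σ k)
    have h2 : x k * x k = (1 - 2 * ((t : ℝ) / n)) * x k + (t : ℝ) / n * (1 - (t : ℝ) / n) := by
      rw [← this, sq]
    rw [sq, mul_add, add_mul, h2]
    ring
  change ∑ k, ∑ l, R k l * (x k * x l) = _
  simp_rw [e, Finset.sum_sub_distrib, Finset.sum_add_distrib]
  rw [e3]
  simp only [Finset.sum_ite_eq, Finset.mem_univ, if_true, e4]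
  rw [Finset.sum_add_distrib, Finset.sum_add_distrib, ← Finset.mul_sum, ← Finset.mul_sum,
    ← Finset.mul_sum, sum_rowDev, ← Equiv.sum_comp σ fun i => cind n t i ^ 2]
  simp only [qstat, lstat, hx]
  ring

lemma Uw_zero_eq (hn : 3 ≤ n) (hR : ∀ i j, R i j = R j i) (hd : ∀ i, R i i = 0) {t : ℕ}
    (ht : t ≤ n) :
    ∃ c : ℝ, ∀ π : Equiv.Perm (Fin n), Uw n R π 0 t
      = qstat (interaction n R) (cind n t) (π⁻¹ : Equiv.Perm (Fin n)) + c := by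
  have h3 : (3 : ℝ) ≤ n := by exact_mod_cast hn
  have h2 : (n : ℝ) - 2 ≠ 0 := by linarith
  have h0 : (n : ℝ) ≠ 0 := by linarith
  set p : ℝ := (t : ℝ) / n with hp
  have hpt : (t : ℝ) = p * n := by rw [hp]; field_simp
  refine ⟨((((n : ℝ) - t - 1) * p ^ 2 + (t - 1) * (1 - p) ^ 2) / (n - 2)) * ∑ k, ∑ l, R k l
    - r0 n R * ∑ i, cind n t i ^ 2, fun π => ?_⟩
  have h := sum_sum_mul_left (R := R) (by omega) fun k => cind n t (π⁻¹ k)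
  have h' := sum_sum_mul_right (by omega) hR fun k => cind n t (π⁻¹ k)
  have hq := sum_sum_mul_cind_eq hd ht π⁻¹
  rw [sum_cind_perm ht π⁻¹, mul_zero, add_zero] at h h'
  have e1 : U1 n R π 0 t = ∑ k, ∑ l, R k l * (cind n t (π⁻¹ k) * cind n t (π⁻¹ l))
      + p * (∑ k, ∑ l, R k l * cind n t (π⁻¹ k) + ∑ k, ∑ l, R k l * cind n t (π⁻¹ l))
      + p ^ 2 * ∑ k, ∑ l, R k l := by
    rw [U1_zero_eq]
    simp_rw [← Finset.sum_add_distrib, Finset.mul_sum, ← Finset.sum_add_distrib]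
    exact Finset.sum_congr rfl fun k _ => Finset.sum_congr rfl fun l _ => by ring
  have e2 : U2 n R π 0 t = ∑ k, ∑ l, R k l * (cind n t (π⁻¹ k) * cind n t (π⁻¹ l))
      - (1 - p) * (∑ k, ∑ l, R k l * cind n t (π⁻¹ k) + ∑ k, ∑ l, R k l * cind n t (π⁻¹ l))
      + (1 - p) ^ 2 * ∑ k, ∑ l, R k l := by
    rw [U2_zero_eq]
    simp_rw [← Finset.sum_add_distrib, Finset.mul_sum, ← Finset.sum_sub_distrib,
      ← Finset.sum_add_distrib]
    exact Finset.sum_congr rfl fun k _ => Finset.sum_congr rfl fun l _ => by ring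
  rw [Uw, e1, e2, h, h', hq, lstat]
  push_cast
  rw [hpt]
  field_simp
  ring

/-! ### Centring -/

lemma pexp_comp_inv (f : Equiv.Perm (Fin n) → ℝ) : pexp n (fun π => f π⁻¹) = pexp n f := by
  rw [pexp, pexp]
  exact congrArg (· / _) (Equiv.sum_comp (Equiv.inv (Equiv.Perm (Fin n))) f)

lemma pexp_add_const (f : Equiv.Perm (Fin n) → ℝ) (c : ℝ) :
    pexp n (fun π => f π + c) = pexp n f + c := by
  have : (n.factorial : ℝ) ≠ 0 := by exact_mod_cast n.factorial_ne_zero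
  simp [pexp, Finset.sum_add_distrib, Fintype.card_perm, add_div, this]

lemma pexp_lstat (b : Fin n → ℝ) {φ : Fin n → ℝ} (hφ : ∑ i, φ i = 0) :
    pexp n (fun π => lstat b φ π) = 0 := by
  rcases Nat.eq_zero_or_pos n with rfl | hn
  · simp [pexp, lstat]
  simp only [pexp, lstat]
  rw [Finset.sum_comm]
  simp_rw [← Finset.mul_sum, sum_perm_apply hn φ, hφ]
  simp

lemma pexp_qstat {H : Fin n → Fin n → ℝ} (φ : Fin n → ℝ) (hd : ∀ k, H k k = 0)
    (hrow : ∀ k, ∑ l, H k l = 0) : pexp n (fun π => qstat H φ π) = 0 := by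
  set G : Fin n → Fin n → ℝ := fun k l => ∑ π : Equiv.Perm (Fin n), φ (π k) * φ (π l) with hG
  have hGτ : ∀ (τ : Equiv.Perm (Fin n)) k l, G (τ k) (τ l) = G k l := fun τ k l => by
    simp only [hG]
    rw [← Equiv.sum_comp (Equiv.mulRight τ) fun π : Equiv.Perm (Fin n) => φ (π k) * φ (π l)]
    rfl
  have hc : ∃ g : ℝ, ∀ k l, k ≠ l → G k l = g := by
    by_cases h : ∃ k₀ l₀ : Fin n, k₀ ≠ l₀
    · obtain ⟨k₀, l₀, h₀⟩ := h
      refine ⟨G k₀ l₀, fun k l hkl => ?_⟩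
      obtain ⟨τ, h1, h2⟩ : ∃ τ : Equiv.Perm (Fin n), τ k₀ = k ∧ τ l₀ = l := by
        refine ⟨Equiv.swap (Equiv.swap k₀ k l₀) l * Equiv.swap k₀ k, ?_, ?_⟩
        · rw [Equiv.Perm.mul_apply, Equiv.swap_apply_left, Equiv.swap_apply_of_ne_of_ne _ hkl]
          intro h
          apply h₀
          apply (Equiv.swap k₀ k).injective
          rw [← h, Equiv.swap_apply_left]
        · rw [Equiv.Perm.mul_apply, Equiv.swap_apply_left]
      rw [← h1, ← h2, hGτ]
    · push Not at h
      exact ⟨0, fun k l hkl => absurd (h k l) hkl⟩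
  obtain ⟨g, hg⟩ := hc
  have : ∑ π : Equiv.Perm (Fin n), qstat H φ π = 0 := by
    simp only [qstat]
    rw [Finset.sum_comm]
    refine Finset.sum_eq_zero fun k _ => ?_
    rw [Finset.sum_comm]
    calc _ = ∑ l, H k l * g := Finset.sum_congr rfl fun l _ => by
          rw [← Finset.mul_sum]
          by_cases h : k = l
          · subst h; simp [hd]
          · rw [← hg k l h]
      _ = 0 := by rw [← Finset.sum_mul, hrow, zero_mul]
  rw [pexp, this, zero_div]

lemma standardize_eq {f : Equiv.Perm (Fin n) → ℝ} {T : Equiv.Perm (Fin n) → ℝ} {c d : ℝ}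
    (hf : ∀ π, f π = d * T π⁻¹ + c) (hT : pexp n T = 0) :
    pvar n f = d ^ 2 * pexp n (fun π => T π ^ 2) ∧ ∀ π, f π - pexp n f = d * T π⁻¹ := by
  have h1 : pexp n f = c := by
    rw [show f = fun π => d * T π⁻¹ + c from funext hf, pexp_add_const,
      pexp_comp_inv fun π => d * T π]
    have : pexp n (fun π => d * T π) = d * pexp n T := by
      rw [pexp, pexp, ← Finset.mul_sum, mul_div_assoc]
    rw [this, hT]; simp
  have h2 : ∀ π, f π - pexp n f = d * T π⁻¹ := fun π => by rw [h1, hf]; ring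
  refine ⟨?_, h2⟩
  simp only [pvar, h2]
  rw [pexp_comp_inv fun π => (d * T π) ^ 2]
  simp only [pexp, mul_pow]
  rw [← Finset.mul_sum, mul_div_assoc]

end Decomposition

/-! ### Norm bounds for the interaction matrix -/

section Bounds

variable {n : ℕ} {R : Fin n → Fin n → ℝ}

lemma sum_rowDev_sq : ∑ k, rowDev n R k ^ 2 = n * (r1sq n R - r0 n R ^ 2) := by
  rcases Nat.eq_zero_or_pos n with rfl | hn
  · simp
  have h0 : (n : ℝ) ≠ 0 := by positivity
  have h1 : ∑ k, Rbar n R k = n * r0 n R := by rw [r0]; field_simp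
  have h2 : ∑ k, Rbar n R k ^ 2 = n * r1sq n R := by rw [r1sq]; field_simp
  have e : ∀ k, rowDev n R k ^ 2 = Rbar n R k ^ 2 - 2 * r0 n R * Rbar n R k + r0 n R ^ 2 :=
    fun k => by rw [rowDev]; ring
  simp_rw [e, Finset.sum_add_distrib, Finset.sum_sub_distrib, ← Finset.mul_sum, h1, h2]
  simp
  ring

lemma sum_sum_sq_eq (hn : 2 ≤ n) : ∑ k, ∑ l, R k l ^ 2 = n * ((n : ℝ) - 1) * rdsq n R := by
  have h2 : (2 : ℝ) ≤ n := by exact_mod_cast hn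
  have h0 : (n : ℝ) ≠ 0 := by linarith
  have h1 : (n : ℝ) - 1 ≠ 0 := by linarith
  rw [rdsq]
  field_simp

lemma r1sq_nonneg : 0 ≤ r1sq n R := by
  rw [r1sq]; positivity

lemma rdsq_nonneg : 0 ≤ rdsq n R := by
  rcases Nat.eq_zero_or_pos n with rfl | hn
  · simp [rdsq]
  have h1 : (1 : ℝ) ≤ n := by exact_mod_cast hn
  have : 0 ≤ (n : ℝ) - 1 := by linarith
  rw [rdsq]; positivity

lemma sum_sum_sub_interaction_sq_le (hn : 3 ≤ n) (hd : ∀ i, R i i = 0) :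
    ∑ k, ∑ l, (R k l - interaction n R k l) ^ 2 ≤ 24 * (n : ℝ) ^ 2 * r1sq n R := by
  have h3 : (3 : ℝ) ≤ n := by exact_mod_cast hn
  have h2 : 0 < (n : ℝ) - 2 := by linarith
  set a : ℝ := ((n : ℝ) - 1) / (n - 2) with ha
  have ha0 : 0 ≤ a := div_nonneg (by linarith) h2.le
  have ha2 : a ≤ 2 := by rw [ha, div_le_iff₀ h2]; linarith
  have ha4 : a ^ 2 ≤ 4 := by nlinarith
  have hpt : ∀ k l, (R k l - interaction n R k l) ^ 2
      ≤ 3 * r0 n R ^ 2 + 12 * rowDev n R k ^ 2 + 12 * rowDev n R l ^ 2 := fun k l => by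
    by_cases h : k = l
    · subst h
      rw [hd, interaction_self, sub_zero, zero_pow two_ne_zero]
      positivity
    · simp only [interaction, h, if_false, ← ha]
      have e : R k l - (R k l - r0 n R - a * (rowDev n R k + rowDev n R l))
          = r0 n R + a * rowDev n R k + a * rowDev n R l := by ring
      rw [e]
      have e2 := mul_le_mul_of_nonneg_right ha4 (sq_nonneg (rowDev n R k))
      have e3 := mul_le_mul_of_nonneg_right ha4 (sq_nonneg (rowDev n R l))
      nlinarith [sq_nonneg (r0 n R - a * rowDev n R k), sq_nonneg (r0 n R - a * rowDev n R l),
        sq_nonneg (a * rowDev n R k - a * rowDev n R l)]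
  refine (Finset.sum_le_sum fun k _ => Finset.sum_le_sum fun l _ => hpt k l).trans ?_
  simp only [Finset.sum_add_distrib, ← Finset.mul_sum, Finset.sum_const, Finset.card_univ,
    Fintype.card_fin, nsmul_eq_mul, sum_rowDev_sq]
  nlinarith [mul_nonneg (sq_nonneg (n : ℝ)) (sq_nonneg (r0 n R))]

lemma sq_le_two_mul_sq_add (x y : ℝ) : x ^ 2 ≤ 2 * y ^ 2 + 2 * (x - y) ^ 2 := by
  nlinarith [sq_nonneg (x - 2 * y)]

lemma sum_sum_sq_le_interaction (hn : 3 ≤ n) (hd : ∀ i, R i i = 0) :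
    n * ((n : ℝ) - 1) * rdsq n R
      ≤ 2 * ∑ k, ∑ l, interaction n R k l ^ 2 + 48 * (n : ℝ) ^ 2 * r1sq n R := by
  rw [← sum_sum_sq_eq (by omega)]
  have h := sum_sum_sub_interaction_sq_le hn hd
  have : ∑ k, ∑ l, R k l ^ 2 ≤ ∑ k, ∑ l, (2 * interaction n R k l ^ 2
      + 2 * (R k l - interaction n R k l) ^ 2) :=
    Finset.sum_le_sum fun k _ => Finset.sum_le_sum fun l _ => sq_le_two_mul_sq_add _ _
  simp only [Finset.sum_add_distrib, ← Finset.mul_sum] at this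
  linarith

lemma sum_interaction_sq_le (k : Fin n) :
    ∑ l, interaction n R k l ^ 2
      ≤ 2 * ∑ l, R k l ^ 2 + 2 * ∑ l, (R k l - interaction n R k l) ^ 2 := by
  rw [Finset.mul_sum, Finset.mul_sum, ← Finset.sum_add_distrib]
  refine Finset.sum_le_sum fun l _ => ?_
  have := sq_le_two_mul_sq_add (interaction n R k l) (R k l)
  rwa [sub_sq_comm (interaction n R k l)] at this

lemma sum_sum_interaction_sq_le (hn : 3 ≤ n) (hd : ∀ i, R i i = 0) :
    ∑ k, ∑ l, interaction n R k l ^ 2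
      ≤ 2 * (n * ((n : ℝ) - 1) * rdsq n R) + 48 * (n : ℝ) ^ 2 * r1sq n R := by
  have h := sum_sum_sub_interaction_sq_le hn hd
  have h2 := Finset.sum_le_sum fun k (_ : k ∈ Finset.univ) => sum_interaction_sq_le (R := R) k
  rw [Finset.sum_add_distrib, ← Finset.mul_sum, ← Finset.mul_sum,
    sum_sum_sq_eq (R := R) (by omega)] at h2
  linarith

lemma sum_sq_le_sq_sum {ι : Type*} {s : Finset ι} {x : ι → ℝ} (hx : ∀ i ∈ s, 0 ≤ x i) :
    ∑ i ∈ s, x i ^ 2 ≤ (∑ i ∈ s, x i) ^ 2 := by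
  rw [sq (∑ i ∈ s, x i), Finset.sum_mul]
  refine Finset.sum_le_sum fun i hi => ?_
  rw [sq]
  exact mul_le_mul_of_nonneg_left (Finset.single_le_sum hx hi) (hx i hi)

lemma sum_sum_interaction_sq_sq_le (hn : 3 ≤ n) (hd : ∀ i, R i i = 0) :
    ∑ k, (∑ l, interaction n R k l ^ 2) ^ 2
      ≤ 8 * ∑ k, (∑ l, R k l ^ 2) ^ 2 + 8 * (24 * (n : ℝ) ^ 2 * r1sq n R) ^ 2 := by
  have h := sum_sum_sub_interaction_sq_le hn hd
  set S : Fin n → ℝ := fun k => ∑ l, (R k l - interaction n R k l) ^ 2 with hS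
  have hS0 : ∀ k, 0 ≤ S k := fun k => by positivity
  have h1 : ∑ k, S k ^ 2 ≤ (24 * (n : ℝ) ^ 2 * r1sq n R) ^ 2 :=
    (sum_sq_le_sq_sum fun k _ => hS0 k).trans
      (pow_le_pow_left₀ (Finset.sum_nonneg fun k _ => hS0 k) h 2)
  have h2 : ∀ k, (∑ l, interaction n R k l ^ 2) ^ 2
      ≤ 8 * (∑ l, R k l ^ 2) ^ 2 + 8 * S k ^ 2 := fun k => by
    have h3 : 0 ≤ ∑ l, interaction n R k l ^ 2 := by positivity
    have := pow_le_pow_left₀ h3 (sum_interaction_sq_le (R := R) k) 2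
    refine this.trans ?_
    nlinarith [sq_nonneg (∑ l, R k l ^ 2 - S k)]
  refine (Finset.sum_le_sum fun k _ => h2 k).trans ?_
  rw [Finset.sum_add_distrib, ← Finset.mul_sum, ← Finset.mul_sum]
  linarith

/-- The fourth moment of the spectrum is controlled by the sum over disjoint pairs of indices. -/
lemma two_mul_sum_sum_mul_self_sq_le (hR : ∀ i j, R i j = R j i) (hd : ∀ i, R i i = 0) :
    2 * ∑ i, ∑ j, (∑ k, R i k * R k j) ^ 2
      ≤ (∑ i, ∑ j, ∑ k, ∑ l, if k ≠ i ∧ k ≠ j ∧ l ≠ i ∧ l ≠ j then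
          R i j * R k l * (R i k * R j l + R i l * R j k) else 0)
        + 4 * ∑ i, (∑ j, R i j ^ 2) ^ 2 := by
  have hT1 : ∑ i, ∑ j, (∑ k, R i k * R k j) ^ 2
      = ∑ i, ∑ j, ∑ k, ∑ l, R i j * R k l * (R i k * R j l) := by
    calc _ = ∑ i, ∑ l, ∑ j, ∑ k, R i j * R k l * (R i k * R j l) := by
          refine Finset.sum_congr rfl fun i _ => Finset.sum_congr rfl fun l _ => ?_
          rw [sq, Finset.sum_mul_sum]
          exact Finset.sum_congr rfl fun j _ => Finset.sum_congr rfl fun k _ => by ring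
      _ = _ := by
          refine Finset.sum_congr rfl fun i _ => ?_
          rw [Finset.sum_comm]
          exact Finset.sum_congr rfl fun j _ => Finset.sum_comm
  have hT2 : ∑ i, ∑ j, (∑ k, R i k * R k j) ^ 2
      = ∑ i, ∑ j, ∑ k, ∑ l, R i j * R k l * (R i l * R j k) := by
    rw [hT1]
    refine Finset.sum_congr rfl fun i _ => Finset.sum_congr rfl fun j _ => ?_
    rw [Finset.sum_comm]
    exact Finset.sum_congr rfl fun k _ => Finset.sum_congr rfl fun l _ => by rw [hR l k]
  have hQ : ∀ i : Fin n, (∑ j, R i j ^ 2) ^ 2 = ∑ j, ∑ l, R i j ^ 2 * R i l ^ 2 := fun i => by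
    rw [sq, Finset.sum_mul_sum]
  have hQ' : ∑ i, (∑ j, R i j ^ 2) ^ 2 = ∑ i, ∑ j, ∑ l, R i j ^ 2 * R j l ^ 2 := by
    simp_rw [hQ]
    conv_rhs => rw [Finset.sum_comm]
    exact Finset.sum_congr rfl fun i _ => Finset.sum_congr rfl fun j _ =>
      Finset.sum_congr rfl fun l _ => by rw [hR j i]
  have hpt : ∀ i j k l, R i j * R k l * (R i k * R j l) + R i j * R k l * (R i l * R j k)
      ≤ (if k ≠ i ∧ k ≠ j ∧ l ≠ i ∧ l ≠ j then
          R i j * R k l * (R i k * R j l + R i l * R j k) else 0)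
        + ((if k = j then R i j ^ 2 * R j l ^ 2 else 0)
          + (if l = i then R i j ^ 2 * R i k ^ 2 else 0)
          + (if k = i then R i j ^ 2 * R i l ^ 2 else 0)
          + (if l = j then R i j ^ 2 * R j k ^ 2 else 0)) := fun i j k l => by
    have p1 : 0 ≤ R i j ^ 2 * R j l ^ 2 := by positivity
    have p2 : 0 ≤ R i j ^ 2 * R i k ^ 2 := by positivity
    have p3 : 0 ≤ R i j ^ 2 * R i l ^ 2 := by positivity
    have p4 : 0 ≤ R i j ^ 2 * R j k ^ 2 := by positivity
    by_cases h1 : k = i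
    · subst h1
      simp only [hd, ne_eq, not_true_eq_false, false_and, if_false, if_true]
      rw [hR j k]
      split_ifs <;> nlinarith
    by_cases h2 : k = j
    · subst h2
      simp only [hd, ne_eq, not_true_eq_false, false_and, and_false, if_false, if_true]
      split_ifs <;> nlinarith
    by_cases h3 : l = i
    · subst h3
      simp only [hd, ne_eq, not_true_eq_false, false_and, and_false, if_false, if_true]
      rw [hR j l, hR k l]
      split_ifs <;> nlinarith
    by_cases h4 : l = j
    · subst h4
      simp only [hd, ne_eq, not_true_eq_false, and_false, if_false, if_true]
      rw [hR k l]
      split_ifs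
      nlinarith
    simp only [h1, h2, h3, h4, ne_eq, not_false_eq_true, and_self, if_true, if_false]
    exact le_of_eq (by ring)
  have h1 := Finset.sum_le_sum fun i (_ : i ∈ Finset.univ) => Finset.sum_le_sum
    fun j (_ : j ∈ Finset.univ) => Finset.sum_le_sum fun k (_ : k ∈ Finset.univ) =>
    Finset.sum_le_sum fun l (_ : l ∈ Finset.univ) => hpt i j k l
  simp only [Finset.sum_add_distrib] at h1
  rw [← hT1, ← hT2] at h1
  have e1 : ∑ i, ∑ j, ∑ k, ∑ l, (if k = j then R i j ^ 2 * R j l ^ 2 else 0)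
      = ∑ i, (∑ j, R i j ^ 2) ^ 2 := by
    rw [hQ']
    refine Finset.sum_congr rfl fun i _ => Finset.sum_congr rfl fun j _ => ?_
    rw [Finset.sum_comm]
    simp
  have e2 : ∑ i, ∑ j, ∑ k, ∑ l, (if l = i then R i j ^ 2 * R i k ^ 2 else 0)
      = ∑ i, (∑ j, R i j ^ 2) ^ 2 := by
    simp [hQ]
  have e3 : ∑ i, ∑ j, ∑ k, ∑ l, (if k = i then R i j ^ 2 * R i l ^ 2 else 0)
      = ∑ i, (∑ j, R i j ^ 2) ^ 2 := by
    simp_rw [hQ]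
    refine Finset.sum_congr rfl fun i _ => Finset.sum_congr rfl fun j _ => ?_
    rw [Finset.sum_comm]
    simp
  have e4 : ∑ i, ∑ j, ∑ k, ∑ l, (if l = j then R i j ^ 2 * R j k ^ 2 else 0)
      = ∑ i, (∑ j, R i j ^ 2) ^ 2 := by
    rw [hQ']
    simp
  rw [e1, e2, e3, e4] at h1
  linarith

lemma sum_mulVec_sq_le (M : Fin n → Fin n → ℝ) (v : Fin n → ℝ) :
    ∑ k, (∑ l, M k l * v l) ^ 2 ≤ (∑ k, ∑ l, M k l ^ 2) * ∑ l, v l ^ 2 := by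
  rw [Finset.sum_mul]
  exact Finset.sum_le_sum fun k _ => Finset.sum_mul_sq_le_sq_mul_sq _ _ _

lemma sum_mulVec_sq_le_sqrt (hR : ∀ i j, R i j = R j i) (v : Fin n → ℝ) :
    ∑ k, (∑ l, R k l * v l) ^ 2
      ≤ Real.sqrt (∑ i, ∑ j, (∑ k, R i k * R k j) ^ 2) * ∑ k, v k ^ 2 := by
  set M : Fin n → Fin n → ℝ := fun i j => ∑ k, R i k * R k j with hM
  have h1 : ∑ k, (∑ l, R k l * v l) ^ 2 = ∑ i, v i * ∑ j, M i j * v j := by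
    have : ∀ k, (∑ l, R k l * v l) ^ 2 = ∑ i, ∑ j, v i * (R i k * R k j * v j) := fun k => by
      rw [sq, Finset.sum_mul_sum]
      exact Finset.sum_congr rfl fun i _ => Finset.sum_congr rfl fun j _ => by rw [hR k i]; ring
    simp_rw [this]
    rw [Finset.sum_comm]
    refine Finset.sum_congr rfl fun i _ => ?_
    rw [Finset.sum_comm, Finset.mul_sum]
    refine Finset.sum_congr rfl fun j _ => ?_
    rw [hM, ← Finset.mul_sum, Finset.sum_mul]
  have hv : 0 ≤ ∑ k, v k ^ 2 := by positivity
  have hM0 : 0 ≤ ∑ i, ∑ j, M i j ^ 2 := by positivity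
  refine (abs_le_of_sq_le_sq' ?_ (by positivity)).2
  rw [mul_pow, Real.sq_sqrt hM0, h1]
  refine (Finset.sum_mul_sq_le_sq_mul_sq _ _ _).trans ?_
  have := mul_le_mul_of_nonneg_left (sum_mulVec_sq_le M v) hv
  refine this.trans (le_of_eq (by ring))

lemma sum_interaction_mulVec_sq_le (hn : 3 ≤ n) (hR : ∀ i j, R i j = R j i)
    (hd : ∀ i, R i i = 0) (v : Fin n → ℝ) :
    ∑ k, (∑ l, interaction n R k l * v l) ^ 2
      ≤ (2 * Real.sqrt (∑ i, ∑ j, (∑ k, R i k * R k j) ^ 2) + 48 * (n : ℝ) ^ 2 * r1sq n R)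
        * ∑ k, v k ^ 2 := by
  have hv : 0 ≤ ∑ k, v k ^ 2 := by positivity
  have h1 := sum_mulVec_sq_le_sqrt hR v
  have h2 := (sum_mulVec_sq_le (fun k l => R k l - interaction n R k l) v).trans
    (mul_le_mul_of_nonneg_right (sum_sum_sub_interaction_sq_le hn hd) hv)
  have hpt : ∀ k, (∑ l, interaction n R k l * v l) ^ 2 ≤ 2 * (∑ l, R k l * v l) ^ 2
      + 2 * (∑ l, (R k l - interaction n R k l) * v l) ^ 2 := fun k => by
    have := sq_le_two_mul_sq_add (∑ l, interaction n R k l * v l) (∑ l, R k l * v l)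
    rw [sub_sq_comm] at this
    refine this.trans (le_of_eq ?_)
    simp only [sub_mul, Finset.sum_sub_distrib]
  refine (Finset.sum_le_sum fun k _ => hpt k).trans ?_
  rw [Finset.sum_add_distrib, ← Finset.mul_sum, ← Finset.mul_sum]
  linarith

end Bounds

/-! ### Consequences of the conditions for the normalised kernels -/

/-- The interaction matrix, normalised in Frobenius norm. -/
noncomputable def unitInteraction (n : ℕ) (R : Fin n → Fin n → ℝ) (k l : Fin n) : ℝ :=
  interaction n R k l / Real.sqrt (∑ k, ∑ l, interaction n R k l ^ 2)

/-- The centred row means, normalised in Euclidean norm. -/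
noncomputable def unitRowDev (n : ℕ) (R : Fin n → Fin n → ℝ) (k : Fin n) : ℝ :=
  rowDev n R k / Real.sqrt (∑ k, rowDev n R k ^ 2)

section Asymptotics

variable {K : (n : ℕ) → Fin n → Fin n → ℝ}

lemma tendsto_r1sq_div_rdsq (hC6 : Cond6 K) :
    Tendsto (fun n => r1sq n (K n) / rdsq n (K n)) atTop (𝓝 0) := by
  have h := hC6.tendsto_div_nhds_zero.pow 2
  simpa [div_pow, Real.sq_sqrt r1sq_nonneg, Real.sq_sqrt rdsq_nonneg] using h

lemma eventually_rdsq_le (hdiag : ∀ n (i : Fin n), K n i i = 0) (hC6 : Cond6 K)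
    (hpos : ∀ᶠ n in atTop, 0 < ∑ k, ∑ l, interaction n (K n) k l ^ 2) :
    ∀ᶠ n in atTop, 0 < rdsq n (K n) ∧
      (n : ℝ) ^ 2 * rdsq n (K n) / 8 ≤ ∑ k, ∑ l, interaction n (K n) k l ^ 2 := by
  have hb := hC6.bound (by norm_num : (0 : ℝ) < 1 / 14)
  filter_upwards [hb, hpos, eventually_ge_atTop 3] with n h1 h2 hn
  have h3 : (3 : ℝ) ≤ n := by exact_mod_cast hn
  have hD : 0 ≤ rdsq n (K n) := rdsq_nonneg
  have hρ : r1sq n (K n) ≤ rdsq n (K n) / 192 := by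
    rw [Real.norm_of_nonneg (Real.sqrt_nonneg _), Real.norm_of_nonneg (Real.sqrt_nonneg _)] at h1
    have := pow_le_pow_left₀ (Real.sqrt_nonneg _) h1 2
    rw [mul_pow, Real.sq_sqrt r1sq_nonneg, Real.sq_sqrt hD] at this
    linarith
  have hn2 := mul_le_mul_of_nonneg_left hρ (by positivity : 0 ≤ 48 * (n : ℝ) ^ 2)
  have hn1 : 0 ≤ (n : ℝ) * (n - 2) * rdsq n (K n) :=
    mul_nonneg (mul_nonneg (by linarith) (by linarith)) hD
  have hl := sum_sum_sq_le_interaction hn (hdiag n)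
  have hu := sum_sum_interaction_sq_le hn (hdiag n)
  refine ⟨hD.lt_of_ne fun h => ?_, by nlinarith⟩
  rw [← h] at hρ hu hn2
  nlinarith

lemma isLittleO_sum_sum_sq_sq (hC1 : Cond1 K) :
    (fun n => ∑ i : Fin n, (∑ j : Fin n, K n i j ^ 2) ^ 2)
      =o[atTop] fun n => (n : ℝ) ^ 4 * rdsq n (K n) ^ 2 := by
  refine hC1.trans_isLittleO (IsLittleO.mul_isBigO ?_ (isBigO_refl _ _))
  exact (isLittleO_pow_pow_atTop_of_lt (𝕜 := ℝ) (by norm_num : 3 < 4)).comp_tendsto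
    tendsto_natCast_atTop_atTop

lemma tendsto_sum_unitInteraction (hdiag : ∀ n (i : Fin n), K n i i = 0) (hC1 : Cond1 K)
    (hC6 : Cond6 K) (hpos : ∀ᶠ n in atTop, 0 < ∑ k, ∑ l, interaction n (K n) k l ^ 2) :
    Tendsto (fun n => ∑ k, (∑ l, unitInteraction n (K n) k l ^ 2) ^ 2) atTop (𝓝 0) := by
  have h1 := (isLittleO_sum_sum_sq_sq hC1).tendsto_div_nhds_zero.const_mul 512
  have h2 := ((tendsto_r1sq_div_rdsq hC6).pow 2).const_mul (512 * 576)
  have h := h1.add h2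
  rw [zero_pow two_ne_zero, mul_zero, mul_zero, add_zero] at h
  refine squeeze_zero' (Eventually.of_forall fun n => by positivity) ?_ h
  filter_upwards [eventually_rdsq_le hdiag hC6 hpos, hpos, eventually_ge_atTop 3]
    with n ⟨hD, hH⟩ hp hn
  have h3 : (3 : ℝ) ≤ n := by exact_mod_cast hn
  have hn0 : (0 : ℝ) < n := by linarith
  have key := sum_sum_interaction_sq_sq_le hn (hdiag n)
  set h := ∑ k, ∑ l, interaction n (K n) k l ^ 2 with hh
  have e : ∑ k, (∑ l, unitInteraction n (K n) k l ^ 2) ^ 2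
      = (∑ k, (∑ l, interaction n (K n) k l ^ 2) ^ 2) / h ^ 2 := by
    simp only [unitInteraction, div_pow, Real.sq_sqrt hp.le, ← hh, ← Finset.sum_div]
  have hsq : ((n : ℝ) ^ 2 * rdsq n (K n) / 8) ^ 2 ≤ h ^ 2 := by gcongr
  rw [e]
  calc _ ≤ (8 * ∑ k, (∑ l, K n k l ^ 2) ^ 2 + 8 * (24 * (n : ℝ) ^ 2 * r1sq n (K n)) ^ 2)
        / ((n : ℝ) ^ 2 * rdsq n (K n) / 8) ^ 2 := by gcongr
    _ = _ := by field_simp; ring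

/-- A bound for the spectral norm of `unitInteraction`. -/
noncomputable def unitInteractionNorm (n : ℕ) (R : Fin n → Fin n → ℝ) : ℝ :=
  Real.sqrt ((2 * Real.sqrt (∑ i, ∑ j, (∑ k, R i k * R k j) ^ 2) + 48 * (n : ℝ) ^ 2 * r1sq n R)
    / ∑ k, ∑ l, interaction n R k l ^ 2)

lemma sum_unitInteraction_mulVec_sq_le {n : ℕ} {R : Fin n → Fin n → ℝ} (hn : 3 ≤ n)
    (hR : ∀ i j, R i j = R j i) (hd : ∀ i, R i i = 0) (v : Fin n → ℝ) :
    ∑ k, (∑ l, unitInteraction n R k l * v l) ^ 2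
      ≤ unitInteractionNorm n R ^ 2 * ∑ k, v k ^ 2 := by
  have h0 : 0 ≤ ∑ k, ∑ l, interaction n R k l ^ 2 := by positivity
  have hρ : 0 ≤ r1sq n R := r1sq_nonneg
  rw [unitInteractionNorm, Real.sq_sqrt (by positivity), div_mul_eq_mul_div]
  have e : ∑ k, (∑ l, unitInteraction n R k l * v l) ^ 2
      = (∑ k, (∑ l, interaction n R k l * v l) ^ 2) / ∑ k, ∑ l, interaction n R k l ^ 2 := by
    simp only [unitInteraction, div_mul_eq_mul_div, ← Finset.sum_div, div_pow, Real.sq_sqrt h0]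
  rw [e]
  exact div_le_div_of_nonneg_right (sum_interaction_mulVec_sq_le hn hR hd v) h0

lemma tendsto_unitInteractionNorm (hsym : ∀ n (i j : Fin n), K n i j = K n j i)
    (hdiag : ∀ n (i : Fin n), K n i i = 0) (hC1 : Cond1 K) (hC5 : Cond5 K)
    (hC6 : Cond6 K) (hpos : ∀ᶠ n in atTop, 0 < ∑ k, ∑ l, interaction n (K n) k l ^ 2) :
    Tendsto (fun n => unitInteractionNorm n (K n)) atTop (𝓝 0) := by
  have hT : Tendsto (fun n => (∑ i, ∑ j, (∑ k, K n i k * K n k j) ^ 2)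
      / ((n : ℝ) ^ 4 * rdsq n (K n) ^ 2)) atTop (𝓝 0) := by
    have h1 := (hC5.tendsto_div_nhds_zero.div_const 2).add
      ((isLittleO_sum_sum_sq_sq hC1).tendsto_div_nhds_zero.const_mul 2)
    rw [zero_div, mul_zero, add_zero] at h1
    refine squeeze_zero (fun n => by positivity) (fun n => ?_) h1
    have key := two_mul_sum_sum_mul_self_sq_le (hsym n) (hdiag n)
    rw [div_right_comm, mul_div_assoc', ← add_div]
    gcongr
    linarith
  have h := ((((Real.continuous_sqrt.tendsto 0).comp hT).const_mul 16).add
    ((tendsto_r1sq_div_rdsq hC6).const_mul 384))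
  rw [Real.sqrt_zero, mul_zero, mul_zero, add_zero] at h
  rw [← Real.sqrt_zero]
  refine (Real.continuous_sqrt.tendsto 0).comp (squeeze_zero' ?_ ?_ h)
  · exact Eventually.of_forall fun n => by
      have : 0 ≤ r1sq n (K n) := r1sq_nonneg
      positivity
  filter_upwards [eventually_rdsq_le hdiag hC6 hpos, eventually_ge_atTop 3] with n ⟨hD, hH⟩ hn
  have h3 : (3 : ℝ) ≤ n := by exact_mod_cast hn
  have hn0 : (0 : ℝ) < n := by linarith
  have hρ : 0 ≤ r1sq n (K n) := r1sq_nonneg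
  have hs : Real.sqrt ((n : ℝ) ^ 4 * rdsq n (K n) ^ 2) = (n : ℝ) ^ 2 * rdsq n (K n) := by
    rw [show (n : ℝ) ^ 4 * rdsq n (K n) ^ 2 = ((n : ℝ) ^ 2 * rdsq n (K n)) ^ 2 by ring]
    exact Real.sqrt_sq (by positivity)
  calc _ ≤ (2 * Real.sqrt (∑ i, ∑ j, (∑ k, K n i k * K n k j) ^ 2)
        + 48 * (n : ℝ) ^ 2 * r1sq n (K n)) / ((n : ℝ) ^ 2 * rdsq n (K n) / 8) := by gcongr
    _ = _ := by
      rw [Function.comp_apply, Real.sqrt_div' _ (by positivity), hs]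
      field_simp
      ring

lemma tendsto_sum_unitRowDev (hC2 : Cond2 K)
    (hpos : ∀ᶠ n in atTop, 0 < ∑ k, rowDev n (K n) k ^ 2) :
    Tendsto (fun n => ∑ k, unitRowDev n (K n) k ^ 4) atTop (𝓝 0) := by
  refine squeeze_zero' (Eventually.of_forall fun n => by positivity) ?_ hC2.tendsto_div_nhds_zero
  filter_upwards [hpos] with n hp
  rw [← sum_rowDev_sq]
  set β := ∑ k, rowDev n (K n) k ^ 2 with hβ
  have hs : 0 < Real.sqrt β := Real.sqrt_pos.2 hp
  have e : β ^ ((3 : ℝ) / 2) = Real.sqrt β ^ 3 := by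
    rw [Real.sqrt_eq_rpow, ← Real.rpow_natCast, ← Real.rpow_mul hp.le]
    norm_num
  rw [e, Finset.sum_div]
  refine Finset.sum_le_sum fun k _ => ?_
  have h1 : |unitRowDev n (K n) k| ≤ 1 := by
    rw [unitRowDev, abs_div, abs_of_pos hs, div_le_one hs]
    refine Real.abs_le_sqrt ?_
    exact Finset.single_le_sum (f := fun k => rowDev n (K n) k ^ 2) (fun _ _ => sq_nonneg _)
      (Finset.mem_univ k)
  have h2 : |rowDev n (K n) k| ^ 3 / Real.sqrt β ^ 3 = |unitRowDev n (K n) k| ^ 3 := by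
    rw [unitRowDev, abs_div, abs_of_pos hs, div_pow]
  change _ ≤ |rowDev n (K n) k| ^ 3 / Real.sqrt β ^ 3
  rw [h2, ← Even.pow_abs (by decide : Even 4)]
  exact pow_le_pow_of_le_one (abs_nonneg _) h1 (by norm_num)

end Asymptotics

/-! ### Standardisation -/

section Standardization

variable {n : ℕ} {R : Fin n → Fin n → ℝ}

lemma sum_sum_unitInteraction_sq (h : 0 < ∑ k, ∑ l, interaction n R k l ^ 2) :
    ∑ k, ∑ l, unitInteraction n R k l ^ 2 = 1 := by
  simp only [unitInteraction, div_pow, Real.sq_sqrt h.le, ← Finset.sum_div]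
  exact div_self h.ne'

lemma sum_unitRowDev_sq (h : 0 < ∑ k, rowDev n R k ^ 2) : ∑ k, unitRowDev n R k ^ 2 = 1 := by
  simp only [unitRowDev, div_pow, Real.sq_sqrt h.le, ← Finset.sum_div]
  exact div_self h.ne'

lemma unitInteraction_self (k : Fin n) : unitInteraction n R k k = 0 := by
  simp [unitInteraction, interaction_self]

lemma unitInteraction_comm (hR : ∀ i j, R i j = R j i) (k l : Fin n) :
    unitInteraction n R k l = unitInteraction n R l k := by
  rw [unitInteraction, interaction_comm hR, unitInteraction]

lemma sum_unitInteraction (hn : 3 ≤ n) (hd : ∀ i, R i i = 0) (k : Fin n) :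
    ∑ l, unitInteraction n R k l = 0 := by
  simp only [unitInteraction, ← Finset.sum_div, sum_interaction hn hd, zero_div]

lemma sum_unitRowDev : ∑ k, unitRowDev n R k = 0 := by
  simp only [unitRowDev, ← Finset.sum_div, sum_rowDev, zero_div]

lemma qstat_unitInteraction (h : 0 < ∑ k, ∑ l, interaction n R k l ^ 2) (φ : Fin n → ℝ)
    (f : Fin n → Fin n) :
    qstat (interaction n R) φ f
      = Real.sqrt (∑ k, ∑ l, interaction n R k l ^ 2) * qstat (unitInteraction n R) φ f := by
  have hs := (Real.sqrt_pos.2 h).ne'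
  simp only [qstat, unitInteraction, Finset.mul_sum]
  refine Finset.sum_congr rfl fun k _ => Finset.sum_congr rfl fun l _ => ?_
  field_simp

lemma lstat_unitRowDev (h : 0 < ∑ k, rowDev n R k ^ 2) (φ : Fin n → ℝ) (f : Fin n → Fin n) :
    lstat (rowDev n R) φ f = Real.sqrt (∑ k, rowDev n R k ^ 2) * lstat (unitRowDev n R) φ f := by
  have hs := (Real.sqrt_pos.2 h).ne'
  simp only [lstat, unitRowDev, Finset.mul_sum]
  refine Finset.sum_congr rfl fun k _ => ?_
  field_simp

lemma standardized_eq {f T : Equiv.Perm (Fin n) → ℝ} {c d : ℝ} (hd : 0 < d)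
    (hf : ∀ π, f π = d * T π⁻¹ + c) (hT : pexp n T = 0) (π : Equiv.Perm (Fin n)) :
    (f π - pexp n f) / Real.sqrt (pvar n f) = T π⁻¹ / Real.sqrt (pexp n fun π => T π ^ 2) := by
  obtain ⟨h1, h2⟩ := standardize_eq hf hT
  rw [h1, h2, Real.sqrt_mul (sq_nonneg d), Real.sqrt_sq hd.le, mul_div_mul_left _ _ hd.ne']

variable {t : ℕ}

lemma sum_sum_interaction_sq_pos (hn : 3 ≤ n) (hR : ∀ i j, R i j = R j i) (hd : ∀ i, R i i = 0)
    (ht : t ≤ n) (hvar : 0 < pvar n fun π => Uw n R π 0 t) :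
    0 < ∑ k, ∑ l, interaction n R k l ^ 2 := by
  obtain ⟨c, hc⟩ := Uw_zero_eq hn hR hd ht
  have h := (standardize_eq (f := fun π => Uw n R π 0 t)
    (T := fun σ => qstat (interaction n R) (cind n t) σ) (c := c) (d := 1)
    (fun π => by rw [hc, one_mul])
    (pexp_qstat _ interaction_self (sum_interaction hn hd))).1
  rw [h] at hvar
  refine (by positivity : (0 : ℝ) ≤ _).lt_of_ne fun h0 => hvar.ne' ?_
  have hz : ∀ k l, interaction n R k l = 0 := fun k l => by
    have h1 := (Finset.sum_eq_zero_iff_of_nonneg fun k _ =>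
      Finset.sum_nonneg fun l _ => sq_nonneg (interaction n R k l)).1 h0.symm k (Finset.mem_univ k)
    have h2 := (Finset.sum_eq_zero_iff_of_nonneg fun l _ =>
      sq_nonneg (interaction n R k l)).1 h1 l (Finset.mem_univ l)
    exact pow_eq_zero_iff two_ne_zero |>.1 h2
  simp [qstat, hz, pexp]

lemma sum_rowDev_sq_pos (hn : 2 ≤ n) (hR : ∀ i j, R i j = R j i) (ht : t ≤ n)
    (hvar : 0 < pvar n fun π => Udiff n R π 0 t) : 0 < ∑ k, rowDev n R k ^ 2 := by
  have h := (standardize_eq (T := fun σ => lstat (rowDev n R) (cind n t) σ)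
    (Udiff_zero_eq hn hR ht) (pexp_lstat _ (sum_cind ht))).1
  rw [h] at hvar
  refine (by positivity : (0 : ℝ) ≤ _).lt_of_ne fun h0 => hvar.ne' ?_
  have hz : ∀ k, rowDev n R k = 0 := fun k => by
    have h1 := (Finset.sum_eq_zero_iff_of_nonneg fun k _ =>
      sq_nonneg (rowDev n R k)).1 h0.symm k (Finset.mem_univ k)
    exact pow_eq_zero_iff two_ne_zero |>.1 h1
  simp [lstat, hz, pexp]

lemma Zw_zero_eq (hn : 3 ≤ n) (hR : ∀ i j, R i j = R j i) (hd : ∀ i, R i i = 0)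
    (ht : t ≤ n) (h : 0 < ∑ k, ∑ l, interaction n R k l ^ 2) (π : Equiv.Perm (Fin n)) :
    Zw n R π 0 t = qstat (unitInteraction n R) (cind n t) (π⁻¹ : Equiv.Perm (Fin n))
      / Real.sqrt (pexp n fun σ => qstat (unitInteraction n R) (cind n t) σ ^ 2) := by
  obtain ⟨c, hc⟩ := Uw_zero_eq hn hR hd ht
  exact standardized_eq (f := fun π => Uw n R π 0 t) (c := c)
    (T := fun σ => qstat (unitInteraction n R) (cind n t) σ)
    (Real.sqrt_pos.2 h) (fun π => by rw [hc, qstat_unitInteraction h])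
    (pexp_qstat _ unitInteraction_self (sum_unitInteraction hn hd)) π

lemma Zdiff_zero_eq (hn : 2 ≤ n) (hR : ∀ i j, R i j = R j i) (ht : t ≤ n)
    (h : 0 < ∑ k, rowDev n R k ^ 2) (π : Equiv.Perm (Fin n)) :
    Zdiff n R π 0 t = lstat (unitRowDev n R) (cind n t) (π⁻¹ : Equiv.Perm (Fin n))
      / Real.sqrt (pexp n fun σ => lstat (unitRowDev n R) (cind n t) σ ^ 2) := by
  have h2 : (2 : ℝ) ≤ n := by exact_mod_cast hn
  have hc : 0 < 2 * ((n : ℝ) - 1) := by linarith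
  exact standardized_eq (f := fun π => Udiff n R π 0 t)
    (c := (2 * ((t : ℝ) / n) - 1) * ∑ k, ∑ l, R k l) (T := fun σ => lstat (unitRowDev n R) (cind n t) σ)
    (mul_pos hc (Real.sqrt_pos.2 h))
    (fun π => by rw [Udiff_zero_eq hn hR ht, lstat_unitRowDev h, mul_assoc (2 * ((n : ℝ) - 1))])
    (pexp_lstat _ (sum_cind ht)) π

end Standardization

/-! ### Limits of second moments -/

section Limits

lemma cindCov_eq {κ : Type*} {n : ℕ} {t : κ → ℕ} (ht : ∀ s, t s ≤ n) (r s : κ) :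
    cindCov n t r s = min ((t r : ℝ) / n) ((t s : ℝ) / n)
      * (1 - max ((t r : ℝ) / n) ((t s : ℝ) / n)) := by
  rcases Nat.eq_zero_or_pos n with rfl | hn
  · simp [cindCov]
  have hn' : (0 : ℝ) < n := by positivity
  rcases le_total (t r) (t s) with h | h
  · have h' : (t r : ℝ) / n ≤ (t s : ℝ) / n := by gcongr
    rw [min_eq_left h', max_eq_right h', cindCov, sum_cind_mul_cind h (ht s)]
    field_simp
  · have h' : (t s : ℝ) / n ≤ (t r : ℝ) / n := by gcongr
    simp_rw [cindCov, mul_comm (cind n (t r) _)]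
    rw [min_eq_right h', max_eq_left h', sum_cind_mul_cind h (ht r)]
    field_simp

lemma tendsto_cindCov {κ : Type*} {t : ℕ → κ → ℕ} {u : κ → ℝ} (ht : ∀ n s, t n s ≤ n)
    (hu : ∀ s, Tendsto (fun n : ℕ => (t n s : ℝ) / n) atTop (𝓝 (u s))) (r s : κ) :
    Tendsto (fun n => cindCov n (t n) r s) atTop
      (𝓝 (min (u r) (u s) * (1 - max (u r) (u s)))) := by
  simp_rw [fun n => cindCov_eq (ht n) r s]
  exact ((hu r).min (hu s)).mul (((hu r).max (hu s)).const_sub 1)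

lemma sum_cind_sq_div {κ : Type*} {n : ℕ} (t : κ → ℕ) (s : κ) :
    (∑ i, cind n (t s) i ^ 2) / n = cindCov n t s s := by
  simp only [cindCov, sq]

lemma tendsto_of_abs_sub_le {x y d : ℕ → ℝ} {L : ℝ} (hy : Tendsto y atTop (𝓝 L))
    (hd : Tendsto d atTop (𝓝 0))
    (h : ∀ᶠ n in atTop, |x n - y n| ≤ d n + 2 * Real.sqrt (d n * y n)) :
    Tendsto x atTop (𝓝 L) := by
  have h1 : Tendsto (fun n => d n + 2 * Real.sqrt (d n * y n)) atTop (𝓝 0) := by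
    have h2 := (Real.continuous_sqrt.tendsto _).comp (hd.mul hy)
    have := hd.add (h2.const_mul 2)
    rwa [zero_mul, Real.sqrt_zero, mul_zero, add_zero] at this
  simpa using (squeeze_zero_norm' h h1).add hy

lemma tendsto_const_div_sqrt_nat (c : ℝ) :
    Tendsto (fun n : ℕ => c / Real.sqrt n) atTop (𝓝 0) :=
  (Real.tendsto_sqrt_atTop.comp tendsto_natCast_atTop_atTop).const_div_atTop c

variable {κ : Type*} {t : ℕ → κ → ℕ} {u : κ → ℝ}

lemma tendsto_pexp_qstat_sq (ht : ∀ n s, t n s ≤ n)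
    (hu : ∀ s, Tendsto (fun n : ℕ => (t n s : ℝ) / n) atTop (𝓝 (u s)))
    {H : (n : ℕ) → Fin n → Fin n → ℝ} (hH : ∀ n k l, H n k l = H n l k) (hd : ∀ n k, H n k k = 0)
    (hrow : ∀ᶠ n in atTop, ∀ k, ∑ l, H n k l = 0)
    (hH1 : ∀ᶠ n in atTop, ∑ k, ∑ l, H n k l ^ 2 = 1) (s : κ) :
    Tendsto (fun n => pexp n fun σ => qstat (H n) (cind n (t n s)) σ ^ 2) atTop
      (𝓝 (2 * (u s * (1 - u s)) ^ 2)) := by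
  have hc := ((tendsto_cindCov ht hu s s).pow 2).const_mul 2
  rw [min_self, max_self] at hc
  refine tendsto_of_abs_sub_le hc (tendsto_const_div_sqrt_nat 32) ?_
  filter_upwards [hrow, hH1, eventually_ge_atTop 4] with n h1 h2 hn
  refine abs_pexp_sq_sub_le (T := fun f => qstat (H n) (cind n (t n s)) f) (by omega)
    (by positivity) ?_ (by positivity) ?_
  · have := sum_coupling_qstat_le hn (ht n s) (H n) (hH n) (hd n) h1
    rwa [h2, mul_one] at this
  · rw [sum_fun_qstat_sq (by omega) (H n) _ (sum_cind (ht n s)) (hH n) (hd n) h1, h2, mul_one,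
      sum_cind_sq_div]

lemma tendsto_pexp_lstat_sq (ht : ∀ n s, t n s ≤ n)
    (hu : ∀ s, Tendsto (fun n : ℕ => (t n s : ℝ) / n) atTop (𝓝 (u s)))
    {b : (n : ℕ) → Fin n → ℝ} (hb : ∀ᶠ n in atTop, ∑ k, b n k = 0)
    (hb1 : ∀ᶠ n in atTop, ∑ k, b n k ^ 2 = 1) (s : κ) :
    Tendsto (fun n => pexp n fun σ => lstat (b n) (cind n (t n s)) σ ^ 2) atTop
      (𝓝 (u s * (1 - u s))) := by
  have hc := tendsto_cindCov ht hu s s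
  rw [min_self, max_self] at hc
  refine tendsto_of_abs_sub_le hc (tendsto_const_div_sqrt_nat 2) ?_
  filter_upwards [hb, hb1, eventually_ge_atTop 2] with n h1 h2 hn
  refine abs_pexp_sq_sub_le (T := fun f => lstat (b n) (cind n (t n s)) f) (by omega)
    (by positivity) ?_ ?_ ?_
  · have := sum_coupling_lstat_le hn (ht n s) (b n) h1
    rwa [h2, mul_one] at this
  · rw [← sum_cind_sq_div]; positivity
  · rw [sum_fun_lstat_sq (by omega) (b n) _ (sum_cind (ht n s)), h2, mul_one, sum_cind_sq_div]

end Limits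

/-! ### The joint limit -/

section JointLimit

lemma two_mul_cov_sq_eq_rhoW {u v : ℝ} (hu0 : 0 < u) (hu1 : u < 1) (hv0 : 0 < v) (hv1 : v < 1)
    (x y : ℝ) :
    2 * (x / Real.sqrt (2 * (u * (1 - u)) ^ 2) * (y / Real.sqrt (2 * (v * (1 - v)) ^ 2))
      * (min u v * (1 - max u v)) ^ 2) = x * y * rhoW u v := by
  have h1 : 0 < 1 - u := by linarith
  have h2 : 0 < 1 - v := by linarith
  have hs : Real.sqrt 2 ≠ 0 := by positivity
  have hs2 : Real.sqrt 2 ^ 2 = 2 := Real.sq_sqrt (by norm_num)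
  rw [Real.sqrt_mul (by norm_num), Real.sqrt_mul (by norm_num), Real.sqrt_sq (by positivity),
    Real.sqrt_sq (by positivity), rhoW]
  rcases le_total u v with h | h
  · rw [min_eq_left h, max_eq_right h]
    field_simp
    rw [hs2]; ring
  · rw [min_eq_right h, max_eq_left h]
    field_simp
    rw [hs2]; ring

lemma cov_eq_rhoDiff {u v : ℝ} (hu0 : 0 < u) (hu1 : u < 1) (x y : ℝ) :
    x / Real.sqrt (u * (1 - u)) * (y / Real.sqrt (v * (1 - v))) * (min u v * (1 - max u v))
      = x * y * rhoDiff u v := by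
  have h1 : 0 ≤ u * (1 - u) := mul_nonneg hu0.le (by linarith)
  have hmm : min u v * (1 - min u v) * (max u v * (1 - max u v))
      = u * (1 - u) * (v * (1 - v)) := by
    rcases le_total u v with h | h
    · rw [min_eq_left h, max_eq_right h]
    · rw [min_eq_right h, max_eq_left h, mul_comm]
  rw [rhoDiff, hmm, Real.sqrt_mul h1]
  ring

variable {κ : Type*} [Fintype κ]

/-- The limiting variance of a linear combination of the standardised statistics. -/
noncomputable def limVar (u : κ → ℝ) (a : κ ⊕ κ → ℝ) : ℝ :=
  ∑ i, ∑ j, (a (Sum.inl i) * a (Sum.inl j) * rhoW (u i) (u j)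
    + a (Sum.inr i) * a (Sum.inr j) * rhoDiff (u i) (u j))

lemma limVar_mul (u : κ → ℝ) (a : κ ⊕ κ → ℝ) (τ : ℝ) :
    limVar u (fun s => τ * a s) = τ ^ 2 * limVar u a := by
  simp only [limVar, Finset.mul_sum]
  exact Finset.sum_congr rfl fun i _ => Finset.sum_congr rfl fun j _ => by ring

variable {t : ℕ → κ → ℕ} {u : κ → ℝ}

lemma tendsto_scanVar (ht : ∀ n s, t n s ≤ n)
    (hu : ∀ s, Tendsto (fun n : ℕ => (t n s : ℝ) / n) atTop (𝓝 (u s)))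
    (hu0 : ∀ s, 0 < u s) (hu1 : ∀ s, u s < 1)
    {H : (n : ℕ) → Fin n → Fin n → ℝ} {b : (n : ℕ) → Fin n → ℝ}
    (hH1 : ∀ᶠ n in atTop, ∑ k, ∑ l, H n k l ^ 2 = 1) (hb1 : ∀ᶠ n in atTop, ∑ k, b n k ^ 2 = 1)
    {α γ : ℕ → κ → ℝ} {a : κ ⊕ κ → ℝ}
    (hα : ∀ s, Tendsto (fun n => α n s) atTop
      (𝓝 (a (Sum.inl s) / Real.sqrt (2 * (u s * (1 - u s)) ^ 2))))
    (hγ : ∀ s, Tendsto (fun n => γ n s) atTop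
      (𝓝 (a (Sum.inr s) / Real.sqrt (u s * (1 - u s))))) :
    Tendsto (fun n => scanVar (H n) (b n) (t n) (α n) (γ n)) atTop (𝓝 (limVar u a)) := by
  have h1 : Tendsto (fun n => ∑ r, ∑ s, 2 * (α n r * α n s * cindCov n (t n) r s ^ 2)) atTop
      (𝓝 (∑ r, ∑ s, a (Sum.inl r) * a (Sum.inl s) * rhoW (u r) (u s))) := by
    refine tendsto_finsetSum _ fun r _ => tendsto_finsetSum _ fun s _ => ?_
    rw [← two_mul_cov_sq_eq_rhoW (hu0 r) (hu1 r) (hu0 s) (hu1 s)]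
    exact (((hα r).mul (hα s)).mul ((tendsto_cindCov ht hu r s).pow 2)).const_mul 2
  have h2 : Tendsto (fun n => ∑ r, ∑ s, γ n r * γ n s * cindCov n (t n) r s) atTop
      (𝓝 (∑ r, ∑ s, a (Sum.inr r) * a (Sum.inr s) * rhoDiff (u r) (u s))) := by
    refine tendsto_finsetSum _ fun r _ => tendsto_finsetSum _ fun s _ => ?_
    rw [← cov_eq_rhoDiff (hu0 r) (hu1 r)]
    exact ((hγ r).mul (hγ s)).mul (tendsto_cindCov ht hu r s)
  have h := h1.add h2
  simp only [← Finset.sum_add_distrib] at h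
  refine h.congr' ?_
  filter_upwards [hH1, hb1] with n e1 e2
  simp only [scanVar, e1, e2, one_mul, Finset.mul_sum, Finset.sum_add_distrib]

lemma exists_sum_abs_le {α : ℕ → κ → ℝ} {c : κ → ℝ}
    (hα : ∀ s, Tendsto (fun n => α n s) atTop (𝓝 (c s))) :
    ∃ S, ∀ᶠ n in atTop, ∑ s, |α n s| ≤ S :=
  ⟨∑ s, |c s| + 1, (tendsto_finsetSum _ fun s _ => (hα s).abs).eventually_le_const (lt_add_one _)⟩

variable {K : (n : ℕ) → Fin n → Fin n → ℝ}

lemma tendsto_avg_exp_standardized (hsym : ∀ n (i j : Fin n), K n i j = K n j i)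
    (hdiag : ∀ n (i : Fin n), K n i i = 0) (hC1 : Cond1 K) (hC2 : Cond2 K) (hC5 : Cond5 K)
    (hC6 : Cond6 K) (hposw : ∀ᶠ n in atTop, 0 < ∑ k, ∑ l, interaction n (K n) k l ^ 2)
    (hposd : ∀ᶠ n in atTop, 0 < ∑ k, rowDev n (K n) k ^ 2) (ht : ∀ n s, t n s ≤ n)
    (hu : ∀ s, Tendsto (fun n : ℕ => (t n s : ℝ) / n) atTop (𝓝 (u s)))
    (hu0 : ∀ s, 0 < u s) (hu1 : ∀ s, u s < 1) (a : κ ⊕ κ → ℝ) :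
    0 ≤ limVar u a ∧
    Tendsto (fun n => ((n.factorial : ℝ)⁻¹ : ℝ) • ∑ π : Equiv.Perm (Fin n),
      Complex.exp (Complex.I * ((∑ s, a s * Sum.elim (fun i => Zw n (K n) π 0 (t n i))
        (fun i => Zdiff n (K n) π 0 (t n i)) s : ℝ) : ℂ))) atTop
      (𝓝 (Complex.exp (-(limVar u a : ℂ) / 2))) := by
  have h3 := eventually_ge_atTop (α := ℕ) 3
  have hH1 : ∀ᶠ n in atTop, ∑ k, ∑ l, unitInteraction n (K n) k l ^ 2 = 1 :=
    hposw.mono fun n => sum_sum_unitInteraction_sq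
  have hb1 : ∀ᶠ n in atTop, ∑ k, unitRowDev n (K n) k ^ 2 = 1 :=
    hposd.mono fun n => sum_unitRowDev_sq
  have hrow : ∀ᶠ n in atTop, ∀ k, ∑ l, unitInteraction n (K n) k l = 0 :=
    h3.mono fun n hn => sum_unitInteraction hn (hdiag n)
  have hb : ∀ᶠ n in atTop, ∑ k, unitRowDev n (K n) k = 0 :=
    Eventually.of_forall fun n => sum_unitRowDev
  have hH : ∀ n k l, unitInteraction n (K n) k l = unitInteraction n (K n) l k :=
    fun n => unitInteraction_comm (hsym n)
  set α : ℕ → κ → ℝ := fun n s => a (Sum.inl s)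
    / Real.sqrt (pexp n fun σ => qstat (unitInteraction n (K n)) (cind n (t n s)) σ ^ 2) with hαdef
  set γ : ℕ → κ → ℝ := fun n s => a (Sum.inr s)
    / Real.sqrt (pexp n fun σ => lstat (unitRowDev n (K n)) (cind n (t n s)) σ ^ 2) with hγdef
  have hu2 : ∀ s, 0 < u s * (1 - u s) := fun s => mul_pos (hu0 s) (by linarith [hu1 s])
  have hα : ∀ s, Tendsto (fun n => α n s) atTop
      (𝓝 (a (Sum.inl s) / Real.sqrt (2 * (u s * (1 - u s)) ^ 2))) := fun s => by
    have hp : 0 < 2 * (u s * (1 - u s)) ^ 2 := by have := hu2 s; positivity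
    exact tendsto_const_nhds.div ((tendsto_pexp_qstat_sq ht hu hH (fun n => unitInteraction_self)
      hrow hH1 s).sqrt) (Real.sqrt_pos.2 hp).ne'
  have hγ : ∀ s, Tendsto (fun n => γ n s) atTop
      (𝓝 (a (Sum.inr s) / Real.sqrt (u s * (1 - u s)))) := fun s =>
    tendsto_const_nhds.div ((tendsto_pexp_lstat_sq ht hu hb hb1 s).sqrt)
      (Real.sqrt_pos.2 (hu2 s)).ne'
  have hV := tendsto_scanVar ht hu hu0 hu1 hH1 hb1 hα hγ
  refine ⟨ge_of_tendsto' hV fun n => scanVar_nonneg _ _ _ _ _, ?_⟩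
  obtain ⟨S₁, hS₁⟩ := exists_sum_abs_le hα
  obtain ⟨S₂, hS₂⟩ := exists_sum_abs_le hγ
  refine (tendsto_avg_exp_scan κ ht (hS₁.mono fun n h => h.trans (le_max_left S₁ S₂))
    (hS₂.mono fun n h => h.trans (le_max_right S₁ S₂)) hH (fun n => unitInteraction_self) hrow hb
    (hH1.mono fun n h => h.le) (hb1.mono fun n h => h.le)
    (tendsto_sum_unitInteraction hdiag hC1 hC6 hposw) (tendsto_sum_unitRowDev hC2 hposd)
    (fun n => Real.sqrt_nonneg _) (tendsto_unitInteractionNorm hsym hdiag hC1 hC5 hC6 hposw)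
    (h3.mono fun n hn => sum_unitInteraction_mulVec_sq_le hn (hsym n) (hdiag n)) hV).congr' ?_
  filter_upwards [h3, hposw, hposd] with n hn hw hd
  rw [← Equiv.sum_comp (Equiv.inv (Equiv.Perm (Fin n)))]
  congr 1
  refine Finset.sum_congr rfl fun π _ => ?_
  congr 3
  rw [Fintype.sum_sum_type, scan, Finset.sum_add_distrib]
  congr 1 <;> refine Finset.sum_congr rfl fun s _ => ?_
  · rw [Sum.elim_inl, Zw_zero_eq hn (hsym n) (hdiag n) (ht n s) hw]
    exact div_mul_eq_mul_div _ _ _ |>.trans (mul_div_assoc _ _ _)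
  · rw [Sum.elim_inr, Zdiff_zero_eq (by omega) (hsym n) (ht n s) hd]
    exact div_mul_eq_mul_div _ _ _ |>.trans (mul_div_assoc _ _ _)

end JointLimit

lemma charFun_permDist (n : ℕ) (f : Equiv.Perm (Fin n) → ℝ) (τ : ℝ) :
    charFun (permDist n f : Measure ℝ) τ = ((n.factorial : ℝ)⁻¹ : ℝ) • ∑ π : Equiv.Perm (Fin n),
      Complex.exp (Complex.I * ((τ * f π : ℝ) : ℂ)) := by
  have hf : Measurable f := fun _ _ => trivial
  rw [charFun_apply_real, permDist, ProbabilityMeasure.toMeasure_map,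
    integral_map hf.aemeasurable (by fun_prop), integral_fintype Integrable.of_finite,
    Finset.smul_sum]
  refine Finset.sum_congr rfl fun π _ => ?_
  have h : (permP n : Measure (Equiv.Perm (Fin n))).real {π} = (n.factorial : ℝ)⁻¹ := by
    rw [permP, measureReal_def, ProbabilityMeasure.coe_mk,
      PMF.toMeasure_apply_singleton _ _ (measurableSet_singleton π)]
    simp [Fintype.card_perm]
  rw [h]
  congr 2
  push_cast
  ring

end RING

/-- (KING/DING-CPD.) If the symmetric weight matrices `K` satisfy Conditions
(C1)–(C6) (with `R` replaced by `K`) together with the additional Condition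
(C7) `max_{i,j} K_{ij} = o(n² r_d²)`, then for every `m ≥ 1` and
`0 < u_1 < … < u_m < 1`, the joint vector `(Z_w^π(⌊n·u_i⌋))_i,
(Z_diff^π(⌊n·u_i⌋))_i` converges in distribution under the permutation null to
a centered `2m`-dimensional Gaussian vector with block-diagonal covariance:
`ρ_w*(u_i,u_j)` on the `Z_w`-block, `ρ_diff*(u_i,u_j)` on the `Z_diff`-block,
and zero cross-covariances. Multivariate convergence is expressed through the
Cramér–Wold device. -/
theorem stmt15 (K : (n : ℕ) → Fin n → Fin n → ℝ)
    (hsym : ∀ n (i j : Fin n), K n i j = K n j i) (hdiag : ∀ n (i : Fin n), K n i i = 0)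
    (hC1 : Cond1 K) (hC2 : Cond2 K) (hC3 : Cond3 K) (hC4 : Cond4 K)
    (hC5 : Cond5 K) (hC6 : Cond6 K) (hC7 : Cond7 K)
    (m : ℕ) (hm : 1 ≤ m) (u : Fin m → ℝ) (hmono : StrictMono u)
    (hu0 : ∀ i, 0 < u i) (hu1 : ∀ i, u i < 1)
    (hvar : ∀ i : Fin m, ∀ᶠ n in atTop,
      0 < pvar n (fun π => Uw n (K n) π 0 ⌊(n : ℝ) * u i⌋₊)
      ∧ 0 < pvar n (fun π => Udiff n (K n) π 0 ⌊(n : ℝ) * u i⌋₊)) :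
    ∀ a : Fin m ⊕ Fin m → ℝ,
      Tendsto
        (fun n =>
          permDist n (fun π =>
            ∑ s : Fin m ⊕ Fin m,
              a s * Sum.elim (fun i => Zw n (K n) π 0 ⌊(n : ℝ) * u i⌋₊)
                (fun i => Zdiff n (K n) π 0 ⌊(n : ℝ) * u i⌋₊) s))
        atTop
        (𝓝 (gaussLimit
          (∑ i : Fin m, ∑ j : Fin m,
            (a (Sum.inl i) * a (Sum.inl j) * rhoW (u i) (u j)
              + a (Sum.inr i) * a (Sum.inr j) * rhoDiff (u i) (u j))))) := by
  intro a
  have ht : ∀ (n : ℕ) i, ⌊(n : ℝ) * u i⌋₊ ≤ n := fun n i =>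
    Nat.floor_le_of_le (mul_le_of_le_one_right n.cast_nonneg (hu1 i).le)
  have hu : ∀ i, Tendsto (fun n : ℕ => (⌊(n : ℝ) * u i⌋₊ : ℝ) / n) atTop (𝓝 (u i)) := fun i => by
    simp_rw [fun n : ℕ => mul_comm (n : ℝ) (u i)]
    exact (tendsto_nat_floor_mul_div_atTop (hu0 i).le).comp tendsto_natCast_atTop_atTop
  have hv := (hvar ⟨0, hm⟩).and (eventually_ge_atTop 3)
  have hposw : ∀ᶠ n in atTop, 0 < ∑ k, ∑ l, interaction n (K n) k l ^ 2 := hv.mono fun n h =>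
    sum_sum_interaction_sq_pos h.2 (hsym n) (hdiag n) (ht n _) h.1.1
  have hposd : ∀ᶠ n in atTop, 0 < ∑ k, rowDev n (K n) k ^ 2 := hv.mono fun n h =>
    sum_rowDev_sq_pos (by omega) (hsym n) (ht n _) h.1.2
  have key := tendsto_avg_exp_standardized hsym hdiag hC1 hC2 hC5 hC6 hposw hposd ht hu hu0 hu1
  change Tendsto _ _ (𝓝 (gaussLimit (limVar u a)))
  rw [ProbabilityMeasure.tendsto_iff_tendsto_charFun]
  intro τ
  have hτ := (key fun s => τ * a s).2
  have hlim : charFun (gaussLimit (limVar u a) : Measure ℝ) τ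
      = Complex.exp (-(limVar u fun s => τ * a s : ℂ) / 2) := by
    change charFun (gaussianReal 0 (Real.toNNReal (limVar u a))) τ = _
    rw [charFun_gaussianReal, limVar_mul, Real.coe_toNNReal _ (key a).1]
    congr 1
    push_cast
    ring
  rw [hlim]
  refine hτ.congr fun n => ?_
  rw [charFun_permDist]
  simp only [Finset.mul_sum, mul_assoc]
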